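/- Suppose that for any choice x_ε ∈ A_ε one has lim_{ε→0} x_ε = x* with x* ∈ Ω (an interior point). Then c_ε = I_ε(u_ε) = π (min_{Ω̄} q²√(det K_H)) ln(1/ε) + O(1) as ε → 0, and there exist constants R₁, R₂ > 0 such that R₁ ε ≤ diam(A_ε) ≤ R₂ ε. -/

import Mathlib

open MeasureTheory Real Filter Topology Set

noncomputable section

/-- The bilinear form `(K_H(x) a | b)` associated with the matrix
`K_H(x) = (k²+|x|²)⁻¹ [[k²+x₂², -x₁x₂],[-x₁x₂, k²+x₁²]]`. -/
def KHform (k : ℝ) (x a b : ℝ × ℝ) : ℝ :=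
  (k ^ 2 + x.1 ^ 2 + x.2 ^ 2)⁻¹ *
    ((k ^ 2 + x.2 ^ 2) * a.1 * b.1 - x.1 * x.2 * a.1 * b.2
      - x.1 * x.2 * a.2 * b.1 + (k ^ 2 + x.1 ^ 2) * a.2 * b.2)

/-- `K_H(x)` applied to a vector `a`. -/
def KHvec (k : ℝ) (x a : ℝ × ℝ) : ℝ × ℝ :=
  ((k ^ 2 + x.1 ^ 2 + x.2 ^ 2)⁻¹ * ((k ^ 2 + x.2 ^ 2) * a.1 - x.1 * x.2 * a.2),
   (k ^ 2 + x.1 ^ 2 + x.2 ^ 2)⁻¹ * (-(x.1 * x.2) * a.1 + (k ^ 2 + x.1 ^ 2) * a.2))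

/-- `det K_H(x) = k²/(k²+|x|²)`. -/
def detKH (k : ℝ) (x : ℝ × ℝ) : ℝ := k ^ 2 / (k ^ 2 + x.1 ^ 2 + x.2 ^ 2)

/-- Gradient of a scalar function on `ℝ²`. -/
def grad (u : ℝ × ℝ → ℝ) (x : ℝ × ℝ) : ℝ × ℝ :=
  (fderiv ℝ u x (1, 0), fderiv ℝ u x (0, 1))

/-- Divergence of a vector field on `ℝ²`. -/
def div2 (F : ℝ × ℝ → ℝ × ℝ) (x : ℝ × ℝ) : ℝ :=
  fderiv ℝ (fun y => (F y).1) x (1, 0) + fderiv ℝ (fun y => (F y).2) x (0, 1)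

/-- The operator `L_H u = -div (K_H(x) ∇u)`. -/
def LH (k : ℝ) (u : ℝ × ℝ → ℝ) (x : ℝ × ℝ) : ℝ :=
  - div2 (fun y => KHvec k y (grad u y)) x

/-- Positive part `t₊ = max (t, 0)`. -/
def pPart (t : ℝ) : ℝ := max t 0

/-- Clockwise rotation through `π/2`: `a^⊥`. -/
def perp2 (a : ℝ × ℝ) : ℝ × ℝ := (a.2, -a.1)

/-- Euclidean distance in the plane. -/
def dE (a b : ℝ × ℝ) : ℝ := Real.sqrt ((a.1 - b.1) ^ 2 + (a.2 - b.2) ^ 2)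

/-- Euclidean diameter of a planar set. -/
def diamE (S : Set (ℝ × ℝ)) : ℝ := sSup {d | ∃ a ∈ S, ∃ b ∈ S, d = dE a b}

/-- Euclidean distance between two planar sets. -/
def distE (A B : Set (ℝ × ℝ)) : ℝ := sInf {d | ∃ a ∈ A, ∃ b ∈ B, d = dE a b}

/-- The function `q² √(det K_H)`. -/
def Qfun (k : ℝ) (q : ℝ × ℝ → ℝ) (x : ℝ × ℝ) : ℝ := q x ^ 2 * Real.sqrt (detKH k x)

/-- Surrogate for membership in `H(Ω) = H¹₀(Ω)` (with equivalent norm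
`‖u‖² = ∫_Ω (K_H ∇u|∇u)`). -/
def MemH (k : ℝ) (Ω : Set (ℝ × ℝ)) (u : ℝ × ℝ → ℝ) : Prop :=
  ContinuousOn u (closure Ω) ∧ ContDiffOn ℝ 1 u Ω ∧ (∀ x ∈ frontier Ω, u x = 0) ∧
    IntegrableOn (fun x => KHform k x (grad u x) (grad u x)) Ω

/-- The energy functional `I_ε`. -/
def Ieps (k p ε : ℝ) (q : ℝ × ℝ → ℝ) (Ω : Set (ℝ × ℝ)) (u : ℝ × ℝ → ℝ) : ℝ :=
  (1 / 2) * (∫ x in Ω, KHform k x (grad u x) (grad u x))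
    - (1 / ((p + 1) * ε ^ 2)) * ∫ x in Ω, pPart (u x - q x * Real.log (1 / ε)) ^ (p + 1)

/-- The mountain pass value `c_ε = inf_{γ ∈ P_ε} max_{t ∈ [0,1]} I_ε(γ(t))`, where
`P_ε` is the collection of paths in `H(Ω)` (continuous for the `H`-norm) joining `0`
to a point with negative energy. -/
def ceps (k p : ℝ) (q : ℝ × ℝ → ℝ) (Ω : Set (ℝ × ℝ)) (ε : ℝ) : ℝ :=
  sInf {c | ∃ γ : ℝ → ℝ × ℝ → ℝ,
    (∀ t ∈ Icc (0:ℝ) 1, MemH k Ω (γ t)) ∧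
    (∀ t ∈ Icc (0:ℝ) 1, ∀ δ > 0, ∃ η > 0, ∀ s ∈ Icc (0:ℝ) 1, |s - t| < η →
      (∫ x in Ω, KHform k x (grad (fun y => γ s y - γ t y) x)
        (grad (fun y => γ s y - γ t y) x)) < δ) ∧
    γ 0 = (fun _ => 0) ∧ Ieps k p ε q Ω (γ 1) < 0 ∧
    c = sSup ((fun t => Ieps k p ε q Ω (γ t)) '' Icc (0:ℝ) 1)}

/-- The Nehari manifold `N_ε`. -/
def Nehari (k p ε : ℝ) (q : ℝ × ℝ → ℝ) (Ω : Set (ℝ × ℝ)) : Set (ℝ × ℝ → ℝ) :=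
  {u | MemH k Ω u ∧ ¬ Set.EqOn u 0 Ω ∧
    (∫ x in Ω, KHform k x (grad u x) (grad u x))
      = (1 / ε ^ 2) * ∫ x in Ω, pPart (u x - q x * Real.log (1 / ε)) ^ p * u x}

/-- `u` is a (classical) solution of `L_H u = ε⁻²(u - q ln(1/ε))₊ᵖ` in `Ω`, `u = 0` on `∂Ω`. -/
def IsSolution (k p ε : ℝ) (q : ℝ × ℝ → ℝ) (Ω : Set (ℝ × ℝ)) (u : ℝ × ℝ → ℝ) : Prop :=
  ContinuousOn u (closure Ω) ∧ ContDiffOn ℝ 2 u Ω ∧ (∀ x ∈ frontier Ω, u x = 0) ∧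
    ∀ x ∈ Ω, LH k u x = (1 / ε ^ 2) * pPart (u x - q x * Real.log (1 / ε)) ^ p

/-- `u` is a mountain pass solution: a solution at the mountain pass level `c_ε`. -/
def IsMPSolution (k p ε : ℝ) (q : ℝ × ℝ → ℝ) (Ω : Set (ℝ × ℝ)) (u : ℝ × ℝ → ℝ) : Prop :=
  IsSolution k p ε q Ω u ∧ MemH k Ω u ∧ Ieps k p ε q Ω u = ceps k p q Ω ε

/-- The vortex core `A_ε = {x ∈ Ω : u(x) > q(x) ln(1/ε)}`. -/
def vcore (q : ℝ × ℝ → ℝ) (Ω : Set (ℝ × ℝ)) (ε : ℝ) (u : ℝ × ℝ → ℝ) : Set (ℝ × ℝ) :=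
  {x ∈ Ω | q x * Real.log (1 / ε) < u x}

/-! ### Linear forms on the plane -/

def lin (a b : ℝ) : ℝ × ℝ →L[ℝ] ℝ :=
  a • ContinuousLinearMap.fst ℝ ℝ ℝ + b • ContinuousLinearMap.snd ℝ ℝ ℝ

@[simp] lemma lin_apply (a b : ℝ) (v : ℝ × ℝ) : lin a b v = a * v.1 + b * v.2 := by
  simp [lin]

lemma lin_of (L : ℝ × ℝ →L[ℝ] ℝ) : L = lin (L (1, 0)) (L (0, 1)) := by
  ext <;> simp

lemma hasF_of_differentiableAt {f : ℝ × ℝ → ℝ} {x : ℝ × ℝ} (h : DifferentiableAt ℝ f x) :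
    HasFDerivAt f (lin (grad f x).1 (grad f x).2) x := by
  have := h.hasFDerivAt
  rw [lin_of (fderiv ℝ f x)] at this
  exact this

lemma grad_of {f : ℝ × ℝ → ℝ} {x : ℝ × ℝ} {a b : ℝ} (h : HasFDerivAt f (lin a b) x) :
    grad f x = (a, b) := by
  simp [grad, h.fderiv]

lemma hasF_mul {f g : ℝ × ℝ → ℝ} {x : ℝ × ℝ} {a b c d : ℝ} (hf : HasFDerivAt f (lin a b) x)
    (hg : HasFDerivAt g (lin c d) x) :
    HasFDerivAt (fun y => f y * g y) (lin (f x * c + g x * a) (f x * d + g x * b)) x := by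
  convert! hf.mul hg using 1
  ext <;> simp

lemma hasF_add {f g : ℝ × ℝ → ℝ} {x : ℝ × ℝ} {a b c d : ℝ} (hf : HasFDerivAt f (lin a b) x)
    (hg : HasFDerivAt g (lin c d) x) :
    HasFDerivAt (fun y => f y + g y) (lin (a + c) (b + d)) x := by
  convert! hf.add hg using 1
  ext <;> simp

lemma hasF_sub {f g : ℝ × ℝ → ℝ} {x : ℝ × ℝ} {a b c d : ℝ} (hf : HasFDerivAt f (lin a b) x)
    (hg : HasFDerivAt g (lin c d) x) :
    HasFDerivAt (fun y => f y - g y) (lin (a - c) (b - d)) x := by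
  convert! hf.sub hg using 1
  ext <;> simp

lemma hasF_comp {f : ℝ × ℝ → ℝ} {x : ℝ × ℝ} {a b c : ℝ} {φ : ℝ → ℝ}
    (hφ : HasDerivAt φ c (f x)) (hf : HasFDerivAt f (lin a b) x) :
    HasFDerivAt (fun y => φ (f y)) (lin (c * a) (c * b)) x := by
  convert! hφ.comp_hasFDerivAt x hf using 1
  ext <;> simp

lemma hasF_const (c : ℝ) (x : ℝ × ℝ) : HasFDerivAt (fun _ : ℝ × ℝ => c) (lin 0 0) x := by
  have : lin 0 0 = 0 := by ext <;> simp
  rw [this]; exact hasFDerivAt_const c x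

lemma hasF_fst (x : ℝ × ℝ) : HasFDerivAt (fun y : ℝ × ℝ => y.1) (lin 1 0) x := by
  convert! hasFDerivAt_fst (𝕜 := ℝ) (p := x) using 1
  ext <;> simp

lemma hasF_snd (x : ℝ × ℝ) : HasFDerivAt (fun y : ℝ × ℝ => y.2) (lin 0 1) x := by
  convert! hasFDerivAt_snd (𝕜 := ℝ) (p := x) using 1
  ext <;> simp

lemma hasF_congr {f : ℝ × ℝ → ℝ} {x : ℝ × ℝ} {a b c d : ℝ} (hf : HasFDerivAt f (lin a b) x)
    (h1 : a = c) (h2 : b = d) : HasFDerivAt f (lin c d) x := by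
  subst h1 h2; exact hf

lemma div2_of {F : ℝ × ℝ → ℝ × ℝ} {x : ℝ × ℝ} {a b c d : ℝ}
    (h1 : HasFDerivAt (fun y => (F y).1) (lin a b) x)
    (h2 : HasFDerivAt (fun y => (F y).2) (lin c d) x) : div2 F x = a + d := by
  simp [div2, h1.fderiv, h2.fderiv]

/-- product rule for the divergence -/
lemma div2_smul {f : ℝ × ℝ → ℝ} {V : ℝ × ℝ → ℝ × ℝ} {x : ℝ × ℝ} (hf : DifferentiableAt ℝ f x)
    (hV : DifferentiableAt ℝ V x) :
    div2 (fun y => f y • V y) x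
      = f x * div2 V x + ((grad f x).1 * (V x).1 + (grad f x).2 * (V x).2) := by
  have h1 := hasF_of_differentiableAt hf
  have h2 := hasF_of_differentiableAt (f := fun y => (V y).1) hV.fst
  have h3 := hasF_of_differentiableAt (f := fun y => (V y).2) hV.snd
  rw [div2_of (F := fun y => f y • V y) (hasF_mul h1 h2) (hasF_mul h1 h3), div2_of h2 h3]
  ring

lemma div2_sub {V W : ℝ × ℝ → ℝ × ℝ} {x : ℝ × ℝ} (hV : DifferentiableAt ℝ V x)
    (hW : DifferentiableAt ℝ W x) :
    div2 (fun y => V y - W y) x = div2 V x - div2 W x := by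
  have h2 := hasF_of_differentiableAt (f := fun y => (V y).1) hV.fst
  have h3 := hasF_of_differentiableAt (f := fun y => (V y).2) hV.snd
  have h4 := hasF_of_differentiableAt (f := fun y => (W y).1) hW.fst
  have h5 := hasF_of_differentiableAt (f := fun y => (W y).2) hW.snd
  rw [div2_of (F := fun y => V y - W y) (hasF_sub h2 h4) (hasF_sub h3 h5), div2_of h2 h3,
    div2_of h4 h5]
  ring

/-! ### The conformal map -/

def sK (k : ℝ) (x : ℝ × ℝ) : ℝ := √(k ^ 2 + x.1 ^ 2 + x.2 ^ 2)
def eta (k : ℝ) (x : ℝ × ℝ) : ℝ := Real.exp (sK k x / k) / (k + sK k x)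
def Ym (k : ℝ) (x : ℝ × ℝ) : ℝ × ℝ := (eta k x * x.1, eta k x * x.2)
def Jac (k : ℝ) (x : ℝ × ℝ) : ℝ := eta k x ^ 2 * sK k x / k
def zf (k : ℝ) (o y : ℝ × ℝ) : ℝ := ((Ym k y).1 - o.1) ^ 2 + ((Ym k y).2 - o.2) ^ 2
def Pf (k : ℝ) (o y : ℝ × ℝ) : ℝ × ℝ :=
  (eta k y / k * (sK k y * ((Ym k y).1 - o.1)
      - y.1 * (y.1 * ((Ym k y).1 - o.1) + y.2 * ((Ym k y).2 - o.2)) / (sK k y + k)),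
   eta k y / k * (sK k y * ((Ym k y).2 - o.2)
      - y.2 * (y.1 * ((Ym k y).1 - o.1) + y.2 * ((Ym k y).2 - o.2)) / (sK k y + k)))

lemma sK_sq (k : ℝ) (x : ℝ × ℝ) : sK k x ^ 2 = k ^ 2 + x.1 ^ 2 + x.2 ^ 2 :=
  Real.sq_sqrt (by positivity)

lemma sK_ge {k : ℝ} (hk : 0 < k) (x : ℝ × ℝ) : k ≤ sK k x := by
  apply Real.le_sqrt_of_sq_le; nlinarith [sq_nonneg x.1, sq_nonneg x.2]

lemma sK_pos {k : ℝ} (hk : 0 < k) (x : ℝ × ℝ) : 0 < sK k x := hk.trans_le (sK_ge hk x)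

lemma eta_pos {k : ℝ} (hk : 0 < k) (x : ℝ × ℝ) : 0 < eta k x := by
  have := sK_pos hk x
  unfold eta; positivity

lemma Jac_pos {k : ℝ} (hk : 0 < k) (x : ℝ × ℝ) : 0 < Jac k x := by
  have := sK_pos hk x
  have := eta_pos hk x
  unfold Jac; positivity

lemma hasF_sK {k : ℝ} (hk : 0 < k) (x : ℝ × ℝ) :
    HasFDerivAt (sK k) (lin (x.1 / sK k x) (x.2 / sK k x)) x := by
  have h0 : 0 < k ^ 2 + x.1 ^ 2 + x.2 ^ 2 := by positivity
  have h1 := hasF_add (hasF_add (hasF_const (k^2) x) (hasF_mul (hasF_fst x) (hasF_fst x)))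
    (hasF_mul (hasF_snd x) (hasF_snd x))
  have h2 := hasF_comp (φ := Real.sqrt)
    (Real.hasDerivAt_sqrt (x := k ^ 2 + x.1 * x.1 + x.2 * x.2) (by nlinarith)) h1
  have e : (fun y : ℝ × ℝ => √(k ^ 2 + y.1 * y.1 + y.2 * y.2)) = sK k := by
    ext y; simp only [sK]; congr 1; ring
  rw [e] at h2
  have e2 : √(k ^ 2 + x.1 * x.1 + x.2 * x.2) = sK k x := congrFun e x
  rw [e2] at h2
  have := sK_pos hk x
  exact hasF_congr h2 (by field_simp; ring) (by field_simp; ring)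

lemma hasF_eta {k : ℝ} (hk : 0 < k) (x : ℝ × ℝ) :
    HasFDerivAt (eta k) (lin (eta k x * x.1 / (k * (sK k x + k)))
      (eta k x * x.2 / (k * (sK k x + k)))) x := by
  have hs := sK_pos hk x
  have h1 : HasDerivAt (fun s : ℝ => Real.exp (s / k) / (k + s))
      ((Real.exp (sK k x / k) * (1 / k) * (k + sK k x) - Real.exp (sK k x / k) * 1)
        / (k + sK k x) ^ 2) (sK k x) := by
    apply HasDerivAt.div
    · exact ((hasDerivAt_id (sK k x)).div_const k).exp
    · simpa using (hasDerivAt_id (sK k x)).const_add k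
    · positivity
  have h2 := hasF_comp h1 (hasF_sK hk x)
  exact hasF_congr h2 (by unfold eta; field_simp; ring) (by unfold eta; field_simp; ring)

lemma hasF_Y1 {k : ℝ} (hk : 0 < k) (x : ℝ × ℝ) :
    HasFDerivAt (fun y => (Ym k y).1) (lin (eta k x * (1 + x.1 * x.1 / (k * (sK k x + k))))
      (eta k x * (x.1 * x.2 / (k * (sK k x + k))))) x :=
  hasF_congr (hasF_mul (hasF_eta hk x) (hasF_fst x)) (by ring) (by ring)

lemma hasF_Y2 {k : ℝ} (hk : 0 < k) (x : ℝ × ℝ) :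
    HasFDerivAt (fun y => (Ym k y).2) (lin (eta k x * (x.1 * x.2 / (k * (sK k x + k))))
      (eta k x * (1 + x.2 * x.2 / (k * (sK k x + k))))) x :=
  hasF_congr (hasF_mul (hasF_eta hk x) (hasF_snd x)) (by ring) (by ring)

/-- gradient of half the squared distance -/
def gz (k : ℝ) (o y : ℝ × ℝ) : ℝ × ℝ :=
  (2 * eta k y * (((Ym k y).1 - o.1) +
      y.1 * (y.1 * ((Ym k y).1 - o.1) + y.2 * ((Ym k y).2 - o.2)) / (k * (sK k y + k))),
   2 * eta k y * (((Ym k y).2 - o.2) +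
      y.2 * (y.1 * ((Ym k y).1 - o.1) + y.2 * ((Ym k y).2 - o.2)) / (k * (sK k y + k))))

lemma hasF_zf {k : ℝ} (hk : 0 < k) (o x : ℝ × ℝ) :
    HasFDerivAt (zf k o) (lin (gz k o x).1 (gz k o x).2) x := by
  have h1 := hasF_sub (hasF_Y1 hk x) (hasF_const o.1 x)
  have h2 := hasF_sub (hasF_Y2 hk x) (hasF_const o.2 x)
  have h := hasF_add (hasF_mul h1 h1) (hasF_mul h2 h2)
  have e : (fun y : ℝ × ℝ => ((Ym k y).1 - o.1) * ((Ym k y).1 - o.1)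
      + ((Ym k y).2 - o.2) * ((Ym k y).2 - o.2)) = zf k o := by
    ext y; simp only [zf]; ring
  rw [e] at h
  exact hasF_congr h (by simp only [gz]; ring) (by simp only [gz]; ring)

lemma contDiff_sK {k : ℝ} (hk : 0 < k) : ContDiff ℝ 2 (sK k) := by
  unfold sK
  apply ContDiff.sqrt (by fun_prop)
  intro x; positivity

lemma contDiff_eta {k : ℝ} (hk : 0 < k) : ContDiff ℝ 2 (eta k) := by
  unfold eta
  have := contDiff_sK hk
  apply ContDiff.div (by fun_prop) (by fun_prop)
  intro x
  have := sK_pos hk x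
  positivity

lemma contDiff_Ym {k : ℝ} (hk : 0 < k) : ContDiff ℝ 2 (Ym k) := by
  have := contDiff_eta hk
  unfold Ym; fun_prop

lemma contDiff_zf {k : ℝ} (hk : 0 < k) (o : ℝ × ℝ) : ContDiff ℝ 2 (zf k o) := by
  have := contDiff_Ym hk
  have h1 : ContDiff ℝ 2 (fun y => (Ym k y).1) := this.fst
  have h2 : ContDiff ℝ 2 (fun y => (Ym k y).2) := this.snd
  unfold zf
  exact ((h1.sub contDiff_const).pow 2).add ((h2.sub contDiff_const).pow 2)

lemma contDiff_Pf {k : ℝ} (hk : 0 < k) (o : ℝ × ℝ) : ContDiff ℝ 2 (Pf k o) := by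
  have := contDiff_Ym hk
  have := contDiff_eta hk
  have := contDiff_sK hk
  have h : ∀ x, sK k x + k ≠ 0 := fun x => by have := sK_pos hk x; positivity
  unfold Pf
  fun_prop (disch := assumption)

lemma KHvec_gz {k : ℝ} (hk : 0 < k) (o y : ℝ × ℝ) :
    KHvec k y (gz k o y) = (2 * (k / sK k y)) • Pf k o y := by
  have hs := sK_pos hk y
  have h2 := sK_sq k y
  simp only [KHvec, gz, Pf, ← h2, Prod.smul_mk, smul_eq_mul]
  generalize (Ym k y).1 - o.1 = D1
  generalize (Ym k y).2 - o.2 = D2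
  generalize sK k y = s at *
  have hy : y.2 ^ 2 = s ^ 2 - k ^ 2 - y.1 ^ 2 := by linarith
  have hy1 : y.1 ^ 2 = s ^ 2 - k ^ 2 - y.2 ^ 2 := by linarith
  ext
  · field_simp
    ring_nf
    simp only [hy, show y.2 ^ 3 = y.2 * y.2 ^ 2 by ring]
    ring
  · field_simp
    ring_nf
    simp only [hy1, show y.1 ^ 3 = y.1 * y.1 ^ 2 by ring]
    ring

lemma Pf_dot_gz {k : ℝ} (hk : 0 < k) (o y : ℝ × ℝ) :
    (Pf k o y).1 * (gz k o y).1 + (Pf k o y).2 * (gz k o y).2 = 2 * Jac k y * zf k o y := by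
  have hs := sK_pos hk y
  have h2 := sK_sq k y
  set s := sK k y
  simp only [Pf, gz, Jac, zf]
  set D1 := (Ym k y).1 - o.1
  set D2 := (Ym k y).2 - o.2
  set w := y.1 * D1 + y.2 * D2 with hw
  have hy : y.1 ^ 2 + y.2 ^ 2 = s ^ 2 - k ^ 2 := by linarith
  have e : ∀ E : ℝ, E / k * (s * D1 - y.1 * w / (s + k)) * (2 * E * (D1 + y.1 * w / (k * (s + k))))
      + E / k * (s * D2 - y.2 * w / (s + k)) * (2 * E * (D2 + y.2 * w / (k * (s + k))))
      = 2 * E ^ 2 / k * (s * (D1 ^ 2 + D2 ^ 2) + s * w * w / (k * (s + k)) - w * w / (s + k)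
        - (y.1 ^ 2 + y.2 ^ 2) * w ^ 2 / (k * (s + k) ^ 2)) := by
    intro E; rw [hw]; field_simp; ring
  rw [e, hy]; change _ = _
  field_simp; ring

lemma div2_Pf {k : ℝ} (hk : 0 < k) (o x : ℝ × ℝ) : div2 (Pf k o) x = 2 * Jac k x := by
  have hs := sK_pos hk x
  have h2 := sK_sq k x
  have a1 := hasF_sub (hasF_Y1 hk x) (hasF_const o.1 x)
  have a2 := hasF_sub (hasF_Y2 hk x) (hasF_const o.2 x)
  have w := hasF_add (hasF_mul (hasF_fst x) a1) (hasF_mul (hasF_snd x) a2)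
  have hi : HasFDerivAt (fun y => (sK k y + k)⁻¹) _ x :=
    hasF_comp (φ := fun t => t⁻¹) (hasDerivAt_inv (x := sK k x + k) (by positivity))
      (hasF_add (hasF_sK hk x) (hasF_const k x))
  have he := hasF_mul (hasF_eta hk x) (hasF_const k⁻¹ x)
  have p1 := hasF_mul he (hasF_sub (hasF_mul (hasF_sK hk x) a1)
    (hasF_mul (hasF_mul (hasF_fst x) w) hi))
  have p2 := hasF_mul he (hasF_sub (hasF_mul (hasF_sK hk x) a2)
    (hasF_mul (hasF_mul (hasF_snd x) w) hi))
  have := div2_of (F := Pf k o) (x := x)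
    (p1.congr_of_eventuallyEq (Eventually.of_forall fun y => by simp only [Pf]; ring))
    (p2.congr_of_eventuallyEq (Eventually.of_forall fun y => by simp only [Pf]; ring))
  rw [this]
  simp only [Jac]
  have hY1 : (Ym k x).1 = eta k x * x.1 := rfl
  have hY2 : (Ym k x).2 = eta k x * x.2 := rfl
  rw [hY1, hY2]
  set s := sK k x
  set E := eta k x
  have hy : x.2 ^ 2 = s ^ 2 - k ^ 2 - x.1 ^ 2 := by linarith
  field_simp
  ring_nf
  simp only [hy, show x.2 ^ 3 = x.2 * x.2 ^ 2 by ring, show x.2 ^ 4 = (x.2 ^ 2) ^ 2 by ring]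
  ring

/-- Cauchy-Schwarz type bound. -/
lemma Pf_bound {k : ℝ} (hk : 0 < k) (o y : ℝ × ℝ) :
    (Pf k o y).1 ^ 2 + (Pf k o y).2 ^ 2 ≤ (Jac k y / eta k y) ^ 2 * zf k o y := by
  have hs := sK_pos hk y
  have he := eta_pos hk y
  have h2 := sK_sq k y
  set s := sK k y
  simp only [Pf, Jac, zf]
  set D1 := (Ym k y).1 - o.1
  set D2 := (Ym k y).2 - o.2
  set w := y.1 * D1 + y.2 * D2 with hw
  have hy : y.1 ^ 2 + y.2 ^ 2 = s ^ 2 - k ^ 2 := by linarith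
  have e : ∀ E : ℝ, (E / k * (s * D1 - y.1 * w / (s + k))) ^ 2
      + (E / k * (s * D2 - y.2 * w / (s + k))) ^ 2
      = (E / k) ^ 2 * (s ^ 2 * (D1 ^ 2 + D2 ^ 2) - 2 * s * w ^ 2 / (s + k) +
        (y.1 ^ 2 + y.2 ^ 2) * w ^ 2 / (s + k) ^ 2) := by
    intro E; rw [hw]; field_simp; ring
  rw [e, hy]
  have : (s ^ 2 - k ^ 2) * w ^ 2 / (s + k) ^ 2 - 2 * s * w ^ 2 / (s + k) = - w ^ 2 := by
    field_simp; ring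
  have e3 : eta k y ^ 2 * s / k / eta k y = eta k y / k * s := by field_simp
  rw [e3, mul_pow, mul_assoc ((eta k y / k) ^ 2)]
  apply mul_le_mul_of_nonneg_left _ (by positivity)
  nlinarith [sq_nonneg w]

def eta0 (k : ℝ) : ℝ := Real.exp 1 / (2 * k)

lemma eta0_pos {k : ℝ} (hk : 0 < k) : 0 < eta0 k := by unfold eta0; positivity

lemma eta_mono_aux {k s t : ℝ} (hk : 0 < k) (hs : 0 ≤ s) (hst : s ≤ t) :
    Real.exp (s / k) / (k + s) ≤ Real.exp (t / k) / (k + t) := by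
  rw [div_le_div_iff₀ (by positivity) (by linarith)]
  have h1 : Real.exp (t / k) = Real.exp (s / k) * Real.exp ((t - s) / k) := by
    rw [← Real.exp_add]; congr 1; field_simp; ring
  have h2 : (t - s) / k + 1 ≤ Real.exp ((t - s) / k) := Real.add_one_le_exp _
  rw [h1, mul_assoc]
  apply mul_le_mul_of_nonneg_left _ (Real.exp_pos _).le
  have h3 : k + t ≤ ((t - s) / k + 1) * (k + s) := by
    have : ((t - s) / k + 1) * (k + s) = k + t + (t - s) * s / k := by field_simp; ring
    rw [this]
    have : 0 ≤ (t - s) * s / k := by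
      have : 0 ≤ t - s := by linarith
      positivity
    linarith
  refine h3.trans ?_
  apply mul_le_mul_of_nonneg_right h2; positivity

lemma eta_mono {k : ℝ} (hk : 0 < k) {x y : ℝ × ℝ} (h : x.1 ^ 2 + x.2 ^ 2 ≤ y.1 ^ 2 + y.2 ^ 2) :
    eta k x ≤ eta k y := by
  apply eta_mono_aux hk (sK_pos hk x).le
  apply Real.sqrt_le_sqrt; linarith

lemma eta0_le {k : ℝ} (hk : 0 < k) (x : ℝ × ℝ) : eta0 k ≤ eta k x := by
  have := eta_mono_aux hk hk.le (sK_ge hk x)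
  rw [div_self hk.ne'] at this
  unfold eta0 eta; rw [two_mul]; exact this

lemma zf_expand {k : ℝ} (hk : 0 < k) (a b : ℝ × ℝ) :
    eta0 k ^ 2 * ((a.1 - b.1) ^ 2 + (a.2 - b.2) ^ 2) ≤ zf k (Ym k a) b := by
  have h0 := eta0_pos hk
  have ha := eta0_le hk a
  have hb := eta0_le hk b
  simp only [zf, Ym]
  have key : eta0 k * ((a.1 - b.1) ^ 2 + (a.2 - b.2) ^ 2) ≤
      (eta k a * a.1 - eta k b * b.1) * (a.1 - b.1) + (eta k a * a.2 - eta k b * b.2) * (a.2 - b.2) := by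
    rcases le_total (a.1 ^ 2 + a.2 ^ 2) (b.1 ^ 2 + b.2 ^ 2) with h | h
    · have := eta_mono hk h
      nlinarith [mul_nonneg (sub_nonneg.2 this) (sub_nonneg.2 h),
        mul_nonneg (sub_nonneg.2 this) (add_nonneg (sq_nonneg (a.1 - b.1)) (sq_nonneg (a.2 - b.2))),
        mul_nonneg (sub_nonneg.2 ha) (add_nonneg (sq_nonneg (a.1 - b.1)) (sq_nonneg (a.2 - b.2)))]
    · have := eta_mono hk h
      nlinarith [mul_nonneg (sub_nonneg.2 this) (sub_nonneg.2 h),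
        mul_nonneg (sub_nonneg.2 this) (add_nonneg (sq_nonneg (a.1 - b.1)) (sq_nonneg (a.2 - b.2))),
        mul_nonneg (sub_nonneg.2 hb) (add_nonneg (sq_nonneg (a.1 - b.1)) (sq_nonneg (a.2 - b.2)))]
  set u := eta k a * a.1 - eta k b * b.1
  set v := eta k a * a.2 - eta k b * b.2
  have e : (eta k b * b.1 - eta k a * a.1) ^ 2 + (eta k b * b.2 - eta k a * a.2) ^ 2 = u ^ 2 + v ^ 2 := by
    simp only [u, v]; ring
  rw [e]
  set s := a.1 - b.1
  set t := a.2 - b.2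
  rcases eq_or_lt_of_le (by positivity : 0 ≤ s ^ 2 + t ^ 2) with h | h
  · rw [← h]; nlinarith [sq_nonneg u, sq_nonneg v]
  · have hcs : (u * s + v * t) ^ 2 ≤ (u ^ 2 + v ^ 2) * (s ^ 2 + t ^ 2) := by
      nlinarith [sq_nonneg (u * t - v * s)]
    have h1 : (eta0 k * (s ^ 2 + t ^ 2)) ^ 2 ≤ (u * s + v * t) ^ 2 :=
      pow_le_pow_left₀ (by positivity) key 2
    have h2 : (eta0 k ^ 2 * (s ^ 2 + t ^ 2)) * (s ^ 2 + t ^ 2) ≤ (u ^ 2 + v ^ 2) * (s ^ 2 + t ^ 2) := by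
      nlinarith
    exact le_of_mul_le_mul_right h2 h

lemma zf_nonneg (k : ℝ) (o y : ℝ × ℝ) : 0 ≤ zf k o y := by unfold zf; positivity

lemma zf_self (k : ℝ) (y : ℝ × ℝ) : zf k (Ym k y) y = 0 := by simp [zf]

lemma zf_comm (k : ℝ) (x y : ℝ × ℝ) : zf k (Ym k x) y = zf k (Ym k y) x := by simp only [zf]; ring

lemma zf_pos {k : ℝ} (hk : 0 < k) {a b : ℝ × ℝ} (h : b ≠ a) : 0 < zf k (Ym k a) b := by
  refine lt_of_lt_of_le ?_ (zf_expand hk a b)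
  have h0 := eta0_pos hk
  have : 0 < (a.1 - b.1) ^ 2 + (a.2 - b.2) ^ 2 := by
    by_contra hc
    apply h
    have h1 : (a.1 - b.1) ^ 2 = 0 := by nlinarith [sq_nonneg (a.1 - b.1), sq_nonneg (a.2 - b.2)]
    have h2 : (a.2 - b.2) ^ 2 = 0 := by nlinarith [sq_nonneg (a.1 - b.1), sq_nonneg (a.2 - b.2)]
    rw [sq_eq_zero_iff] at h1 h2
    ext <;> linarith
  positivity

lemma Ym_injective {k : ℝ} (hk : 0 < k) : Function.Injective (Ym k) := by
  intro a b h
  by_contra hc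
  have := zf_pos hk (a := a) (b := b) (fun h' => hc h'.symm)
  rw [h, zf_self] at this
  exact lt_irrefl _ this

lemma Ym_surjective {k : ℝ} (hk : 0 < k) : Function.Surjective (Ym k) := by
  intro z
  have h0 := eta0_pos hk
  set r := √(z.1 ^ 2 + z.2 ^ 2) with hr
  have hr2 : r ^ 2 = z.1 ^ 2 + z.2 ^ 2 := Real.sq_sqrt (by positivity)
  have hr0 : 0 ≤ r := Real.sqrt_nonneg _
  have hc : ContinuousOn (fun t : ℝ => eta k (t, 0) * t) (Icc 0 (r / eta0 k)) := by
    have := (contDiff_eta hk).continuous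
    fun_prop
  have := intermediate_value_Icc (by positivity : (0:ℝ) ≤ r / eta0 k) hc
  have hmem : r ∈ Icc ((fun t : ℝ => eta k (t, 0) * t) 0) ((fun t : ℝ => eta k (t, 0) * t) (r / eta0 k)) := by
    refine ⟨by simpa using hr0, ?_⟩
    have : eta0 k * (r / eta0 k) = r := by field_simp
    calc r = eta0 k * (r / eta0 k) := this.symm
      _ ≤ _ := mul_le_mul_of_nonneg_right (eta0_le hk _) (by positivity)
  obtain ⟨t, ht, hte⟩ := this hmem
  simp only at hte
  rcases eq_or_lt_of_le hr0 with h | h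
  · refine ⟨0, ?_⟩
    rw [← h] at hr2
    have h1 : z.1 ^ 2 = 0 := by nlinarith [sq_nonneg z.1, sq_nonneg z.2]
    have h2 : z.2 ^ 2 = 0 := by nlinarith [sq_nonneg z.1, sq_nonneg z.2]
    rw [sq_eq_zero_iff] at h1 h2
    ext <;> simp [Ym, h1, h2]
  · refine ⟨(t / r * z.1, t / r * z.2), ?_⟩
    have e : eta k (t / r * z.1, t / r * z.2) = eta k (t, 0) := by
      have hs : sK k (t / r * z.1, t / r * z.2) = sK k (t, 0) := by
        simp only [sK]
        congr 1
        have : (t / r * z.1) ^ 2 + (t / r * z.2) ^ 2 = (t / r) ^ 2 * r ^ 2 := by rw [hr2]; ring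
        have h3 : (t / r) ^ 2 * r ^ 2 = t ^ 2 := by field_simp
        linarith
      simp only [eta, hs]
    simp only [Ym, e]
    ext
    · simp only
      rw [← mul_assoc, mul_div_assoc', hte, div_self h.ne', one_mul]
    · simp only
      rw [← mul_assoc, mul_div_assoc', hte, div_self h.ne', one_mul]

/-- The derivative of the conformal map. -/
def dYm (k : ℝ) (x : ℝ × ℝ) : ℝ × ℝ →L[ℝ] ℝ × ℝ :=
  (Matrix.toLin (.finTwoProd ℝ) (.finTwoProd ℝ)
    !![eta k x * (1 + x.1 * x.1 / (k * (sK k x + k))), eta k x * (x.1 * x.2 / (k * (sK k x + k)));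
      eta k x * (x.1 * x.2 / (k * (sK k x + k))),
      eta k x * (1 + x.2 * x.2 / (k * (sK k x + k)))]).toContinuousLinearMap

lemma hasF_Ym {k : ℝ} (hk : 0 < k) (x : ℝ × ℝ) : HasFDerivAt (Ym k) (dYm k x) x := by
  unfold dYm
  rw [Matrix.toLin_finTwoProd_toContinuousLinearMap]
  exact HasFDerivAt.prodMk (hasF_Y1 hk x) (hasF_Y2 hk x)

lemma det_dYm {k : ℝ} (hk : 0 < k) (x : ℝ × ℝ) : (dYm k x).det = Jac k x := by
  have hs := sK_pos hk x
  have h2 := sK_sq k x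
  rw [dYm, ContinuousLinearMap.det, LinearMap.coe_toContinuousLinearMap, LinearMap.det_toLin,
    Matrix.det_fin_two_of, Jac]
  have hy : x.1 ^ 2 + x.2 ^ 2 = sK k x ^ 2 - k ^ 2 := by linarith
  have : ∀ E s : ℝ, E * (1 + x.1 * x.1 / (k * (s + k))) * (E * (1 + x.2 * x.2 / (k * (s + k))))
      - E * (x.1 * x.2 / (k * (s + k))) * (E * (x.1 * x.2 / (k * (s + k))))
      = E ^ 2 * (1 + (x.1 ^ 2 + x.2 ^ 2) / (k * (s + k))) := by intro E s; ring
  rw [this, hy]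
  field_simp; ring

lemma cov_lintegral {k : ℝ} (hk : 0 < k) (f : ℝ × ℝ → ENNReal) :
    ∫⁻ y, ENNReal.ofReal (Jac k y) * f (Ym k y) = ∫⁻ z, f z := by
  have := lintegral_image_eq_lintegral_abs_det_fderiv_mul volume MeasurableSet.univ
    (fun x _ => (hasF_Ym hk x).hasFDerivWithinAt) (Ym_injective hk).injOn f
  rw [image_univ, (Ym_surjective hk).range_eq] at this
  simp only [Measure.restrict_univ] at this
  rw [this]
  congr 1; ext y
  rw [det_dYm hk, abs_of_pos (Jac_pos hk y)]

lemma polar_lintegral (o : ℝ × ℝ) {f : ℝ → ENNReal} (hf : Measurable f) :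
    ∫⁻ z : ℝ × ℝ, f (√((z.1 - o.1) ^ 2 + (z.2 - o.2) ^ 2))
      = ENNReal.ofReal (2 * π) * ∫⁻ r in Ioi (0:ℝ), ENNReal.ofReal r * f r := by
  have h1 := lintegral_sub_right_eq_self (μ := (volume : Measure (ℝ × ℝ)))
    (fun z : ℝ × ℝ => f (√(z.1 ^ 2 + z.2 ^ 2))) o
  simp only [Prod.fst_sub, Prod.snd_sub] at h1
  rw [h1, ← lintegral_comp_polarCoord_symm]
  have h2 : ∀ p ∈ polarCoord.target, ENNReal.ofReal p.1 • f (√((polarCoord.symm p).1 ^ 2 + (polarCoord.symm p).2 ^ 2))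
      = ENNReal.ofReal p.1 * f p.1 * 1 := by
    intro p hp
    simp only [polarCoord_target, mem_prod, mem_Ioi] at hp
    have : √((polarCoord.symm p).1 ^ 2 + (polarCoord.symm p).2 ^ 2) = p.1 := by
      simp only [polarCoord_symm_apply]
      rw [show (p.1 * cos p.2) ^ 2 + (p.1 * sin p.2) ^ 2 = p.1 ^ 2 by
        rw [mul_pow, mul_pow, ← mul_add, Real.cos_sq_add_sin_sq, mul_one]]
      exact Real.sqrt_sq hp.1.le
    rw [this, smul_eq_mul, mul_one]
  rw [setLIntegral_congr_fun polarCoord.open_target.measurableSet h2, polarCoord_target,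
    Measure.volume_eq_prod, ← Measure.prod_restrict,
    lintegral_prod_mul (f := fun r => ENNReal.ofReal r * f r) (g := fun _ => 1)
      (by fun_prop) (by fun_prop)]
  rw [mul_comm]
  congr 1
  rw [lintegral_one, Measure.restrict_apply_univ, Real.volume_Ioo]
  congr 1; ring

lemma radial_lintegral {k : ℝ} (hk : 0 < k) (o : ℝ × ℝ) {f : ℝ → ENNReal} (hf : Measurable f) :
    ∫⁻ y, ENNReal.ofReal (Jac k y) * f (√(zf k o y))
      = ENNReal.ofReal (2 * π) * ∫⁻ r in Ioi (0:ℝ), ENNReal.ofReal r * f r := by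
  rw [← polar_lintegral o hf]
  exact cov_lintegral hk (fun z => f (√((z.1 - o.1) ^ 2 + (z.2 - o.2) ^ 2)))

lemma contDiff_Jac {k : ℝ} (hk : 0 < k) : ContDiff ℝ 2 (Jac k) := by
  have := contDiff_eta hk
  have := contDiff_sK hk
  unfold Jac; fun_prop

lemma radial_integral {k : ℝ} (hk : 0 < k) (o : ℝ × ℝ) {f : ℝ → ℝ} (hf : Measurable f)
    (h0 : ∀ r, 0 ≤ f r) :
    ∫ y, Jac k y * f (√(zf k o y)) = 2 * π * ∫ r in Ioi (0:ℝ), r * f r := by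
  have hz : Measurable (zf k o) := (contDiff_zf hk o).continuous.measurable
  have hJ : Measurable (Jac k) := (contDiff_Jac hk).continuous.measurable
  rw [integral_eq_lintegral_of_nonneg_ae
    (Eventually.of_forall fun y => mul_nonneg (Jac_pos hk y).le (h0 _))
    (by apply Measurable.aestronglyMeasurable; fun_prop),
    integral_eq_lintegral_of_nonneg_ae
    ((ae_restrict_iff' measurableSet_Ioi).2 (Eventually.of_forall fun y hy => mul_nonneg (le_of_lt hy) (h0 _)))
    (by apply Measurable.aestronglyMeasurable; fun_prop)]
  have := radial_lintegral hk o (f := fun r => ENNReal.ofReal (f r)) (by fun_prop)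
  rw [show (∫⁻ y, ENNReal.ofReal (Jac k y * f √(zf k o y))) =
    ∫⁻ y, ENNReal.ofReal (Jac k y) * ENNReal.ofReal (f √(zf k o y)) by
      congr 1; ext y; rw [ENNReal.ofReal_mul (Jac_pos hk y).le], this, ENNReal.toReal_mul,
      ENNReal.toReal_ofReal (by positivity)]
  congr 2
  apply setLIntegral_congr_fun measurableSet_Ioi
  intro r hr
  simp only
  rw [ENNReal.ofReal_mul (le_of_lt hr)]

lemma radial_integrable {k : ℝ} (hk : 0 < k) (o : ℝ × ℝ) {f : ℝ → ℝ} (hf : Measurable f)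
    (h0 : ∀ r, 0 ≤ f r) (hi : IntegrableOn (fun r => r * f r) (Ioi 0)) :
    Integrable (fun y => Jac k y * f (√(zf k o y))) := by
  have hz : Measurable (zf k o) := (contDiff_zf hk o).continuous.measurable
  have hJ : Measurable (Jac k) := (contDiff_Jac hk).continuous.measurable
  refine ⟨by apply Measurable.aestronglyMeasurable; fun_prop, ?_⟩
  rw [hasFiniteIntegral_iff_ofReal
    (Eventually.of_forall fun y => mul_nonneg (Jac_pos hk y).le (h0 _))]
  have := radial_lintegral hk o (f := fun r => ENNReal.ofReal (f r)) (by fun_prop)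
  rw [show (∫⁻ y, ENNReal.ofReal (Jac k y * f √(zf k o y))) =
    ∫⁻ y, ENNReal.ofReal (Jac k y) * ENNReal.ofReal (f √(zf k o y)) by
      congr 1; ext y; rw [ENNReal.ofReal_mul (Jac_pos hk y).le], this]
  apply ENNReal.mul_lt_top ENNReal.ofReal_lt_top
  have h2 := hi.2
  rw [hasFiniteIntegral_iff_ofReal ((ae_restrict_iff' measurableSet_Ioi).2
    (Eventually.of_forall fun y hy => mul_nonneg (le_of_lt hy) (h0 _)))] at h2
  convert! h2 using 1
  apply setLIntegral_congr_fun measurableSet_Ioi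
  intro r hr
  simp only
  rw [ENNReal.ofReal_mul (le_of_lt hr)]

lemma KHform_eq (k : ℝ) (x a b : ℝ × ℝ) :
    KHform k x a b = b.1 * (KHvec k x a).1 + b.2 * (KHvec k x a).2 := by
  simp only [KHform, KHvec]; ring

lemma KHform_comm (k : ℝ) (x a b : ℝ × ℝ) : KHform k x a b = KHform k x b a := by
  simp only [KHform]; ring

lemma KHform_sq (k : ℝ) (x a : ℝ × ℝ) :
    KHform k x a a = (k ^ 2 + x.1 ^ 2 + x.2 ^ 2)⁻¹ *
      (k ^ 2 * (a.1 ^ 2 + a.2 ^ 2) + (x.2 * a.1 - x.1 * a.2) ^ 2) := by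
  simp only [KHform]; ring

lemma KHform_nonneg (k : ℝ) (x a : ℝ × ℝ) : 0 ≤ KHform k x a a := by
  rw [KHform_sq]; positivity

lemma KHform_lower {k : ℝ} (hk : 0 < k) (x a : ℝ × ℝ) :
    (k / sK k x) ^ 2 * (a.1 ^ 2 + a.2 ^ 2) ≤ KHform k x a a := by
  have hs := sK_pos hk x
  rw [KHform_sq, ← sK_sq, div_pow, div_mul_eq_mul_div, div_eq_inv_mul]
  apply mul_le_mul_of_nonneg_left _ (by positivity)
  nlinarith [sq_nonneg (x.2 * a.1 - x.1 * a.2)]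

lemma sqrt_detKH {k : ℝ} (hk : 0 < k) (x : ℝ × ℝ) : √(detKH k x) = k / sK k x := by
  rw [detKH, Real.sqrt_div (by positivity), Real.sqrt_sq hk.le]; rfl

lemma Qfun_eq {k : ℝ} (hk : 0 < k) (q : ℝ × ℝ → ℝ) (x : ℝ × ℝ) :
    Qfun k q x = q x ^ 2 * (k / sK k x) := by rw [Qfun, sqrt_detKH hk]

lemma contDiffOn_grad {u : ℝ × ℝ → ℝ} {Ω : Set (ℝ × ℝ)} (hΩ : IsOpen Ω) (hu : ContDiffOn ℝ 2 u Ω) :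
    ContDiffOn ℝ 1 (grad u) Ω := by
  have h : ContDiffOn ℝ 1 (fderiv ℝ u) Ω := hu.fderiv_of_isOpen hΩ (by norm_num)
  unfold grad
  exact (h.clm_apply contDiffOn_const).prodMk (h.clm_apply contDiffOn_const)

lemma continuousOn_grad {u : ℝ × ℝ → ℝ} {Ω : Set (ℝ × ℝ)} (hΩ : IsOpen Ω) (hu : ContDiffOn ℝ 1 u Ω) :
    ContinuousOn (grad u) Ω := by
  have h : ContinuousOn (fderiv ℝ u) Ω := hu.continuousOn_fderiv_of_isOpen hΩ (by norm_num)
  unfold grad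
  exact (h.clm_apply continuousOn_const).prodMk (h.clm_apply continuousOn_const)

lemma contDiffOn_KHvec {k : ℝ} (hk : 0 < k) {V : ℝ × ℝ → ℝ × ℝ} {Ω : Set (ℝ × ℝ)}
    (hV : ContDiffOn ℝ 1 V Ω) : ContDiffOn ℝ 1 (fun y => KHvec k y (V y)) Ω := by
  have h1 : ContDiffOn ℝ 1 (fun y => (V y).1) Ω := hV.fst
  have h2 : ContDiffOn ℝ 1 (fun y => (V y).2) Ω := hV.snd
  have h3 : ContDiffOn ℝ 1 (fun y : ℝ × ℝ => (k ^ 2 + y.1 ^ 2 + y.2 ^ 2)⁻¹) Ω := by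
    apply ContDiff.contDiffOn
    apply ContDiff.inv (by fun_prop)
    intro x; positivity
  unfold KHvec
  fun_prop

lemma contDiffOn_KHgrad {k : ℝ} (hk : 0 < k) {u : ℝ × ℝ → ℝ} {Ω : Set (ℝ × ℝ)} (hΩ : IsOpen Ω)
    (hu : ContDiffOn ℝ 2 u Ω) : ContDiffOn ℝ 1 (fun y => KHvec k y (grad u y)) Ω :=
  contDiffOn_KHvec hk (contDiffOn_grad hΩ hu)

lemma continuousOn_KHform {k : ℝ} (hk : 0 < k) {V : ℝ × ℝ → ℝ × ℝ} {Ω : Set (ℝ × ℝ)}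
    (hV : ContinuousOn V Ω) : ContinuousOn (fun y => KHform k y (V y) (V y)) Ω := by
  have h1 : ContinuousOn (fun y => (V y).1) Ω := hV.fst
  have h2 : ContinuousOn (fun y => (V y).2) Ω := hV.snd
  have h3 : ContinuousOn (fun y : ℝ × ℝ => (k ^ 2 + y.1 ^ 2 + y.2 ^ 2)⁻¹) Ω := by
    apply Continuous.continuousOn
    apply Continuous.inv₀ (by fun_prop)
    intro x; positivity
  unfold KHform
  fun_prop

/-- smooth compactly supported functions have vanishing integral of derivatives -/
lemma integral_fderiv_zero {f : ℝ × ℝ → ℝ} (hf : ContDiff ℝ 1 f) (hc : HasCompactSupport f)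
    (v : ℝ × ℝ) : Integrable (fun x => fderiv ℝ f x v) ∧ ∫ x, fderiv ℝ f x v = 0 := by
  have h1 : Continuous (fun x => fderiv ℝ f x v) := by
    have := hf.continuous_fderiv (by norm_num)
    fun_prop
  have h2 : HasCompactSupport (fun x => fderiv ℝ f x v) := hc.fderiv_apply ℝ v
  have hi := h1.integrable_of_hasCompactSupport (μ := volume) h2
  refine ⟨hi, ?_⟩
  have := integral_mul_fderiv_eq_neg_fderiv_mul_of_integrable (μ := (volume : Measure (ℝ × ℝ)))
    (f := fun _ => (1:ℝ)) (g := f) (v := v) (by simp) (by simpa using hi)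
    (by simpa using hf.continuous.integrable_of_hasCompactSupport (μ := volume) hc)
    (by intros; fun_prop) (fun x _ => (hf.differentiable (by norm_num)) x)
  simpa using this

lemma ibp {F : ℝ × ℝ → ℝ × ℝ} {Ω C : Set (ℝ × ℝ)} (hΩ : IsOpen Ω) (hF : ContDiffOn ℝ 1 F Ω)
    (hC : IsCompact C) (hCΩ : C ⊆ Ω) (h0 : ∀ x ∈ Ω, x ∉ C → F x = 0) :
    IntegrableOn (div2 F) Ω ∧ ∫ x in Ω, div2 F x = 0 := by
  classical
  set G : ℝ × ℝ → ℝ × ℝ := Ω.indicator F with hG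
  have hGe : ∀ x ∈ Ω, G =ᶠ[𝓝 x] F := fun x hx => by
    filter_upwards [hΩ.mem_nhds hx] with y hy
    simp [hG, hy]
  have hG0 : ∀ x, x ∉ C → G x = 0 := fun x hx => by
    by_cases h : x ∈ Ω
    · simp [hG, h, h0 x h hx]
    · simp [hG, h]
  have hGd : ContDiff ℝ 1 G := by
    rw [contDiff_iff_contDiffAt]
    intro x
    by_cases h : x ∈ Ω
    · exact ((hF.contDiffAt (hΩ.mem_nhds h))).congr_of_eventuallyEq (hGe x h)
    · have : G =ᶠ[𝓝 x] fun _ => 0 := by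
        filter_upwards [hC.isClosed.isOpen_compl.mem_nhds (fun h' => h (hCΩ h'))] with y hy
        exact hG0 y hy
      exact contDiffAt_const.congr_of_eventuallyEq this
  have c1 : HasCompactSupport (fun y => (G y).1) :=
    HasCompactSupport.intro hC (fun x hx => by simp [hG0 x hx])
  have c2 : HasCompactSupport (fun y => (G y).2) :=
    HasCompactSupport.intro hC (fun x hx => by simp [hG0 x hx])
  obtain ⟨i1, e1⟩ := integral_fderiv_zero hGd.fst c1 (1, 0)
  obtain ⟨i2, e2⟩ := integral_fderiv_zero hGd.snd c2 (0, 1)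
  have hdiv : ∀ x ∈ Ω, div2 F x = div2 G x := fun x hx => by
    have h1 : (fun y => (F y).1) =ᶠ[𝓝 x] (fun y => (G y).1) := by
      filter_upwards [hGe x hx] with y hy; rw [hy]
    have h2 : (fun y => (F y).2) =ᶠ[𝓝 x] (fun y => (G y).2) := by
      filter_upwards [hGe x hx] with y hy; rw [hy]
    simp only [div2, h1.fderiv_eq, h2.fderiv_eq]
  have hi : Integrable (div2 G) := i1.add i2
  have hz : ∫ x, div2 G x = 0 := by
    have := integral_add i1 i2
    rw [e1, e2, add_zero] at this
    exact this
  have hz2 : ∀ x, x ∉ Ω → div2 G x = 0 := fun x hx => by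
    have : ∀ᶠ y in 𝓝 x, G y = 0 := by
      filter_upwards [hC.isClosed.isOpen_compl.mem_nhds (fun h' => hx (hCΩ h'))] with y hy
      exact hG0 y hy
    have h1 : (fun y => (G y).1) =ᶠ[𝓝 x] (fun y => 0) := by
      filter_upwards [this] with y hy; simp [hy]
    have h2 : (fun y => (G y).2) =ᶠ[𝓝 x] (fun y => 0) := by
      filter_upwards [this] with y hy; simp [hy]
    simp only [div2, h1.fderiv_eq, h2.fderiv_eq]; simp
  constructor
  · exact hi.integrableOn.congr_fun (fun x hx => (hdiv x hx).symm) hΩ.measurableSet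
  · rw [setIntegral_congr_fun hΩ.measurableSet hdiv, setIntegral_eq_integral_of_forall_compl_eq_zero hz2, hz]

/-! cutoffs -/
def thB (t : ℝ) : ℝ := t * expNegInvGlue t
def thB1 (t : ℝ) : ℝ := (1 + t⁻¹) * expNegInvGlue t
def thB2 (t : ℝ) : ℝ := (t⁻¹) ^ 3 * expNegInvGlue t

open Polynomial in
lemma hasDeriv_thB (t : ℝ) : HasDerivAt thB (thB1 t) t := by
  have h := expNegInvGlue.hasDerivAt_polynomial_eval_inv_mul 1 t
  simp at h
  have h2 := (hasDerivAt_id t).mul h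
  have e : (id * expNegInvGlue) = thB := by ext x; simp [thB]
  rw [e] at h2
  convert! h2 using 1
  simp only [thB1, id]
  by_cases ht : t = 0
  · simp [ht]
  · field_simp

open Polynomial in
lemma hasDeriv_thB1 (t : ℝ) : HasDerivAt thB1 (thB2 t) t := by
  have h := expNegInvGlue.hasDerivAt_polynomial_eval_inv_mul (1 + X) t
  simp at h
  convert! h using 1
  simp only [thB2]; ring

open Polynomial in
lemma continuous_thB2 : Continuous thB2 := by
  have := expNegInvGlue.continuous_polynomial_eval_inv_mul (X ^ 3)
  have e : thB2 = fun x => (x ^ 3)⁻¹ * expNegInvGlue x := by ext x; simp [thB2]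
  rw [e]; simpa using this

lemma thB2_nonneg (t : ℝ) : 0 ≤ thB2 t := by
  rcases le_or_gt t 0 with h | h
  · simp [thB2, expNegInvGlue.zero_of_nonpos h]
  · have := expNegInvGlue.nonneg t
    unfold thB2; positivity

lemma thB1_nonneg (t : ℝ) : 0 ≤ thB1 t := by
  rcases le_or_gt t 0 with h | h
  · simp [thB1, expNegInvGlue.zero_of_nonpos h]
  · have := expNegInvGlue.nonneg t
    unfold thB1; positivity

lemma thB1_le (t : ℝ) : thB1 t ≤ 1 := by
  rcases le_or_gt t 0 with h | h
  · simp [thB1, expNegInvGlue.zero_of_nonpos h]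
  · rw [thB1, expNegInvGlue, if_neg (not_le.2 h), Real.exp_neg, ← div_eq_mul_inv,
      div_le_one (Real.exp_pos _)]
    linarith [Real.add_one_le_exp t⁻¹]

lemma thB_nonneg (t : ℝ) : 0 ≤ thB t := by
  rcases le_or_gt t 0 with h | h
  · simp [thB, expNegInvGlue.zero_of_nonpos h]
  · have := expNegInvGlue.nonneg t
    unfold thB; positivity

lemma thB_ge (t : ℝ) : t - 1 ≤ thB t := by
  rcases le_or_gt t 0 with h | h
  · have := thB_nonneg t; linarith
  · rw [thB, expNegInvGlue, if_neg (not_le.2 h)]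
    have := Real.add_one_le_exp (-t⁻¹)
    have h2 : t * (-t⁻¹ + 1) = t - 1 := by field_simp; ring
    nlinarith

lemma thB_le (t : ℝ) (ht : 0 ≤ t) : thB t ≤ t := by
  rcases eq_or_lt_of_le ht with h | h
  · simp [thB, ← h]
  · rw [thB, expNegInvGlue, if_neg (not_le.2 h)]
    have : Real.exp (-t⁻¹) ≤ 1 := Real.exp_le_one_iff.2 (by simp [ht])
    nlinarith

def Th (δ t : ℝ) : ℝ := δ * thB (t / δ - 1)
def Th1 (δ t : ℝ) : ℝ := thB1 (t / δ - 1)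
def Th2 (δ t : ℝ) : ℝ := thB2 (t / δ - 1) / δ

lemma hasDeriv_aux (δ t : ℝ) : HasDerivAt (fun t => t / δ - 1) (1 / δ) t :=
  ((hasDerivAt_id t).div_const δ).sub_const 1

lemma hasDeriv_Th {δ : ℝ} (hδ : 0 < δ) (t : ℝ) : HasDerivAt (Th δ) (Th1 δ t) t := by
  have h : HasDerivAt (fun t => thB (t / δ - 1)) (thB1 (t / δ - 1) * (1 / δ)) t :=
    HasDerivAt.comp (h₂ := thB) t (hasDeriv_thB (t / δ - 1)) (hasDeriv_aux δ t)
  have := h.const_mul δ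
  convert! this using 1
  unfold Th1; field_simp

lemma hasDeriv_Th1 (δ : ℝ) (t : ℝ) : HasDerivAt (Th1 δ) (Th2 δ t) t := by
  have h : HasDerivAt (fun t => thB1 (t / δ - 1)) (thB2 (t / δ - 1) * (1 / δ)) t :=
    HasDerivAt.comp (h₂ := thB1) t (hasDeriv_thB1 (t / δ - 1)) (hasDeriv_aux δ t)
  convert! h using 1
  unfold Th2; ring

lemma contDiff_of_hasDeriv {f f' : ℝ → ℝ} {n : ℕ} (h : ∀ t, HasDerivAt f (f' t) t)
    (h' : ContDiff ℝ n f') : ContDiff ℝ ((n : ℕ∞) + 1) f := by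
  have e : deriv f = f' := funext fun t => (h t).deriv
  have := contDiff_succ_iff_deriv (𝕜 := ℝ) (n := (n : WithTop ℕ∞)) (f := f)
  refine this.2 ⟨fun t => (h t).differentiableAt, by simp, by rw [e]; exact h'⟩

lemma contDiff_Th1 (δ : ℝ) : ContDiff ℝ 1 (Th1 δ) := by
  have := contDiff_of_hasDeriv (n := 0) (hasDeriv_Th1 δ) (by
    rw [Nat.cast_zero, contDiff_zero]
    have := continuous_thB2
    unfold Th2; fun_prop)
  simpa using this

lemma contDiff_Th {δ : ℝ} (hδ : 0 < δ) : ContDiff ℝ 2 (Th δ) := by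
  have := contDiff_of_hasDeriv (n := 1) (hasDeriv_Th hδ) (by simpa using contDiff_Th1 δ)
  convert! this using 1

lemma Th_zero {δ t : ℝ} (hδ : 0 < δ) (h : t ≤ δ) : Th δ t = 0 := by
  have : t / δ - 1 ≤ 0 := by rw [sub_nonpos, div_le_one hδ]; exact h
  simp [Th, thB, expNegInvGlue.zero_of_nonpos this]

lemma Th1_zero {δ t : ℝ} (hδ : 0 < δ) (h : t ≤ δ) : Th1 δ t = 0 := by
  have : t / δ - 1 ≤ 0 := by rw [sub_nonpos, div_le_one hδ]; exact h
  simp [Th1, thB1, expNegInvGlue.zero_of_nonpos this]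

lemma Th_nonneg {δ : ℝ} (hδ : 0 < δ) (t : ℝ) : 0 ≤ Th δ t := mul_nonneg hδ.le (thB_nonneg _)
lemma Th1_nonneg (δ t : ℝ) : 0 ≤ Th1 δ t := thB1_nonneg _
lemma Th1_le (δ t : ℝ) : Th1 δ t ≤ 1 := thB1_le _
lemma Th2_nonneg {δ : ℝ} (hδ : 0 < δ) (t : ℝ) : 0 ≤ Th2 δ t := div_nonneg (thB2_nonneg _) hδ.le
lemma Th_ge {δ : ℝ} (hδ : 0 < δ) (t : ℝ) : t - 2 * δ ≤ Th δ t := by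
  have := mul_le_mul_of_nonneg_left (thB_ge (t / δ - 1)) hδ.le
  have h : δ * (t / δ - 1 - 1) = t - 2 * δ := by field_simp; ring
  unfold Th; linarith
lemma Th_le {δ : ℝ} (hδ : 0 < δ) {t : ℝ} (ht : 0 ≤ t) : Th δ t ≤ t := by
  rcases le_or_gt t δ with h | h
  · rw [Th_zero hδ h]; exact ht
  · have h0 : 0 ≤ t / δ - 1 := by rw [sub_nonneg, le_div_iff₀ hδ]; linarith
    have := mul_le_mul_of_nonneg_left (thB_le _ h0) hδ.le
    have h : δ * (t / δ - 1) = t - δ := by field_simp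
    unfold Th; linarith

/-- superlevel sets are compact in the domain -/
lemma superlevel {Ω : Set (ℝ × ℝ)} (hΩ : IsOpen Ω) (hb : Bornology.IsBounded Ω) {u g : ℝ × ℝ → ℝ}
    (hu : ContinuousOn u (closure Ω)) (hg : ContinuousOn g (closure Ω))
    (hu0 : ∀ x ∈ frontier Ω, u x = 0) (hg0 : ∀ x ∈ closure Ω, 0 < g x) :
    IsCompact {x ∈ closure Ω | g x ≤ u x} ∧ {x ∈ closure Ω | g x ≤ u x} ⊆ Ω := by
  have hc : IsCompact (closure Ω) := hb.isCompact_closure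
  constructor
  · apply hc.of_isClosed_subset _ (fun x hx => hx.1)
    have := (hu.sub hg).preimage_isClosed_of_isClosed isClosed_closure (isClosed_Ici (a := (0:ℝ)))
    convert this using 1
    ext x; simp
  · rintro x ⟨hx, hxu⟩
    by_contra h
    have hf : x ∈ frontier Ω := by rw [hΩ.frontier_eq]; exact ⟨hx, h⟩
    have := hg0 x hx
    rw [hu0 x hf] at hxu
    linarith

structure Setup (k : ℝ) (Ω : Set (ℝ × ℝ)) (q : ℝ × ℝ → ℝ) : Prop where
  hk : 0 < k
  hΩ : IsOpen Ω
  hb : Bornology.IsBounded Ω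
  hq1 : ContDiffOn ℝ 2 q Ω
  hq2 : ContDiffOn ℝ 1 q (closure Ω)
  hq3 : ∀ x ∈ closure Ω, 0 < q x
  hq4 : ∀ x ∈ Ω, LH k q x = 0

lemma Setup.cpt {k : ℝ} {Ω : Set (ℝ × ℝ)} {q : ℝ × ℝ → ℝ} (S : Setup k Ω q) :
    IsCompact (closure Ω) := S.hb.isCompact_closure

lemma Setup.qpos {k : ℝ} {Ω : Set (ℝ × ℝ)} {q : ℝ × ℝ → ℝ} (S : Setup k Ω q) {x : ℝ × ℝ}
    (hx : x ∈ Ω) : 0 < q x := S.hq3 x (subset_closure hx)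

lemma Setup.qd {k : ℝ} {Ω : Set (ℝ × ℝ)} {q : ℝ × ℝ → ℝ} (S : Setup k Ω q) {x : ℝ × ℝ}
    (hx : x ∈ Ω) : DifferentiableAt ℝ q x :=
  (S.hq1.contDiffAt (S.hΩ.mem_nhds hx)).differentiableAt (by norm_num)

lemma cpt_lower {K : Set (ℝ × ℝ)} (hK : IsCompact K) {f : ℝ × ℝ → ℝ} (hf : ContinuousOn f K)
    (h0 : ∀ x ∈ K, 0 < f x) : ∃ m > 0, ∀ x ∈ K, m ≤ f x := by
  rcases K.eq_empty_or_nonempty with h | h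
  · exact ⟨1, one_pos, by simp [h]⟩
  · obtain ⟨a, ha, hm⟩ := hK.exists_isMinOn h hf
    exact ⟨f a, h0 a ha, fun x hx => hm hx⟩

lemma cpt_upper {K : Set (ℝ × ℝ)} (hK : IsCompact K) {f : ℝ × ℝ → ℝ} (hf : ContinuousOn f K) :
    ∃ M > 0, ∀ x ∈ K, |f x| ≤ M := by
  obtain ⟨C, hC⟩ := hK.exists_bound_of_continuousOn hf
  refine ⟨max C 1, by positivity, fun x hx => (hC x hx).trans (le_max_left _ _)⟩

lemma grad_bound {Ω : Set (ℝ × ℝ)} (hΩ : IsOpen Ω) (hc : IsCompact (closure Ω)) {q : ℝ × ℝ → ℝ}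
    (hq : ContDiffOn ℝ 1 q (closure Ω)) : ∃ M > 0, ∀ x ∈ Ω, ‖fderiv ℝ q x‖ ≤ M := by
  have : ∃ M, ∀ x ∈ Ω ∩ closure Ω, ‖fderiv ℝ q x‖ ≤ M := by
    refine IsCompact.induction_on (p := fun s => ∃ M, ∀ x ∈ Ω ∩ s, ‖fderiv ℝ q x‖ ≤ M) hc ?_ ?_ ?_ ?_
    · exact ⟨0, by simp⟩
    · intro s t hst ht
      obtain ⟨M, hM⟩ := ht
      exact ⟨M, fun x hx => hM x ⟨hx.1, hst hx.2⟩⟩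
    · intro s t h1 h2
      obtain ⟨M, hM⟩ := h1
      obtain ⟨N, hN⟩ := h2
      refine ⟨max M N, fun x hx => ?_⟩
      rcases hx.2 with h | h
      · exact (hM x ⟨hx.1, h⟩).trans (le_max_left _ _)
      · exact (hN x ⟨hx.1, h⟩).trans (le_max_right _ _)
    · intro x hx
      have h1 := hq x hx
      have h1' : ContDiffWithinAt ℝ (0 + 1) q (closure Ω) x := by simpa using h1
      rw [contDiffWithinAt_succ_iff_hasFDerivWithinAt (by simp)] at h1'
      obtain ⟨v, hv, -, f', hf', hcf⟩ := h1'
      rw [insert_eq_of_mem hx] at hv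
      have hcont := hcf.continuousWithinAt.norm
      have h2 : ∀ᶠ y in 𝓝[v] x, ‖f' y‖ < ‖f' x‖ + 1 :=
        hcont.eventually_lt_const (by linarith)
      have h3 : 𝓝[closure Ω] x ≤ 𝓝[v] x := by
        rw [nhdsWithin_le_iff]; exact hv
      have h4 : ∀ᶠ y in 𝓝[closure Ω] x, y ∈ v ∧ ‖f' y‖ < ‖f' x‖ + 1 := (show ∀ᶠ y in 𝓝[closure Ω] x, y ∈ v from hv).and (h3 h2)
      rw [eventually_nhdsWithin_iff] at h4
      obtain ⟨O, hO, hOo, hxO⟩ := eventually_nhds_iff.1 h4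
      refine ⟨O ∩ closure Ω, by rw [inter_comm]; exact inter_mem_nhdsWithin _ (hOo.mem_nhds hxO), ‖f' x‖ + 1, fun y hy => ?_⟩
      have hyv := hO y hy.2.1 hy.2.2
      have hvn : v ∈ 𝓝 y := by
        filter_upwards [hOo.mem_nhds hy.2.1, hΩ.mem_nhds hy.1] with w hw hw2
        exact (hO w hw (subset_closure hw2)).1
      have := ((hf' y hyv.1).hasFDerivAt hvn).fderiv
      rw [this]; exact hyv.2.le
  obtain ⟨M, hM⟩ := this
  exact ⟨max M 1, by positivity, fun x hx => (hM x ⟨hx, subset_closure hx⟩).trans (le_max_left _ _)⟩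

lemma grad_abs {f : ℝ × ℝ → ℝ} {x : ℝ × ℝ} {M : ℝ} (h : ‖fderiv ℝ f x‖ ≤ M) :
    |(grad f x).1| ≤ M ∧ |(grad f x).2| ≤ M := by
  constructor
  · have := (fderiv ℝ f x).le_opNorm (1, 0)
    simp [Prod.norm_def] at this
    exact this.trans h
  · have := (fderiv ℝ f x).le_opNorm (0, 1)
    simp [Prod.norm_def] at this
    exact this.trans h

lemma contDiff_sig {k : ℝ} (hk : 0 < k) : ContDiff ℝ 2 (fun x => k / sK k x) := by
  have := contDiff_sK hk
  exact contDiff_const.div this (fun x => (sK_pos hk x).ne')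

lemma Qfun_contDiffOn {k : ℝ} {Ω : Set (ℝ × ℝ)} {q : ℝ × ℝ → ℝ} (S : Setup k Ω q) :
    ContDiffOn ℝ 2 (Qfun k q) Ω := by
  have e : Qfun k q = fun x => q x ^ 2 * (k / sK k x) := funext (Qfun_eq S.hk q)
  rw [e]
  exact (S.hq1.pow 2).mul (contDiff_sig S.hk).contDiffOn

lemma Qfun_continuousOn {k : ℝ} {Ω : Set (ℝ × ℝ)} {q : ℝ × ℝ → ℝ} (S : Setup k Ω q) :
    ContinuousOn (Qfun k q) (closure Ω) := by
  have e : Qfun k q = fun x => q x ^ 2 * (k / sK k x) := funext (Qfun_eq S.hk q)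
  rw [e]
  exact (S.hq2.continuousOn.pow 2).mul (contDiff_sig S.hk).continuous.continuousOn

lemma Qfun_pos {k : ℝ} {Ω : Set (ℝ × ℝ)} {q : ℝ × ℝ → ℝ} (S : Setup k Ω q) {x : ℝ × ℝ}
    (hx : x ∈ closure Ω) : 0 < Qfun k q x := by
  have := S.hq3 x hx
  have := sK_pos S.hk x
  have := S.hk
  rw [Qfun_eq S.hk]; positivity

/-- logarithmic gradient bound for `Q` -/
lemma Qfun_grad {k : ℝ} {Ω : Set (ℝ × ℝ)} {q : ℝ × ℝ → ℝ} (S : Setup k Ω q) :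
    ∃ L > 0, ∀ x ∈ Ω, |(grad (Qfun k q) x).1| ≤ L * Qfun k q x ∧
      |(grad (Qfun k q) x).2| ≤ L * Qfun k q x := by
  have hk := S.hk
  obtain ⟨M, hM0, hM⟩ := grad_bound S.hΩ S.cpt S.hq2
  obtain ⟨N, hN0, hN⟩ := grad_bound S.hΩ S.cpt (((contDiff_sig hk).of_le (by norm_num)).contDiffOn)
  obtain ⟨m, hm0, hm⟩ := cpt_lower S.cpt S.hq2.continuousOn S.hq3
  obtain ⟨s, hs0, hs⟩ := cpt_lower S.cpt (contDiff_sig hk).continuous.continuousOn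
    (fun x _ => div_pos hk (sK_pos hk x))
  refine ⟨2 * M / m + N / s, by positivity, fun x hx => ?_⟩
  have hxc := subset_closure hx
  have hq := hasF_of_differentiableAt (S.qd hx)
  have hσ := hasF_of_differentiableAt (((contDiff_sig hk).differentiable (by norm_num)) x)
  have h := hasF_mul (hasF_mul hq hq) hσ
  have e : (fun y => q y * q y * (k / sK k y)) = Qfun k q := by
    ext y; rw [Qfun_eq hk]; ring
  rw [e] at h
  rw [grad_of h, Qfun_eq hk]
  obtain ⟨a1, a2⟩ := grad_abs (hM x hx)
  obtain ⟨b1, b2⟩ := grad_abs (hN x hx)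
  have hqx := hm x hxc
  have hsx := hs x hxc
  set σ := k / sK k x
  set Q := q x
  have hQ : 0 < Q := hm0.trans_le hqx
  have hσ0 : 0 < σ := hs0.trans_le hsx
  have key : ∀ a b : ℝ, |a| ≤ M → |b| ≤ N →
      |Q * Q * b + σ * (Q * a + Q * a)| ≤ (2 * M / m + N / s) * (Q ^ 2 * σ) := by
    intro a b ha hb
    calc |Q * Q * b + σ * (Q * a + Q * a)| = |Q * Q * b + (2 * σ * Q) * a| := by congr 1; ring
      _ ≤ |Q * Q * b| + |(2 * σ * Q) * a| := abs_add_le _ _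
      _ = Q * Q * |b| + (2 * σ * Q) * |a| := by
        rw [abs_mul, abs_mul (2 * σ * Q), abs_of_pos (by positivity : 0 < Q * Q),
          abs_of_pos (by positivity : 0 < 2 * σ * Q)]
      _ ≤ Q * Q * (N / s * σ) + (2 * σ * Q) * (M / m * Q) := by
        gcongr
        · refine hb.trans ?_
          rw [div_mul_eq_mul_div, le_div_iff₀ hs0]; gcongr
        · refine ha.trans ?_
          rw [div_mul_eq_mul_div, le_div_iff₀ hm0]; gcongr
      _ = _ := by ring
  exact ⟨key _ _ a1 b1, key _ _ a2 b2⟩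

/-- bounds on distances -/
lemma zf_bdd {k : ℝ} {Ω : Set (ℝ × ℝ)} {q : ℝ × ℝ → ℝ} (S : Setup k Ω q) :
    ∃ D > 0, ∀ x ∈ closure Ω, ∀ y ∈ closure Ω, zf k (Ym k x) y ≤ D := by
  have hk := S.hk
  have hc := (contDiff_Ym hk).continuous
  obtain ⟨M, hM0, hM⟩ := cpt_upper S.cpt (f := fun x => (Ym k x).1) hc.fst.continuousOn
  obtain ⟨N, hN0, hN⟩ := cpt_upper S.cpt (f := fun x => (Ym k x).2) hc.snd.continuousOn
  refine ⟨(2 * M) ^ 2 + (2 * N) ^ 2, by positivity, fun x hx y hy => ?_⟩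
  unfold zf
  have a1 := abs_le.1 (hM x hx)
  have a2 := abs_le.1 (hM y hy)
  have b1 := abs_le.1 (hN x hx)
  have b2 := abs_le.1 (hN y hy)
  apply add_le_add
  · apply sq_le_sq'  <;> linarith
  · apply sq_le_sq'  <;> linarith

lemma Jac_bdd {k : ℝ} {Ω : Set (ℝ × ℝ)} {q : ℝ × ℝ → ℝ} (S : Setup k Ω q) :
    ∃ a > 0, ∃ b > 0, ∀ x ∈ closure Ω, a ≤ Jac k x ∧ Jac k x ≤ b := by
  have hk := S.hk
  have hc := (contDiff_Jac hk).continuous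
  obtain ⟨a, ha, h1⟩ := cpt_lower S.cpt hc.continuousOn (fun x _ => Jac_pos hk x)
  obtain ⟨b, hb, h2⟩ := cpt_upper S.cpt hc.continuousOn
  exact ⟨a, ha, b, hb, fun x hx => ⟨h1 x hx, (le_abs_self _).trans (h2 x hx)⟩⟩

lemma q_bdd {k : ℝ} {Ω : Set (ℝ × ℝ)} {q : ℝ × ℝ → ℝ} (S : Setup k Ω q) :
    ∃ a > 0, ∃ b > 0, ∀ x ∈ closure Ω, a ≤ q x ∧ q x ≤ b := by
  obtain ⟨a, ha, h1⟩ := cpt_lower S.cpt S.hq2.continuousOn S.hq3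
  obtain ⟨b, hb, h2⟩ := cpt_upper S.cpt S.hq2.continuousOn
  exact ⟨a, ha, b, hb, fun x hx => ⟨h1 x hx, (le_abs_self _).trans (h2 x hx)⟩⟩

/-- approximate identity -/
def kerf (r0 τ r : ℝ) : ℝ := if r < r0 then 2 * τ ^ 2 / (r ^ 2 + τ ^ 2) ^ 2 else 0

lemma kerf_meas (r0 τ : ℝ) : Measurable (kerf r0 τ) := by
  unfold kerf
  exact Measurable.ite measurableSet_Iio (by fun_prop) (by fun_prop)

lemma kerf_nonneg (r0 τ r : ℝ) : 0 ≤ kerf r0 τ r := by unfold kerf; split_ifs <;> positivity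

lemma int_rad {f : ℝ → ℝ} {r0 : ℝ} (hr : 0 < r0) (g : ℝ → ℝ) (hf : ∀ r, f r = if r < r0 then g r else 0)
     (hg : IntervalIntegrable (fun r => r * g r) volume 0 r0) :
    IntegrableOn (fun r => r * f r) (Ioi 0) ∧ ∫ r in Ioi (0:ℝ), r * f r = ∫ r in (0:ℝ)..r0, r * g r := by
  have e : (fun r => r * f r) = (Iio r0).indicator (fun r => r * g r) := by
    ext r; rw [hf]; by_cases h : r < r0 <;> simp [h]
  rw [e]
  have h1 : IntegrableOn (fun r => r * g r) (Ioi 0 ∩ Iio r0) := by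
    rw [Ioi_inter_Iio, ← integrableOn_Ioc_iff_integrableOn_Ioo]
    exact (intervalIntegrable_iff_integrableOn_Ioc_of_le hr.le).1 hg
  constructor
  · rw [IntegrableOn, integrable_indicator_iff measurableSet_Iio, IntegrableOn,
      Measure.restrict_restrict measurableSet_Iio, inter_comm]
    exact h1
  · rw [setIntegral_indicator measurableSet_Iio, Ioi_inter_Iio, intervalIntegral.integral_of_le hr.le,
      integral_Ioc_eq_integral_Ioo]

lemma kerf_int {r0 τ : ℝ} (hr : 0 < r0) (hτ : 0 < τ) :
    IntegrableOn (fun r => r * kerf r0 τ r) (Ioi 0) ∧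
    ∫ r in Ioi (0:ℝ), r * kerf r0 τ r = r0 ^ 2 / (r0 ^ 2 + τ ^ 2) := by
  have hcont : Continuous (fun r : ℝ => r * (2 * τ ^ 2 / (r ^ 2 + τ ^ 2) ^ 2)) := by
    apply continuous_id.mul
    apply Continuous.div (by fun_prop) (by fun_prop)
    intro x; positivity
  have := int_rad (f := kerf r0 τ) hr (fun r => 2 * τ ^ 2 / (r ^ 2 + τ ^ 2) ^ 2) (fun r => rfl)
    (hcont.intervalIntegrable _ _)
  refine ⟨this.1, ?_⟩
  rw [this.2]
  have hd : ∀ r ∈ uIcc 0 r0, HasDerivAt (fun r : ℝ => -τ ^ 2 * (r ^ 2 + τ ^ 2)⁻¹)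
      (r * (2 * τ ^ 2 / (r ^ 2 + τ ^ 2) ^ 2)) r := by
    intro r _
    have h1 : HasDerivAt (fun r : ℝ => r ^ 2 + τ ^ 2) (2 * r) r := by
      simpa using ((hasDerivAt_id r).pow 2).add_const (τ ^ 2)
    have := (h1.inv (by positivity)).const_mul (-τ ^ 2)
    convert! this using 1
    field_simp
  rw [intervalIntegral.integral_eq_sub_of_hasDerivAt hd (hcont.intervalIntegrable _ _)]
  field_simp; ring

def Gf (c B τ z : ℝ) : ℝ := -(1 / 2) * Real.log (z + τ ^ 2) - Real.exp (c * √(z + τ ^ 2)) + B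
def G1 (c τ z : ℝ) : ℝ :=
  -(1 + c * √(z + τ ^ 2) * Real.exp (c * √(z + τ ^ 2))) / (2 * (z + τ ^ 2))
def G2 (c τ z : ℝ) : ℝ :=
  -(c * Real.exp (c * √(z + τ ^ 2)) * (1 + c * √(z + τ ^ 2)) / (2 * √(z + τ ^ 2))) / (2 * (z + τ ^ 2))
   + (1 + c * √(z + τ ^ 2) * Real.exp (c * √(z + τ ^ 2))) / (2 * (z + τ ^ 2) ^ 2)

lemma hasDeriv_sqE {τ z : ℝ} (hτ : 0 < τ) (hz : 0 ≤ z) :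
    HasDerivAt (fun z => √(z + τ ^ 2)) (1 / (2 * √(z + τ ^ 2))) z := by
  have hE : 0 < z + τ ^ 2 := by positivity
  exact (((hasDerivAt_id z).add_const (τ ^ 2)).sqrt (by simpa using hE.ne'))

lemma hasDeriv_Gf {c B τ z : ℝ} (hτ : 0 < τ) (hz : 0 ≤ z) : HasDerivAt (Gf c B τ) (G1 c τ z) z := by
  have hE : 0 < z + τ ^ 2 := by positivity
  have h0 := hasDeriv_sqE hτ hz
  have h1 : HasDerivAt (fun z => Real.log (z + τ ^ 2)) (1 / (z + τ ^ 2)) z :=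
    ((hasDerivAt_id z).add_const (τ ^ 2)).log (by simpa using hE.ne')
  have h2 := (h0.const_mul c).exp
  have h := ((h1.const_mul (-(1 / 2))).sub h2).add_const B
  convert! h using 1
  unfold G1
  have hs : 0 < √(z + τ ^ 2) := Real.sqrt_pos.2 hE
  have hsq : z + τ ^ 2 = √(z + τ ^ 2) ^ 2 := (Real.sq_sqrt hE.le).symm
  set t := √(z + τ ^ 2)
  rw [hsq]
  field_simp
  ring

lemma hasDeriv_G1 {c τ z : ℝ} (hτ : 0 < τ) (hz : 0 ≤ z) : HasDerivAt (G1 c τ) (G2 c τ z) z := by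
  have hE : 0 < z + τ ^ 2 := by positivity
  have h0 := hasDeriv_sqE hτ hz
  have h2 := (h0.const_mul c).exp
  have h3 := (((h0.const_mul c).mul h2).const_add 1).neg
  have h4 := ((hasDerivAt_id z).add_const (τ ^ 2)).const_mul 2
  have h := h3.div h4 (by simp only [id]; positivity)
  convert! h using 1
  unfold G2
  have hs : 0 < √(z + τ ^ 2) := Real.sqrt_pos.2 hE
  have hsq : z + τ ^ 2 = √(z + τ ^ 2) ^ 2 := (Real.sq_sqrt hE.le).symm
  simp only [id, Pi.mul_apply, Pi.neg_apply]
  set t := √(z + τ ^ 2)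
  rw [hsq]
  field_simp
  ring

lemma contDiff_sqzf {k τ : ℝ} (hk : 0 < k) (hτ : 0 < τ) (o : ℝ × ℝ) :
    ContDiff ℝ 2 (fun y => √(zf k o y + τ ^ 2)) := by
  have h := contDiff_zf hk o
  apply ContDiff.sqrt (by fun_prop)
  intro x; have := zf_nonneg k o x; positivity

lemma contDiff_Gf {k τ c B : ℝ} (hk : 0 < k) (hτ : 0 < τ) (o : ℝ × ℝ) :
    ContDiff ℝ 2 (fun y => Gf c B τ (zf k o y)) := by
  have h := contDiff_zf hk o
  have h1 := contDiff_sqzf hk hτ o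
  unfold Gf
  have h2 : ContDiff ℝ 2 (fun y => Real.log (zf k o y + τ ^ 2)) := by
    apply ContDiff.log (by fun_prop)
    intro x; have := zf_nonneg k o x; positivity
  fun_prop

lemma contDiff_G1 {k τ c : ℝ} (hk : 0 < k) (hτ : 0 < τ) (o : ℝ × ℝ) :
    ContDiff ℝ 2 (fun y => G1 c τ (zf k o y)) := by
  have h := contDiff_zf hk o
  have h1 := contDiff_sqzf hk hτ o
  unfold G1
  apply ContDiff.div (by fun_prop) (by fun_prop)
  intro x; have := zf_nonneg k o x; positivity

lemma core_ineq {d τ L t e : ℝ} (hd : 0 ≤ d) (hτ : 0 < τ) (hL : 0 < L) (hLτ : L * τ ≤ 1)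
    (ht : 0 < t) (hE : t ^ 2 = d ^ 2 + τ ^ 2) (he : 1 ≤ e) :
    2 * (1 - L * τ) * τ ^ 2 ≤ 2 * (1 + 2 * L * t * e) * τ ^ 2 + d ^ 2 * (2 * L) * e * (1 + 2 * L * t) * t
      - (1 + 2 * L * t * e) * L * d * t ^ 2 := by
  have hb : 1 ≤ 1 + 2 * L * t * e := by
    have : 0 ≤ 2 * L * t * e := by positivity
    linarith
  rcases le_or_gt t (2 * d) with h | h
  · have h1 : L * d * t ^ 2 * (1 + 2 * L * t * e) ≤ L * d * t ^ 2 * (e * (1 + 2 * L * t)) := by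
      apply mul_le_mul_of_nonneg_left _ (by positivity)
      nlinarith
    have h2 : L * d * t * (e * (1 + 2 * L * t)) * t ≤ L * d * t * (e * (1 + 2 * L * t)) * (2 * d) :=
      mul_le_mul_of_nonneg_left h (by positivity)
    have h3 : 2 * (1 - L * τ) * τ ^ 2 ≤ 2 * (1 + 2 * L * t * e) * τ ^ 2 := by
      apply mul_le_mul_of_nonneg_right _ (by positivity)
      have : 0 < L * τ := by positivity
      linarith
    nlinarith
  · have h1 : 4 * d ^ 2 < t ^ 2 := by nlinarith
    have h2 : d ≤ τ := by nlinarith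
    have h3 : t ^ 2 ≤ 2 * τ ^ 2 := by nlinarith
    have h4 : L * d * t ^ 2 ≤ L * τ * (2 * τ ^ 2) := by gcongr
    have h5 : (1 + 2 * L * t * e) * (L * d * t ^ 2) ≤ (1 + 2 * L * t * e) * (L * τ * (2 * τ ^ 2)) := by
      gcongr
    have h6 : 0 ≤ d ^ 2 * (2 * L) * e * (1 + 2 * L * t) * t := by positivity
    have h7 : 2 * (1 - L * τ) * τ ^ 2 * 1 ≤ 2 * (1 - L * τ) * τ ^ 2 * (1 + 2 * L * t * e) := by
      apply mul_le_mul_of_nonneg_left hb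
      have : 0 ≤ 1 - L * τ := by linarith
      positivity
    nlinarith

lemma ptw_ineq {z τ L J Q D : ℝ} (hz : 0 ≤ z) (hτ : 0 < τ) (hL : 0 < L) (hLτ : L * τ ≤ 1)
    (hJ : 0 < J) (hQ : 0 < Q) (hD : |D| ≤ L * J * √z * Q) :
    Q * J * ((1 - L * τ) * (2 * τ ^ 2 / (z + τ ^ 2) ^ 2)) ≤
      -(4 * Q * J * G1 (2 * L) τ z + 2 * G1 (2 * L) τ z * D + 4 * Q * G2 (2 * L) τ z * J * z) := by
  have hE : 0 < z + τ ^ 2 := by positivity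
  have ht : 0 < √(z + τ ^ 2) := Real.sqrt_pos.2 hE
  have hsq : √(z + τ ^ 2) ^ 2 = z + τ ^ 2 := Real.sq_sqrt hE.le
  have hd2 : √z ^ 2 = z := Real.sq_sqrt hz
  unfold G1 G2
  have he : 1 ≤ Real.exp (2 * L * √(z + τ ^ 2)) := Real.one_le_exp (by positivity)
  have key := core_ineq (d := √z) (t := √(z + τ ^ 2)) (Real.sqrt_nonneg z) hτ hL hLτ ht
    (by rw [hsq, hd2]) he
  set t := √(z + τ ^ 2) with htdef
  set e := Real.exp (2 * L * t)
  set d := √z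
  rw [← hsq]
  have h3 : t ^ 2 - d ^ 2 = τ ^ 2 := by rw [hsq, hd2]; ring
  have hz2 : z = d ^ 2 := hd2.symm
  rw [← hsq, hz2] at *
  have hDl : -(L * J * d * Q) ≤ D := (abs_le.1 hD).1
  have e1 : -(4 * Q * J * (-(1 + 2 * L * t * e) / (2 * t ^ 2)) + 2 * (-(1 + 2 * L * t * e) / (2 * t ^ 2)) * D
      + 4 * Q * (-(2 * L * e * (1 + 2 * L * t) / (2 * t)) / (2 * t ^ 2)
      + (1 + 2 * L * t * e) / (2 * (t ^ 2) ^ 2)) * J * d ^ 2)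
      = (Q * J * (2 * (1 + 2 * L * t * e) * (t ^ 2 - d ^ 2) + d ^ 2 * (2 * L) * e * (1 + 2 * L * t) * t)
        + (1 + 2 * L * t * e) * t ^ 2 * D) / t ^ 4 := by
    field_simp; ring
  rw [e1]
  rw [show Q * J * ((1 - L * τ) * (2 * τ ^ 2 / (t ^ 2) ^ 2))
    = Q * J * (2 * (1 - L * τ) * τ ^ 2) / t ^ 4 by field_simp]
  apply div_le_div_of_nonneg_right _ (by positivity)
  have h1 := mul_le_mul_of_nonneg_left key (by positivity : 0 ≤ Q * J)
  have hbp : 0 ≤ (1 + 2 * L * t * e) * t ^ 2 := by positivity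
  have h2 := mul_le_mul_of_nonneg_left hDl hbp
  rw [h3]
  refine h1.trans ?_
  nlinarith

/-- the differential inequality -/
lemma green_diff {k : ℝ} {Ω : Set (ℝ × ℝ)} {q : ℝ × ℝ → ℝ} (S : Setup k Ω q)
    {u ω : ℝ × ℝ → ℝ} (huc : ContDiffOn ℝ 2 u Ω) (hLH : ∀ x ∈ Ω, LH k u x = ω x)
    (hω : ∀ x ∈ Ω, 0 ≤ ω x) {Γ : ℝ × ℝ → ℝ} (hΓ : ContDiff ℝ 2 Γ) (hΓ0 : ∀ x ∈ Ω, 0 ≤ Γ x)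
    {V : ℝ × ℝ → ℝ × ℝ} (hV : ContDiffOn ℝ 1 V Ω)
    (hVe : ∀ x ∈ Ω, V x = (q x ^ 2) • KHvec k x (grad Γ x)) {δ : ℝ} (hδ : 0 < δ) :
    ContDiffOn ℝ 1 (fun y => (Γ y * Th1 δ (u y / q y)) •
        (q y • KHvec k y (grad u y) - u y • KHvec k y (grad q y)) - Th δ (u y / q y) • V y) Ω ∧
    ∀ x ∈ Ω, -(Th δ (u x / q x) * div2 V x) ≤
      div2 (fun y => (Γ y * Th1 δ (u y / q y)) •
        (q y • KHvec k y (grad u y) - u y • KHvec k y (grad q y)) - Th δ (u y / q y) • V y) x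
      + Γ x * (q x * ω x) := by
  have hk := S.hk
  have hu1 := contDiffOn_KHgrad hk S.hΩ huc
  have hq1 := contDiffOn_KHgrad hk S.hΩ S.hq1
  have huc1 : ContDiffOn ℝ 1 u Ω := huc.of_le (by norm_num)
  have hqc1 : ContDiffOn ℝ 1 q Ω := S.hq1.of_le (by norm_num)
  have hh : ContDiffOn ℝ 1 (fun y => u y / q y) Ω := huc1.div hqc1 (fun x hx => (S.qpos hx).ne')
  have ht1 : ContDiffOn ℝ 1 (fun y => Th1 δ (u y / q y)) Ω := (contDiff_Th1 δ).comp_contDiffOn hh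
  have ht : ContDiffOn ℝ 1 (fun y => Th δ (u y / q y)) Ω :=
    ((contDiff_Th hδ).of_le (by norm_num)).comp_contDiffOn hh
  have hΓ1 : ContDiffOn ℝ 1 Γ Ω := (hΓ.of_le (by norm_num)).contDiffOn
  have hW : ContDiffOn ℝ 1 (fun y => q y • KHvec k y (grad u y) - u y • KHvec k y (grad q y)) Ω :=
    (hqc1.smul hu1).sub (huc1.smul hq1)
  have hf1 : ContDiffOn ℝ 1 (fun y => Γ y * Th1 δ (u y / q y)) Ω := hΓ1.mul ht1
  refine ⟨(hf1.smul hW).sub (ht.smul hV), fun x hx => ?_⟩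
  have dat : ∀ {f : ℝ × ℝ → ℝ}, ContDiffOn ℝ 1 f Ω → DifferentiableAt ℝ f x := fun hf =>
    (hf.contDiffAt (S.hΩ.mem_nhds hx)).differentiableAt (by norm_num)
  have dat2 : ∀ {f : ℝ × ℝ → ℝ × ℝ}, ContDiffOn ℝ 1 f Ω → DifferentiableAt ℝ f x := fun hf =>
    (hf.contDiffAt (S.hΩ.mem_nhds hx)).differentiableAt (by norm_num)
  rw [div2_sub (V := fun y => (Γ y * Th1 δ (u y / q y)) •
        (q y • KHvec k y (grad u y) - u y • KHvec k y (grad q y)))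
        (W := fun y => Th δ (u y / q y) • V y) (dat2 (hf1.smul hW)) (dat2 (ht.smul hV)),
    div2_smul (dat hf1) (dat2 hW), div2_smul (dat ht) (dat2 hV),
    div2_sub (V := fun y => q y • KHvec k y (grad u y)) (W := fun y => u y • KHvec k y (grad q y))
      (dat2 (hqc1.smul hu1)) (dat2 (huc1.smul hq1)),
    div2_smul (dat hqc1) (dat2 hu1), div2_smul (dat huc1) (dat2 hq1)]
  have e1 : div2 (fun y => KHvec k y (grad u y)) x = - ω x := by
    have := hLH x hx; simp only [LH] at this; linarith
  have e2 : div2 (fun y => KHvec k y (grad q y)) x = 0 := by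
    have := S.hq4 x hx; simp only [LH] at this; linarith
  have gu := hasF_of_differentiableAt (dat huc1)
  have gq := hasF_of_differentiableAt (dat hqc1)
  have gΓ := hasF_of_differentiableAt (dat hΓ1)
  have hqx := S.qpos hx
  have gqi := hasF_comp (φ := fun s => s⁻¹) (hasDerivAt_inv hqx.ne') gq
  have gh := hasF_mul gu gqi
  simp only [← div_eq_mul_inv] at gh
  have gt1 := hasF_comp (hasDeriv_Th1 δ (u x / q x)) gh
  have gt := hasF_comp (hasDeriv_Th hδ (u x / q x)) gh
  have gf1 := hasF_mul gΓ gt1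
  rw [grad_of gf1, grad_of gt, e1, e2, hVe x hx]
  have hG0 := hΓ0 x hx
  have hω0 := hω x hx
  have ht1n := Th1_nonneg δ (u x / q x)
  have ht1l := Th1_le δ (u x / q x)
  have ht2n := Th2_nonneg hδ (u x / q x)
  have htn := Th_nonneg hδ (u x / q x)
  set T0 := Th δ (u x / q x)
  set T1 := Th1 δ (u x / q x)
  set T2 := Th2 δ (u x / q x)
  set h1 : ℝ := u x * (-(q x ^ 2)⁻¹ * (grad q x).1) + (q x)⁻¹ * (grad u x).1 with hh1
  set h2 : ℝ := u x * (-(q x ^ 2)⁻¹ * (grad q x).2) + (q x)⁻¹ * (grad u x).2 with hh2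
  have c1 : (grad u x).1 = q x * h1 + u x * (grad q x).1 / q x := by
    rw [hh1]; field_simp; ring
  have c2 : (grad u x).2 = q x * h2 + u x * (grad q x).2 / q x := by
    rw [hh2]; field_simp; ring
  have hK := KHform_nonneg k x (h1, h2)
  rw [KHform_eq] at hK
  have eW : q x • KHvec k x (grad u x) - u x • KHvec k x (grad q x) = (q x ^ 2) • KHvec k x (h1, h2) := by
    ext
    · simp only [KHvec, Prod.smul_mk, smul_eq_mul, Prod.fst_sub, c1, c2]; field_simp; ring
    · simp only [KHvec, Prod.smul_mk, smul_eq_mul, Prod.snd_sub, c1, c2]; field_simp; ring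
  rw [eW]
  have esym : (grad q x).1 * (KHvec k x (grad u x)).1 + (grad q x).2 * (KHvec k x (grad u x)).2
      = (grad u x).1 * (KHvec k x (grad q x)).1 + (grad u x).2 * (KHvec k x (grad q x)).2 := by
    rw [← KHform_eq, ← KHform_eq, KHform_comm]
  have esym2 : h1 * (KHvec k x (grad Γ x)).1 + h2 * (KHvec k x (grad Γ x)).2
      = (grad Γ x).1 * (KHvec k x (h1, h2)).1 + (grad Γ x).2 * (KHvec k x (h1, h2)).2 := by
    have := KHform_comm k x (grad Γ x) (h1, h2)
    rw [KHform_eq, KHform_eq] at this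
    exact this
  simp only [Prod.smul_fst, Prod.smul_snd, smul_eq_mul] at *
  set Dq := div2 V x
  have hmain : Γ x * T1 * (q x * -ω x + ((grad q x).1 * (KHvec k x (grad u x)).1 + (grad q x).2 * (KHvec k x (grad u x)).2)
     - (u x * 0 + ((grad u x).1 * (KHvec k x (grad q x)).1 + (grad u x).2 * (KHvec k x (grad q x)).2))) 
     = -(Γ x * T1 * (q x * ω x)) := by rw [esym]; ring
  rw [hmain]
  have hexp : ((Γ x * (T2 * h1) + T1 * (grad Γ x).1) * (q x ^ 2 * (KHvec k x (h1, h2)).1)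
     + (Γ x * (T2 * h2) + T1 * (grad Γ x).2) * (q x ^ 2 * (KHvec k x (h1, h2)).2))
     = Γ x * T2 * q x ^ 2 * (h1 * (KHvec k x (h1, h2)).1 + h2 * (KHvec k x (h1, h2)).2)
      + T1 * q x ^ 2 * ((grad Γ x).1 * (KHvec k x (h1, h2)).1 + (grad Γ x).2 * (KHvec k x (h1, h2)).2) := by
    ring
  rw [hexp]
  have hexp2 : T1 * h1 * (q x ^ 2 * (KHvec k x (grad Γ x)).1) + T1 * h2 * (q x ^ 2 * (KHvec k x (grad Γ x)).2)
     = T1 * q x ^ 2 * (h1 * (KHvec k x (grad Γ x)).1 + h2 * (KHvec k x (grad Γ x)).2) := by ring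
  rw [hexp2, esym2]
  have p1 : 0 ≤ Γ x * T2 * q x ^ 2 * (h1 * (KHvec k x (h1, h2)).1 + h2 * (KHvec k x (h1, h2)).2) := by
    positivity
  have p2 : Γ x * T1 * (q x * ω x) ≤ Γ x * (q x * ω x) := by
    have : 0 ≤ q x * ω x := by positivity
    nlinarith [mul_nonneg hG0 this]
  linarith

lemma dot_bound {k : ℝ} {Ω : Set (ℝ × ℝ)} {q : ℝ × ℝ → ℝ} (S : Setup k Ω q) {L0 : ℝ} (hL0 : 0 < L0)
    {o y : ℝ × ℝ} (hy : y ∈ Ω)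
    (hL : |(grad (Qfun k q) y).1| ≤ L0 * Qfun k q y ∧ |(grad (Qfun k q) y).2| ≤ L0 * Qfun k q y) :
    |(grad (Qfun k q) y).1 * (Pf k o y).1 + (grad (Qfun k q) y).2 * (Pf k o y).2|
      ≤ 2 * L0 / eta0 k * Jac k y * √(zf k o y) * Qfun k q y := by
  have hk := S.hk
  have hQ := Qfun_pos S (subset_closure hy)
  have hJ := Jac_pos hk y
  have h0 := eta0_pos hk
  have he := eta0_le hk y
  have hz := zf_nonneg k o y
  have hz2 : √(zf k o y) ^ 2 = zf k o y := Real.sq_sqrt hz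
  set a := (grad (Qfun k q) y).1
  set b := (grad (Qfun k q) y).2
  set P := Pf k o y
  set Q := Qfun k q y
  have hP := Pf_bound hk o y
  apply abs_le_of_sq_le_sq _ (by positivity)
  have ha : a ^ 2 ≤ (L0 * Q) ^ 2 := by rw [← sq_abs a]; exact pow_le_pow_left₀ (abs_nonneg _) hL.1 2
  have hb : b ^ 2 ≤ (L0 * Q) ^ 2 := by rw [← sq_abs b]; exact pow_le_pow_left₀ (abs_nonneg _) hL.2 2
  have hcs : (a * P.1 + b * P.2) ^ 2 ≤ (a ^ 2 + b ^ 2) * (P.1 ^ 2 + P.2 ^ 2) := by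
    nlinarith [sq_nonneg (a * P.2 - b * P.1)]
  have hJe : Jac k y / eta k y ≤ Jac k y / eta0 k := by gcongr
  have hP2 : P.1 ^ 2 + P.2 ^ 2 ≤ (Jac k y / eta0 k) ^ 2 * zf k o y := by
    refine hP.trans ?_
    have := (eta_pos hk y)
    gcongr
  calc (a * P.1 + b * P.2) ^ 2 ≤ (a ^ 2 + b ^ 2) * (P.1 ^ 2 + P.2 ^ 2) := hcs
    _ ≤ (4 * (L0 * Q) ^ 2) * ((Jac k y / eta0 k) ^ 2 * zf k o y) := by
      apply mul_le_mul _ hP2 (by positivity) (by positivity)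
      nlinarith [sq_nonneg (L0 * Q)]
    _ = (2 * L0 / eta0 k * Jac k y * √(zf k o y) * Q) ^ 2 := by
      have e : (2 * L0 / eta0 k * Jac k y * √(zf k o y) * Q) ^ 2
        = (2 * L0 / eta0 k * Jac k y * Q) ^ 2 * √(zf k o y) ^ 2 := by ring
      rw [e, hz2]; ring

/-- the divergence of the fundamental-solution field -/
lemma div_V {k : ℝ} {Ω : Set (ℝ × ℝ)} {q : ℝ × ℝ → ℝ} (S : Setup k Ω q) {c τ : ℝ} (hτ : 0 < τ)
    (o : ℝ × ℝ) :
    ContDiffOn ℝ 1 (fun y => (2 * Qfun k q y * G1 c τ (zf k o y)) • Pf k o y) Ω ∧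
    ∀ y ∈ Ω, div2 (fun y => (2 * Qfun k q y * G1 c τ (zf k o y)) • Pf k o y) y =
      4 * Qfun k q y * Jac k y * G1 c τ (zf k o y)
       + 2 * G1 c τ (zf k o y) * ((grad (Qfun k q) y).1 * (Pf k o y).1 + (grad (Qfun k q) y).2 * (Pf k o y).2)
       + 4 * Qfun k q y * G2 c τ (zf k o y) * Jac k y * zf k o y := by
  have hk := S.hk
  have hQ : ContDiffOn ℝ 1 (Qfun k q) Ω := (Qfun_contDiffOn S).of_le (by norm_num)
  have hG : ContDiffOn ℝ 1 (fun y => G1 c τ (zf k o y)) Ω :=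
    ((contDiff_G1 hk hτ o).of_le (by norm_num)).contDiffOn
  have hf : ContDiffOn ℝ 1 (fun y => 2 * Qfun k q y * G1 c τ (zf k o y)) Ω :=
    (contDiffOn_const.mul hQ).mul hG
  have hP : ContDiffOn ℝ 1 (Pf k o) Ω := ((contDiff_Pf hk o).of_le (by norm_num)).contDiffOn
  refine ⟨hf.smul hP, fun y hy => ?_⟩
  have dat : ∀ {f : ℝ × ℝ → ℝ}, ContDiffOn ℝ 1 f Ω → DifferentiableAt ℝ f y := fun hf =>
    (hf.contDiffAt (S.hΩ.mem_nhds hy)).differentiableAt (by norm_num)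
  have dat2 : ∀ {f : ℝ × ℝ → ℝ × ℝ}, ContDiffOn ℝ 1 f Ω → DifferentiableAt ℝ f y := fun hf =>
    (hf.contDiffAt (S.hΩ.mem_nhds hy)).differentiableAt (by norm_num)
  rw [div2_smul (dat hf) (dat2 hP), div2_Pf hk]
  have h1 := hasF_mul (hasF_const 2 y) (hasF_of_differentiableAt (dat hQ))
  have h2 := hasF_comp (hasDeriv_G1 (c := c) hτ (zf_nonneg k o y)) (hasF_zf hk o y)
  have h3 := hasF_mul h1 h2
  rw [grad_of h3]
  have := Pf_dot_gz hk o y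
  simp only
  linear_combination (2 * Qfun k q y * G2 c τ (zf k o y)) * this

lemma V_eq {k : ℝ} {q : ℝ × ℝ → ℝ} (hk : 0 < k) {c B τ : ℝ} (hτ : 0 < τ)
    (o y : ℝ × ℝ) : (2 * Qfun k q y * G1 c τ (zf k o y)) • Pf k o y =
      (q y ^ 2) • KHvec k y (grad (fun y => Gf c B τ (zf k o y)) y) := by
  have h2 := hasF_comp (hasDeriv_Gf (c := c) (B := B) hτ (zf_nonneg k o y)) (hasF_zf hk o y)
  rw [grad_of h2]
  have e : KHvec k y (G1 c τ (zf k o y) * (gz k o y).1, G1 c τ (zf k o y) * (gz k o y).2)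
     = G1 c τ (zf k o y) • KHvec k y (gz k o y) := by
    ext <;> simp only [KHvec, Prod.smul_mk, smul_eq_mul] <;> ring
  rw [e, KHvec_gz hk, smul_smul, smul_smul, Qfun_eq hk]
  congr 1; ring

lemma green_step {k : ℝ} {Ω : Set (ℝ × ℝ)} {q : ℝ × ℝ → ℝ} (S : Setup k Ω q) {L0 D : ℝ} (hL0 : 0 < L0)
    (hL : ∀ y ∈ Ω, |(grad (Qfun k q) y).1| ≤ L0 * Qfun k q y ∧ |(grad (Qfun k q) y).2| ≤ L0 * Qfun k q y)
    (hD0 : 0 < D) (hD : ∀ x ∈ closure Ω, ∀ y ∈ closure Ω, zf k (Ym k x) y ≤ D)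
    {u ω : ℝ × ℝ → ℝ} (hu : ContinuousOn u (closure Ω)) (huc : ContDiffOn ℝ 2 u Ω)
    (hu0 : ∀ x ∈ frontier Ω, u x = 0) (hLH : ∀ x ∈ Ω, LH k u x = ω x)
    (hω : ∀ x ∈ Ω, 0 ≤ ω x) {x : ℝ × ℝ} (hx : x ∈ Ω) {Ψ : ℝ × ℝ → ℝ} (hΨ : IntegrableOn Ψ Ω)
    (hΨ2 : ∀ y ∈ Ω, y ≠ x → (Real.log √(D + 1) + Real.exp (2 * (2 * L0 / eta0 k) * √(D + 1))
      - Real.log √(zf k (Ym k x) y)) * (q y * ω y) ≤ Ψ y)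
    {δ : ℝ} (hδ : 0 < δ) {τ : ℝ} (hτ : 0 < τ) (hτ1 : τ ≤ 1) (hLτ : 2 * L0 / eta0 k * τ ≤ 1)
    {α r0 : ℝ} (hα : 0 ≤ α) (hr : 0 < r0)
    (hr0 : ∀ y, √(zf k (Ym k x) y) < r0 → y ∈ Ω ∧ α ≤ Qfun k q y * Th δ (u y / q y)) :
    α * (1 - 2 * L0 / eta0 k * τ) * (2 * π * (r0 ^ 2 / (r0 ^ 2 + τ ^ 2))) ≤ ∫ y in Ω, Ψ y := by
  have hk := S.hk
  have h0 := eta0_pos hk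
  set L := 2 * L0 / eta0 k with hLdef
  have hLpos : 0 < L := by positivity
  set o := Ym k x
  set B := Real.log √(D + 1) + Real.exp (2 * L * √(D + 1))
  set Γ : ℝ × ℝ → ℝ := fun y => Gf (2 * L) B τ (zf k o y) with hΓ
  set V : ℝ × ℝ → ℝ × ℝ := fun y => (2 * Qfun k q y * G1 (2 * L) τ (zf k o y)) • Pf k o y with hV
  obtain ⟨hVc, hVd⟩ := div_V S (c := 2 * L) hτ o
  have hΓ0 : ∀ y ∈ Ω, 0 ≤ Γ y := by
    intro y hy
    have hz := zf_nonneg k o y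
    have hE : zf k o y + τ ^ 2 ≤ D + 1 := by
      have := hD x (subset_closure hx) y (subset_closure hy)
      have : τ ^ 2 ≤ 1 := by nlinarith
      linarith
    have hE0 : 0 < zf k o y + τ ^ 2 := by positivity
    have l1 := Real.log_le_log hE0 hE
    have l2 : Real.log √(D + 1) = 1 / 2 * Real.log (D + 1) := by
      rw [Real.log_sqrt (by positivity)]; ring
    have l3 : Real.exp (2 * L * √(zf k o y + τ ^ 2)) ≤ Real.exp (2 * L * √(D + 1)) := by
      apply Real.exp_le_exp.2
      have := Real.sqrt_le_sqrt hE
      gcongr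
    simp only [hΓ, Gf, B, l2]
    linarith
  have hΓup : ∀ y, y ≠ x → Γ y ≤ B - Real.log √(zf k o y) := by
    intro y hy
    have hz : 0 < zf k o y := zf_pos hk hy
    have l1 := Real.log_le_log hz (by nlinarith : zf k o y ≤ zf k o y + τ ^ 2)
    have l3 := Real.exp_pos (2 * L * √(zf k o y + τ ^ 2))
    rw [Real.log_sqrt hz.le]
    simp only [hΓ, Gf]
    linarith
  obtain ⟨hFc, hFd⟩ := green_diff S huc hLH hω (Γ := Γ) (contDiff_Gf hk hτ o) hΓ0 (V := V) hVc
    (fun y _ => V_eq hk hτ o y) hδ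
  set F : ℝ × ℝ → ℝ × ℝ := fun y => (Γ y * Th1 δ (u y / q y)) •
        (q y • KHvec k y (grad u y) - u y • KHvec k y (grad q y)) - Th δ (u y / q y) • V y with hF
  obtain ⟨hC1, hC2⟩ := superlevel S.hΩ S.hb hu (g := fun y => δ * q y)
    (continuousOn_const.mul S.hq2.continuousOn) hu0 (fun y hy => mul_pos hδ (S.hq3 y hy))
  obtain ⟨hi, hz⟩ := ibp S.hΩ hFc hC1 hC2 (by
    intro y hy hyC
    have : u y < δ * q y := by
      by_contra h
      exact hyC ⟨subset_closure hy, not_lt.1 h⟩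
    have h2 : u y / q y ≤ δ := by rw [div_le_iff₀ (S.qpos hy)]; exact this.le
    simp only [hF, Th_zero hδ h2, Th1_zero hδ h2]; simp)
  have hker := kerf_int hr hτ
  have hri := radial_integral hk o (kerf_meas r0 τ) (kerf_nonneg r0 τ)
  rw [hker.2] at hri
  rw [← hri, ← integral_const_mul]
  have e1 : ∫ y, α * (1 - L * τ) * (Jac k y * kerf r0 τ √(zf k o y))
      = ∫ y in Ω, α * (1 - L * τ) * (Jac k y * kerf r0 τ √(zf k o y)) := by
    symm
    apply setIntegral_eq_integral_of_forall_compl_eq_zero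
    intro y hy
    have : ¬ √(zf k o y) < r0 := fun h => hy (hr0 y h).1
    simp [kerf, this]
  rw [e1]
  have e2 : ∫ y in Ω, Ψ y = ∫ y in Ω, (div2 F y + Ψ y) := by
    rw [integral_add hi hΨ, hz, zero_add]
  rw [e2]
  have hLt : 0 ≤ 1 - L * τ := by linarith
  apply integral_mono_of_nonneg
  · refine Eventually.of_forall fun y => ?_
    have := kerf_nonneg r0 τ √(zf k o y)
    have := Jac_pos hk y
    show (0:ℝ) ≤ _
    positivity
  · exact hi.add hΨ
  · have hne : ∀ᵐ y ∂(volume.restrict Ω), y ≠ x := by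
      apply ae_restrict_of_ae
      rw [ae_iff]; simp
    filter_upwards [hne, ae_restrict_mem S.hΩ.measurableSet] with y hyx hy
    have h1 := hFd y hy
    have hQ := Qfun_pos S (subset_closure hy)
    have hp := ptw_ineq (zf_nonneg k o y) hτ hLpos hLτ (Jac_pos hk y) hQ (dot_bound S hL0 hy (hL y hy))
    have hT := Th_nonneg hδ (u y / q y)
    rw [hVd y hy] at h1
    have hm := mul_le_mul_of_nonneg_left hp hT
    have h3 : Γ y * (q y * ω y) ≤ Ψ y := by
      refine le_trans ?_ (hΨ2 y hy hyx)
      apply mul_le_mul_of_nonneg_right (hΓup y hyx)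
      exact mul_nonneg (S.qpos hy).le (hω y hy)
    refine le_trans ?_ (h1.trans (by linarith) : _ ≤ div2 F y + Ψ y)
    refine le_trans ?_ (hm.trans (by linarith))
    have hz0 := zf_nonneg k o y
    have hJ := Jac_pos hk y
    unfold kerf
    split_ifs with hlt
    · rw [Real.sq_sqrt hz0]
      have := (hr0 y hlt).2
      have hX : 0 ≤ (1 - L * τ) * Jac k y * (2 * τ ^ 2 / (zf k o y + τ ^ 2) ^ 2) := by positivity
      nlinarith [mul_le_mul_of_nonneg_right this hX]
    · simp only [mul_zero]; positivity

lemma zf_small {k : ℝ} (hk : 0 < k) {x : ℝ × ℝ} {s : Set (ℝ × ℝ)} (hs : s ∈ 𝓝 x) :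
    ∃ r > 0, ∀ y, √(zf k (Ym k x) y) < r → y ∈ s := by
  obtain ⟨ρ, hρ, hb⟩ := Metric.mem_nhds_iff.1 hs
  have h0 := eta0_pos hk
  refine ⟨eta0 k * ρ, by positivity, fun y hy => hb ?_⟩
  have h1 : zf k (Ym k x) y < (eta0 k * ρ) ^ 2 := by
    rw [← Real.sqrt_lt_sqrt_iff (zf_nonneg _ _ _), Real.sqrt_sq (by positivity)]; exact hy
  have h2 := zf_expand hk x y
  have h3 : (x.1 - y.1) ^ 2 + (x.2 - y.2) ^ 2 < ρ ^ 2 := by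
    rw [mul_pow] at h1
    exact lt_of_mul_lt_mul_left (h2.trans_lt h1) (by positivity)
  rw [Metric.mem_ball, Prod.dist_eq, max_lt_iff, Real.dist_eq, Real.dist_eq]
  constructor
  · apply abs_lt_of_sq_lt_sq _ hρ.le; nlinarith [sq_nonneg (x.2 - y.2)]
  · apply abs_lt_of_sq_lt_sq _ hρ.le; nlinarith [sq_nonneg (x.1 - y.1)]

theorem green {k : ℝ} {Ω : Set (ℝ × ℝ)} {q : ℝ × ℝ → ℝ} (S : Setup k Ω q) :
    ∃ C : ℝ, ∀ u ω : ℝ × ℝ → ℝ, ContinuousOn u (closure Ω) → ContDiffOn ℝ 2 u Ω →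
      (∀ x ∈ frontier Ω, u x = 0) → (∀ x ∈ Ω, LH k u x = ω x) → (∀ x ∈ Ω, 0 ≤ ω x) →
      ∀ x ∈ Ω, ∀ Ψ : ℝ × ℝ → ℝ, IntegrableOn Ψ Ω →
      (∀ y ∈ Ω, y ≠ x → (C - Real.log √(zf k (Ym k x) y)) * (q y * ω y) ≤ Ψ y) →
      2 * π * (Qfun k q x * (u x / q x)) ≤ ∫ y in Ω, Ψ y := by
  have hk := S.hk
  obtain ⟨L0, hL0, hL⟩ := Qfun_grad S
  obtain ⟨D, hD0, hD⟩ := zf_bdd S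
  refine ⟨Real.log √(D + 1) + Real.exp (2 * (2 * L0 / eta0 k) * √(D + 1)),
    fun u ω hu huc hu0 hLH hω x hx Ψ hΨ hΨ2 => ?_⟩
  have h0 := eta0_pos hk
  have hQ := Qfun_pos S (subset_closure hx)
  -- for every cutoff
  have hδ : ∀ δ > 0, 2 * π * (Qfun k q x * Th δ (u x / q x)) ≤ ∫ y in Ω, Ψ y := by
    intro δ hδ
    have hgen : ∀ α ≥ 0, ∀ r0 > 0,
       (∀ y, √(zf k (Ym k x) y) < r0 → y ∈ Ω ∧ α ≤ Qfun k q y * Th δ (u y / q y)) →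
       2 * π * α ≤ ∫ y in Ω, Ψ y := by
      intro α hα r0 hr hr0
      have hlim : Tendsto (fun τ : ℝ => α * (1 - 2 * L0 / eta0 k * τ) * (2 * π * (r0 ^ 2 / (r0 ^ 2 + τ ^ 2))))
          (𝓝[>] 0) (𝓝 (α * (1 - 2 * L0 / eta0 k * 0) * (2 * π * (r0 ^ 2 / (r0 ^ 2 + 0 ^ 2))))) := by
        apply tendsto_nhdsWithin_of_tendsto_nhds
        apply Continuous.tendsto
        have : Continuous (fun τ : ℝ => r0 ^ 2 / (r0 ^ 2 + τ ^ 2)) := by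
          apply Continuous.div (by fun_prop) (by fun_prop)
          intro τ; positivity
        fun_prop
      have hev : ∀ᶠ τ in 𝓝[>] (0:ℝ), α * (1 - 2 * L0 / eta0 k * τ) * (2 * π * (r0 ^ 2 / (r0 ^ 2 + τ ^ 2)))
          ≤ ∫ y in Ω, Ψ y := by
        have hpos : 0 < min 1 (1 / (2 * L0 / eta0 k)) := by positivity
        filter_upwards [Ioo_mem_nhdsGT hpos] with τ hτ
        have h1 : τ < 1 := hτ.2.trans_le (min_le_left _ _)
        have h2 : τ < 1 / (2 * L0 / eta0 k) := hτ.2.trans_le (min_le_right _ _)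
        refine green_step S hL0 hL hD0 hD hu huc hu0 hLH hω hx hΨ hΨ2 hδ hτ.1 h1.le ?_ hα hr hr0
        rw [lt_div_iff₀ (by positivity)] at h2
        linarith
      have := le_of_tendsto hlim hev
      refine le_trans (le_of_eq ?_) this
      field_simp
      ring
    have hpos : 0 ≤ Qfun k q x * Th δ (u x / q x) := mul_nonneg hQ.le (Th_nonneg hδ _)
    have hcont : ContinuousAt (fun y => Qfun k q y * Th δ (u y / q y)) x := by
      have n := S.hΩ.mem_nhds hx
      have c1 := ((Qfun_contDiffOn S).contDiffAt n).continuousAt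
      have c2 := (huc.contDiffAt n).continuousAt
      have c3 := (S.hq1.contDiffAt n).continuousAt
      have c4 : ContinuousAt (fun y => u y / q y) x := c2.div c3 (S.qpos hx).ne'
      have c5 : ContinuousAt (fun y => Th δ (u y / q y)) x :=
        ContinuousAt.comp (g := Th δ) (f := fun y => u y / q y) (contDiff_Th hδ).continuous.continuousAt c4
      exact c1.mul c5
    rcases eq_or_lt_of_le hpos with he | hlt
    · rw [← he, mul_zero]
      obtain ⟨r, hr, hrs⟩ := zf_small hk (S.hΩ.mem_nhds hx)
      have := hgen 0 le_rfl r hr (fun y hy => ⟨hrs y hy,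
        mul_nonneg (Qfun_pos S (subset_closure (hrs y hy))).le (Th_nonneg hδ _)⟩)
      simpa using this
    · set g := Qfun k q x * Th δ (u x / q x)
      have : ∀ α ∈ Ioo 0 g, 2 * π * α ≤ ∫ y in Ω, Ψ y := by
        intro α hα
        have hev := (hcont.eventually (lt_mem_nhds hα.2)).and (S.hΩ.mem_nhds hx)
        obtain ⟨r, hr, hrs⟩ := zf_small hk hev
        exact hgen α hα.1.le r hr (fun y hy => ⟨(hrs y hy).2, (hrs y hy).1.le⟩)
      by_contra hcon
      rw [not_le] at hcon
      have hp := Real.pi_pos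
      set I := ∫ y in Ω, Ψ y
      have h1 : I / (2 * π) < g := by rw [div_lt_iff₀ (by positivity)]; linarith
      obtain ⟨α, ha1, ha2⟩ := exists_between (max_lt hlt h1)
      have := this α ⟨(le_max_left _ _).trans_lt ha1, ha2⟩
      have h3 := (le_max_right _ _).trans_lt ha1
      rw [div_lt_iff₀ (by positivity)] at h3
      linarith
  have hp := Real.pi_pos
  apply le_of_forall_pos_le_add
  intro e he
  set M := 2 * π * Qfun k q x with hM
  have hM0 : 0 < M := by positivity
  have := hδ (e / (2 * M)) (by positivity)
  have h2 := Th_ge (by positivity : 0 < e / (2 * M)) (u x / q x)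
  have h3 := mul_le_mul_of_nonneg_left h2 hM0.le
  have h4 : M * (2 * (e / (2 * M))) = e := by field_simp
  have e1 : 2 * π * (Qfun k q x * Th (e / (2 * M)) (u x / q x)) = M * Th (e / (2 * M)) (u x / q x) := by
    rw [hM]; ring
  have e2 : 2 * π * (Qfun k q x * (u x / q x)) = M * (u x / q x) := by rw [hM]; ring
  rw [e1] at this
  rw [e2]
  rw [mul_sub, h4] at h3
  linarith

lemma pPart_nonneg (t : ℝ) : 0 ≤ pPart t := le_max_right _ _
lemma pPart_cont : Continuous pPart := continuous_id.max continuous_const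
lemma pPart_of_nonpos {t : ℝ} (h : t ≤ 0) : pPart t = 0 := max_eq_right h
lemma pPart_of_nonneg {t : ℝ} (h : 0 ≤ t) : pPart t = t := max_eq_left h

lemma pPow_cont {a : ℝ} (ha : 0 < a) : Continuous (fun t => pPart t ^ a) :=
  pPart_cont.rpow_const (fun _ => Or.inr ha.le)

lemma Setup.intOn {k : ℝ} {Ω : Set (ℝ × ℝ)} {q : ℝ × ℝ → ℝ} (S : Setup k Ω q) {f : ℝ × ℝ → ℝ}
    (hf : ContinuousOn f (closure Ω)) : IntegrableOn f Ω :=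
  (hf.integrableOn_compact S.cpt).mono_set subset_closure

lemma Setup.vol {k : ℝ} {Ω : Set (ℝ × ℝ)} {q : ℝ × ℝ → ℝ} (S : Setup k Ω q) :
    volume Ω < ⊤ := S.hb.measure_lt_top

lemma v_cont {k : ℝ} {Ω : Set (ℝ × ℝ)} {q : ℝ × ℝ → ℝ} (S : Setup k Ω q) {u : ℝ × ℝ → ℝ}
    (hu : ContinuousOn u (closure Ω)) (l : ℝ) {a : ℝ} (ha : 0 < a) :
    ContinuousOn (fun x => pPart (u x - q x * l) ^ a) (closure Ω) :=
  (pPow_cont ha).comp_continuousOn (hu.sub (S.hq2.continuousOn.mul continuousOn_const))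

/-- energy identity, lower bound half -/
lemma energy_ge {k : ℝ} {Ω : Set (ℝ × ℝ)} {q : ℝ × ℝ → ℝ} (S : Setup k Ω q) {u ω : ℝ × ℝ → ℝ}
    (hu : ContinuousOn u (closure Ω)) (huc : ContDiffOn ℝ 2 u Ω)
    (hu0 : ∀ x ∈ frontier Ω, u x = 0) (hLH : ∀ x ∈ Ω, LH k u x = ω x)
    (hω : ∀ x ∈ Ω, 0 ≤ ω x) (hωc : ContinuousOn ω (closure Ω))
    (hi : IntegrableOn (fun x => KHform k x (grad u x) (grad u x)) Ω) :
    ∫ x in Ω, u x * ω x ≤ ∫ x in Ω, KHform k x (grad u x) (grad u x) := by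
  have hk := S.hk
  have i1 : IntegrableOn (fun x => u x * ω x) Ω := S.intOn (hu.mul hωc)
  have i2 : IntegrableOn ω Ω := S.intOn hωc
  have hδ : ∀ δ > 0, (∫ x in Ω, u x * ω x) - 2 * δ * ∫ x in Ω, ω x
      ≤ ∫ x in Ω, KHform k x (grad u x) (grad u x) := by
    intro δ hδ
    have hu1 := contDiffOn_KHgrad hk S.hΩ huc
    have huc1 : ContDiffOn ℝ 1 u Ω := huc.of_le (by norm_num)
    have ht : ContDiffOn ℝ 1 (fun y => Th δ (u y)) Ω :=
      ((contDiff_Th hδ).of_le (by norm_num)).comp_contDiffOn huc1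
    obtain ⟨hC1, hC2⟩ := superlevel S.hΩ S.hb hu (g := fun _ => δ)
      continuousOn_const hu0 (fun y hy => hδ)
    obtain ⟨hd, hz⟩ := ibp S.hΩ (ht.smul hu1) hC1 hC2 (by
      intro y hy hyC
      have : u y < δ := by
        by_contra h
        exact hyC ⟨subset_closure hy, not_lt.1 h⟩
      simp [Th_zero hδ this.le])
    have key : ∀ x ∈ Ω, div2 (fun y => Th δ (u y) • KHvec k y (grad u y)) x + (u x * ω x - 2 * δ * ω x)
       ≤ KHform k x (grad u x) (grad u x) := by
      intro x hx
      have n := S.hΩ.mem_nhds hx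
      rw [div2_smul ((ht.contDiffAt n).differentiableAt (by norm_num))
        ((hu1.contDiffAt n).differentiableAt (by norm_num))]
      have e1 : div2 (fun y => KHvec k y (grad u y)) x = - ω x := by
        have := hLH x hx; simp only [LH] at this; linarith
      have gu := hasF_of_differentiableAt ((huc1.contDiffAt n).differentiableAt (by norm_num))
      have gt := hasF_comp (hasDeriv_Th hδ (u x)) gu
      rw [grad_of gt, e1]
      have h1 := KHform_nonneg k x (grad u x)
      have h2 := Th1_le δ (u x)
      have h3 := Th_ge hδ (u x)
      have h4 := hω x hx
      have h5 : Th1 δ (u x) * (grad u x).1 * (KHvec k x (grad u x)).1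
         + Th1 δ (u x) * (grad u x).2 * (KHvec k x (grad u x)).2
          = Th1 δ (u x) * KHform k x (grad u x) (grad u x) := by rw [KHform_eq]; ring
      simp only
      rw [h5]
      nlinarith [mul_le_mul_of_nonneg_right h3 h4]
    have := setIntegral_mono_on (hd.add (i1.sub (i2.const_mul (2 * δ)))) hi S.hΩ.measurableSet key
    have e3 := integral_add hd (i1.sub (i2.const_mul (2 * δ)))
    have e4 := integral_sub i1 (i2.const_mul (2 * δ))
    rw [integral_const_mul] at e4
    simp only [Pi.add_apply, Pi.sub_apply] at this e3
    linarith
  have hM : 0 ≤ ∫ x in Ω, ω x := setIntegral_nonneg S.hΩ.measurableSet hω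
  set M := ∫ x in Ω, ω x
  apply le_of_forall_pos_le_add
  intro e he
  have := hδ (e / (2 * (M + 1))) (by positivity)
  have h2 : 2 * (e / (2 * (M + 1))) * M ≤ e := by
    have : 2 * (e / (2 * (M + 1))) * M = e * (M / (M + 1)) := by field_simp
    rw [this]
    have : M / (M + 1) ≤ 1 := by rw [div_le_one (by positivity)]; linarith
    nlinarith
  linarith

lemma grad_neg (u : ℝ × ℝ → ℝ) : grad (fun y => - u y) = fun y => - grad u y := by
  ext y <;> simp [grad, fderiv_fun_neg]

lemma LH_neg (k : ℝ) (u : ℝ × ℝ → ℝ) (x : ℝ × ℝ) : LH k (fun y => - u y) x = - LH k u x := by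
  have e : ∀ y, KHvec k y (grad (fun z => - u z) y) = - KHvec k y (grad u y) := by
    intro y; rw [grad_neg]; ext <;> simp [KHvec] <;> ring
  simp only [LH, div2, e, Prod.fst_neg, Prod.snd_neg, fderiv_fun_neg]
  simp; ring

lemma u_nonpos {k : ℝ} {Ω : Set (ℝ × ℝ)} {q : ℝ × ℝ → ℝ} (S : Setup k Ω q) {u : ℝ × ℝ → ℝ}
    (hu : ContinuousOn u (closure Ω)) (huc : ContDiffOn ℝ 2 u Ω)
    (hu0 : ∀ x ∈ frontier Ω, u x = 0) (hLH : ∀ x ∈ Ω, LH k u x = 0) : ∀ x ∈ Ω, u x ≤ 0 := by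
  intro x hx
  obtain ⟨C, hC⟩ := green S
  have := hC u (fun _ => 0) hu huc hu0 hLH (fun _ _ => le_rfl) x hx (fun _ => 0) (by simp [IntegrableOn])
    (by simp)
  simp only [integral_zero] at this
  have hQ := Qfun_pos S (subset_closure hx)
  have hp := Real.pi_pos
  have hq := S.qpos hx
  by_contra h
  rw [not_le] at h
  have : 0 < 2 * π * (Qfun k q x * (u x / q x)) := by positivity
  linarith

lemma u_zero {k : ℝ} {Ω : Set (ℝ × ℝ)} {q : ℝ × ℝ → ℝ} (S : Setup k Ω q) {u : ℝ × ℝ → ℝ}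
    (hu : ContinuousOn u (closure Ω)) (huc : ContDiffOn ℝ 2 u Ω)
    (hu0 : ∀ x ∈ frontier Ω, u x = 0) (hLH : ∀ x ∈ Ω, LH k u x = 0) : ∀ x ∈ Ω, u x = 0 := by
  intro x hx
  have h1 := u_nonpos S hu huc hu0 hLH x hx
  have h2 := u_nonpos S hu.neg huc.neg (fun x hx => by simp [hu0 x hx])
    (fun x hx => by
      have := LH_neg k u x
      rw [hLH x hx, neg_zero] at this; exact this) x hx
  simp at h2
  linarith

lemma Ieps_zero {k p ε : ℝ} {Ω : Set (ℝ × ℝ)} {q : ℝ × ℝ → ℝ} (S : Setup k Ω q) (hp : 1 < p)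
    (hl : 0 < Real.log (1 / ε)) {u : ℝ × ℝ → ℝ} (hu : ∀ x ∈ Ω, u x = 0) : Ieps k p ε q Ω u = 0 := by
  have h1 : ∫ x in Ω, KHform k x (grad u x) (grad u x) = 0 := by
    rw [setIntegral_congr_fun (g := fun _ => 0) S.hΩ.measurableSet, integral_zero]
    intro x hx
    have : u =ᶠ[𝓝 x] fun _ => 0 := by
      filter_upwards [S.hΩ.mem_nhds hx] with y hy using hu y hy
    simp [grad, this.fderiv_eq, KHform]
  have h2 : ∫ x in Ω, pPart (u x - q x * Real.log (1 / ε)) ^ (p + 1) = 0 := by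
    rw [setIntegral_congr_fun (g := fun _ => 0) S.hΩ.measurableSet, integral_zero]
    intro x hx
    have := S.qpos hx
    simp only
    rw [hu x hx, pPart_of_nonpos (by nlinarith), Real.zero_rpow (by linarith)]
  rw [Ieps, h1, h2]; simp

/-- if the core is empty then the energy vanishes -/
lemma core_nonempty {k p ε : ℝ} {Ω : Set (ℝ × ℝ)} {q : ℝ × ℝ → ℝ} (S : Setup k Ω q) (hp : 1 < p)
    (hl : 0 < Real.log (1 / ε)) {u : ℝ × ℝ → ℝ} (hu : IsSolution k p ε q Ω u)
    (hI : 0 < Ieps k p ε q Ω u) : (vcore q Ω ε u).Nonempty := by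
  by_contra h
  rw [not_nonempty_iff_eq_empty] at h
  obtain ⟨h1, h2, h3, h4⟩ := hu
  have : ∀ x ∈ Ω, LH k u x = 0 := by
    intro x hx
    rw [h4 x hx, pPart_of_nonpos, Real.zero_rpow (by linarith), mul_zero]
    by_contra hc
    have : x ∈ vcore q Ω ε u := ⟨hx, by linarith⟩
    rw [h] at this; exact this
  have := Ieps_zero (p := p) S hp hl (u_zero S h1 h2 h3 this)
  linarith

/-- lower bound for the energy of a solution -/
lemma I_lower {k p ε : ℝ} {Ω : Set (ℝ × ℝ)} {q : ℝ × ℝ → ℝ} (S : Setup k Ω q) (hp : 1 < p)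
    (hε : 0 < ε) {u : ℝ × ℝ → ℝ} (hu : IsSolution k p ε q Ω u) (hm : MemH k Ω u) :
    (1 / 2 - 1 / (p + 1)) * (∫ x in Ω, 1 / ε ^ 2 * pPart (u x - q x * Real.log (1 / ε)) ^ (p + 1))
      + 1 / 2 * Real.log (1 / ε) * (∫ x in Ω, q x * (1 / ε ^ 2 * pPart (u x - q x * Real.log (1 / ε)) ^ p))
      ≤ Ieps k p ε q Ω u := by
  obtain ⟨h1, h2, h3, h4⟩ := hu
  have hc : ContinuousOn (fun x => 1 / ε ^ 2 * pPart (u x - q x * Real.log (1 / ε)) ^ p) (closure Ω) :=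
    continuousOn_const.mul (v_cont S h1 _ (by linarith))
  have hc2 : ContinuousOn (fun x => 1 / ε ^ 2 * pPart (u x - q x * Real.log (1 / ε)) ^ (p + 1)) (closure Ω) :=
    continuousOn_const.mul (v_cont S h1 _ (by linarith))
  have hE := energy_ge S h1 h2 h3 h4 (fun x _ => by
    have := pPart_nonneg (u x - q x * Real.log (1 / ε)); positivity) hc hm.2.2.2
  have e : ∫ x in Ω, u x * (1 / ε ^ 2 * pPart (u x - q x * Real.log (1 / ε)) ^ p)
     = (∫ x in Ω, 1 / ε ^ 2 * pPart (u x - q x * Real.log (1 / ε)) ^ (p + 1))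
      + Real.log (1 / ε) * (∫ x in Ω, q x * (1 / ε ^ 2 * pPart (u x - q x * Real.log (1 / ε)) ^ p)) := by
    rw [← integral_const_mul, ← integral_add (S.intOn hc2)]
    · apply setIntegral_congr_fun S.hΩ.measurableSet
      intro x hx
      simp only
      rcases le_total (u x - q x * Real.log (1 / ε)) 0 with h | h
      · rw [pPart_of_nonpos h, Real.zero_rpow (by linarith), Real.zero_rpow (by linarith)]; ring
      · rw [pPart_of_nonneg h, Real.rpow_add_one' h (by linarith)]
        ring
    · exact S.intOn (continuousOn_const.mul (S.hq2.continuousOn.mul hc))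
  rw [e] at hE
  rw [Ieps]
  have e2 : 1 / ((p + 1) * ε ^ 2) * ∫ x in Ω, pPart (u x - q x * Real.log (1 / ε)) ^ (p + 1)
     = 1 / (p + 1) * ∫ x in Ω, 1 / ε ^ 2 * pPart (u x - q x * Real.log (1 / ε)) ^ (p + 1) := by
    rw [integral_const_mul, ← mul_assoc]
    congr 1
    field_simp
  rw [e2]
  linarith

lemma indicator_contDiff {f : ℝ × ℝ → ℝ} {Ω C : Set (ℝ × ℝ)} (hΩ : IsOpen Ω) (hf : ContDiffOn ℝ 1 f Ω)
    (hC : IsCompact C) (h0 : ∀ x ∈ Ω, x ∉ C → f x = 0) (hCΩ : C ⊆ Ω) :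
    ContDiff ℝ 1 (Ω.indicator f) ∧ (∀ x ∉ Ω, fderiv ℝ (Ω.indicator f) x = 0) ∧
    ∀ x ∈ Ω, fderiv ℝ (Ω.indicator f) x = fderiv ℝ f x := by
  have hGe : ∀ x ∈ Ω, Ω.indicator f =ᶠ[𝓝 x] f := fun x hx => by
    filter_upwards [hΩ.mem_nhds hx] with y hy
    simp [hy]
  have hG0 : ∀ x ∉ Ω, Ω.indicator f =ᶠ[𝓝 x] fun _ => 0 := fun x hx => by
    have : x ∈ Cᶜ := fun h => hx (hCΩ h)
    filter_upwards [hC.isClosed.isOpen_compl.mem_nhds this] with y hy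
    by_cases hyΩ : y ∈ Ω
    · simp [hyΩ, h0 y hyΩ hy]
    · simp [hyΩ]
  refine ⟨?_, ?_, ?_⟩
  · rw [contDiff_iff_contDiffAt]
    intro x
    by_cases hx : x ∈ Ω
    · exact (hf.contDiffAt (hΩ.mem_nhds hx)).congr_of_eventuallyEq (hGe x hx)
    · exact contDiffAt_const.congr_of_eventuallyEq (hG0 x hx)
  · intro x hx
    rw [(hG0 x hx).fderiv_eq]; simp
  · intro x hx
    exact (hGe x hx).fderiv_eq

lemma fder_norm_sq (w : ℝ × ℝ → ℝ) (x : ℝ × ℝ) :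
    ‖fderiv ℝ w x‖ ^ 2 ≤ 2 * ((grad w x).1 ^ 2 + (grad w x).2 ^ 2) := by
  have : ‖fderiv ℝ w x‖ ≤ |(grad w x).1| + |(grad w x).2| := by
    apply ContinuousLinearMap.opNorm_le_bound _ (by positivity)
    intro v
    rw [lin_of (fderiv ℝ w x), lin_apply, Real.norm_eq_abs]
    have h1 : |v.1| ≤ ‖v‖ := norm_fst_le v
    have h2 : |v.2| ≤ ‖v‖ := norm_snd_le v
    refine (abs_add_le _ _).trans ?_
    rw [abs_mul, abs_mul, add_mul]
    exact add_le_add (mul_le_mul_of_nonneg_left h1 (abs_nonneg _))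
      (mul_le_mul_of_nonneg_left h2 (abs_nonneg _))
  have h2 := pow_le_pow_left₀ (norm_nonneg _) this 2
  nlinarith [sq_nonneg (|(grad w x).1| - |(grad w x).2|), sq_abs (grad w x).1, sq_abs (grad w x).2]

lemma KH_coer {k : ℝ} {Ω : Set (ℝ × ℝ)} {q : ℝ × ℝ → ℝ} (S : Setup k Ω q) :
    ∃ C > 0, ∀ x ∈ Ω, ∀ w : ℝ × ℝ → ℝ, ‖fderiv ℝ w x‖ ^ 2 ≤ C * KHform k x (grad w x) (grad w x) := by
  have hk := S.hk
  obtain ⟨M, hM, hb⟩ := cpt_upper S.cpt (f := sK k) (contDiff_sK hk).continuous.continuousOn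
  refine ⟨2 * (M / k) ^ 2, by positivity, fun x hx w => ?_⟩
  have h1 := fder_norm_sq w x
  have h2 := KHform_lower hk x (grad w x)
  have hs := sK_pos hk x
  have h3 : sK k x ≤ M := (le_abs_self _).trans (hb x (subset_closure hx))
  have h4 : (sK k x / k) ^ 2 ≤ (M / k) ^ 2 := by gcongr
  have h5 : (sK k x / k) ^ 2 * ((k / sK k x) ^ 2 * ((grad w x).1 ^ 2 + (grad w x).2 ^ 2))
     = (grad w x).1 ^ 2 + (grad w x).2 ^ 2 := by field_simp
  have h6 := KHform_nonneg k x (grad w x)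
  calc _ ≤ 2 * ((grad w x).1 ^ 2 + (grad w x).2 ^ 2) := h1
    _ = 2 * ((sK k x / k) ^ 2 * ((k / sK k x) ^ 2 * ((grad w x).1 ^ 2 + (grad w x).2 ^ 2))) := by rw [h5]
    _ ≤ 2 * ((M / k) ^ 2 * KHform k x (grad w x) (grad w x)) := by gcongr
    _ = _ := by ring

lemma sob {k p l : ℝ} {Ω : Set (ℝ × ℝ)} {q : ℝ × ℝ → ℝ} (S : Setup k Ω q) (hp : 1 < p) (hl : 0 < l) :
    ∃ C > 0, ∀ w, MemH k Ω w → ∫ x in Ω, pPart (w x - q x * l) ^ (p + 1)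
      ≤ (C * √(∫ x in Ω, KHform k x (grad w x) (grad w x))) ^ (p + 1) := by
  have hk := S.hk
  obtain ⟨a, ha, b, hb, hq⟩ := q_bdd S
  obtain ⟨C1, hC1, hco⟩ := KH_coer S
  set δ := a * l / 2 with hδd
  have hδ : 0 < δ := by positivity
  obtain ⟨P, hPc⟩ : ∃ P : NNReal, (P : ℝ) = p + 1 := ⟨⟨p + 1, by linarith⟩, rfl⟩
  obtain ⟨r, hrc⟩ : ∃ r : NNReal, (r : ℝ) = 2 * (p + 1) / (p + 3) :=
    ⟨⟨2 * (p + 1) / (p + 3), by apply div_nonneg <;> linarith⟩, rfl⟩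
  have hfin : Module.finrank ℝ (ℝ × ℝ) = 2 := by simp
  set K0 : NNReal := MeasureTheory.eLpNormLESNormFDerivOfLeConst ℝ (volume : Measure (ℝ × ℝ)) Ω r P
  set K : ENNReal := K0 * (volume Ω ^ (1 / (r : ℝ) - 1 / 2)) * ENNReal.ofReal (√C1) with hK
  have hr1 : 1 ≤ r := by
    rw [← NNReal.coe_le_coe, hrc]; simp only [NNReal.coe_one]
    rw [le_div_iff₀ (by linarith)]; linarith
  have hr2 : (r : ℝ) < 2 := by rw [hrc, div_lt_iff₀ (by linarith)]; linarith
  have hr0 : (0 : ℝ) < r := by rw [hrc]; apply div_pos <;> linarith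
  have hexp : 0 ≤ 1 / (r : ℝ) - 1 / 2 := by
    rw [sub_nonneg]; exact one_div_le_one_div_of_le hr0 hr2.le
  have hKt : K ≠ ⊤ := by
    rw [hK]
    exact ENNReal.mul_ne_top (ENNReal.mul_ne_top ENNReal.coe_ne_top
      (ENNReal.rpow_ne_top_of_nonneg hexp S.vol.ne)) ENNReal.ofReal_ne_top
  refine ⟨K.toReal + 1, by positivity, fun w hw => ?_⟩
  obtain ⟨w1, w2, w3, w4⟩ := hw
  set N := ∫ x in Ω, KHform k x (grad w x) (grad w x) with hN
  have hN0 : 0 ≤ N := integral_nonneg fun x => KHform_nonneg k x _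
  have ht : ContDiffOn ℝ 1 (fun y => Th δ (w y)) Ω :=
    ((contDiff_Th hδ).of_le (by norm_num)).comp_contDiffOn w2
  obtain ⟨hC1', hC2'⟩ := superlevel S.hΩ S.hb w1 (g := fun _ => δ)
      continuousOn_const w3 (fun y hy => hδ)
  obtain ⟨f1, f2, f3⟩ := indicator_contDiff S.hΩ ht hC1' (by
      intro y hy hyC
      have : w y < δ := by
        by_contra h
        exact hyC ⟨subset_closure hy, not_lt.1 h⟩
      simp [Th_zero hδ this.le]) hC2'
  set f := Ω.indicator (fun y => Th δ (w y)) with hf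
  have s1 := eLpNorm_le_eLpNorm_fderiv_of_le (volume : Measure (ℝ × ℝ)) (F := ℝ) (u := f) (s := Ω) f1
    (support_indicator_subset) (p := r) (q := P) hr1 (by rw [hfin]; exact_mod_cast hr2)
    (by rw [hfin, NNReal.coe_inv, hPc, hrc]; push_cast
        apply le_of_eq; rw [inv_div]; field_simp; ring) S.hb
  set g : ℝ × ℝ → ℝ := fun x => ‖fderiv ℝ f x‖ with hg
  have s0 : eLpNorm (fderiv ℝ f) r volume = eLpNorm g r volume := (eLpNorm_norm _).symm
  have s2 : eLpNorm g r volume = eLpNorm g r (volume.restrict Ω) := by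
    have hsub : Function.support g ⊆ Ω := fun x hx => by
      by_contra h
      apply hx
      simp only [hg, f2 x h, norm_zero]
    exact (eLpNorm_restrict_eq_of_support_subset (μ := volume) hsub).symm
  have hgm : Continuous g := (f1.continuous_fderiv (by norm_num)).norm
  have s3 : eLpNorm g r (volume.restrict Ω)
      ≤ eLpNorm g 2 (volume.restrict Ω) * volume Ω ^ (1 / (r : ℝ) - 1 / 2) := by
    have := eLpNorm_le_eLpNorm_mul_rpow_measure_univ (μ := volume.restrict Ω) (f := g)
      (p := (r : ENNReal)) (q := 2) (by exact_mod_cast hr2.le)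
      hgm.aestronglyMeasurable
    simpa using this
  have s4 : eLpNorm g 2 (volume.restrict Ω) ≤ ENNReal.ofReal (√C1 * √N) := by
    rw [eLpNorm_eq_lintegral_rpow_enorm_toReal (by norm_num) (by norm_num)]
    have : ∫⁻ x in Ω, ‖g x‖ₑ ^ (2 : ENNReal).toReal ≤ ENNReal.ofReal (C1 * N) := by
      rw [hN, ← integral_const_mul, ofReal_integral_eq_lintegral_ofReal (w4.const_mul C1)
        (Eventually.of_forall fun x => mul_nonneg hC1.le (KHform_nonneg k x _))]
      apply setLIntegral_mono' S.hΩ.measurableSet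
      intro x hx
      have gw := (w2.contDiffAt (S.hΩ.mem_nhds hx)).differentiableAt (by norm_num)
      have e : fderiv ℝ (fun y => Th δ (w y)) x = Th1 δ (w x) • fderiv ℝ w x :=
        ((hasDeriv_Th hδ (w x)).comp_hasFDerivAt x gw.hasFDerivAt).fderiv
      have h1 : ‖Th1 δ (w x) • fderiv ℝ w x‖ ≤ ‖fderiv ℝ w x‖ := by
        rw [norm_smul, Real.norm_eq_abs, abs_of_nonneg (Th1_nonneg _ _)]
        exact mul_le_of_le_one_left (norm_nonneg _) (Th1_le _ _)
      have h2 := hco x hx w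
      have hgx : g x = ‖Th1 δ (w x) • fderiv ℝ w x‖ := by simp only [hg]; rw [f3 x hx, e]
      have hgx0 : ‖g x‖ = g x := by simp only [hg, norm_norm]
      rw [← ofReal_norm_eq_enorm, hgx0, hgx, ENNReal.toReal_ofNat, ENNReal.ofReal_rpow_of_nonneg (norm_nonneg _) (by norm_num)]
      apply ENNReal.ofReal_le_ofReal
      refine le_trans ?_ h2
      rw [← Real.rpow_natCast]
      push_cast
      gcongr
    refine (ENNReal.rpow_le_rpow this (by norm_num)).trans (le_of_eq ?_)
    rw [ENNReal.ofReal_rpow_of_nonneg (by positivity) (by norm_num), ← Real.sqrt_mul hC1.le, Real.sqrt_eq_rpow]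
    norm_num
  have s5 : eLpNorm f P volume ≤ K * ENNReal.ofReal (√N) := by
    refine s1.trans ?_
    rw [s0, s2]
    refine (mul_le_mul_right (s3.trans (mul_le_mul_left s4 _)) _).trans (le_of_eq ?_)
    rw [ENNReal.ofReal_mul (by positivity), hK]
    ring
  have s6 : ENNReal.ofReal (∫ x in Ω, pPart (w x - q x * l) ^ (p + 1)) ≤ (eLpNorm f P volume) ^ (p + 1) := by
    rw [ofReal_integral_eq_lintegral_ofReal (S.intOn (v_cont S w1 l (by linarith)))
        (Eventually.of_forall fun x => Real.rpow_nonneg (pPart_nonneg _) _)]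
    have hP0 : (P : ENNReal) ≠ 0 := by
      have : P ≠ 0 := by rw [← NNReal.coe_ne_zero, hPc]; linarith
      exact_mod_cast this
    rw [eLpNorm_eq_lintegral_rpow_enorm_toReal hP0 ENNReal.coe_ne_top, ENNReal.coe_toReal, hPc, ← ENNReal.rpow_mul,
      one_div_mul_cancel (by linarith), ENNReal.rpow_one]
    refine le_trans ?_ (setLIntegral_le_lintegral Ω _)
    apply setLIntegral_mono' S.hΩ.measurableSet
    intro x hx
    have hfx : f x = Th δ (w x) := by simp [hf, hx]
    rw [hfx, ← ofReal_norm_eq_enorm, ENNReal.ofReal_rpow_of_nonneg (norm_nonneg _) (by linarith)]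
    apply ENNReal.ofReal_le_ofReal
    apply Real.rpow_le_rpow (pPart_nonneg _) _ (by linarith)
    rw [Real.norm_eq_abs, abs_of_nonneg (Th_nonneg hδ _)]
    apply max_le _ (Th_nonneg hδ _)
    refine le_trans ?_ (Th_ge hδ _)
    have := (hq x (subset_closure hx)).1
    have : a * l ≤ q x * l := by gcongr
    rw [hδd]; linarith
  have s7 := s6.trans (ENNReal.rpow_le_rpow s5 (by linarith : (0:ℝ) ≤ p + 1))
  have s8 : K * ENNReal.ofReal (√N) = ENNReal.ofReal (K.toReal * √N) := by
    rw [ENNReal.ofReal_mul ENNReal.toReal_nonneg, ENNReal.ofReal_toReal hKt]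
  rw [s8, ENNReal.ofReal_rpow_of_nonneg (by positivity) (by linarith), ENNReal.ofReal_le_ofReal_iff (by positivity)] at s7
  refine s7.trans ?_
  apply Real.rpow_le_rpow (by positivity) _ (by linarith)
  have := Real.sqrt_nonneg N
  nlinarith

lemma KH_diff {k lam : ℝ} (hl : 0 < lam) (x a b : ℝ × ℝ) :
    |KHform k x a a - KHform k x b b| ≤ lam * KHform k x b b + (1 + 1 / lam) * KHform k x (a - b) (a - b) := by
  have h1 := KHform_nonneg k x (lam • b + (a - b))
  have h2 := KHform_nonneg k x (lam • b - (a - b))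
  have e1 : KHform k x (lam • b + (a - b)) (lam • b + (a - b))
    = lam ^ 2 * KHform k x b b + 2 * lam * KHform k x b (a - b) + KHform k x (a - b) (a - b) := by
    simp only [KHform, Prod.fst_add, Prod.snd_add, Prod.smul_fst, Prod.smul_snd, smul_eq_mul,
      Prod.fst_sub, Prod.snd_sub]; ring
  have e2 : KHform k x (lam • b - (a - b)) (lam • b - (a - b))
    = lam ^ 2 * KHform k x b b - 2 * lam * KHform k x b (a - b) + KHform k x (a - b) (a - b) := by
    simp only [KHform, Prod.smul_fst, Prod.smul_snd, smul_eq_mul,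
      Prod.fst_sub, Prod.snd_sub]; ring
  have e3 : KHform k x a a = KHform k x b b + 2 * KHform k x b (a - b) + KHform k x (a - b) (a - b) := by
    simp only [KHform, Prod.fst_sub, Prod.snd_sub]; ring
  have h3 := KHform_nonneg k x (a - b)
  set B := KHform k x b b
  set M := KHform k x b (a - b)
  set D := KHform k x (a - b) (a - b)
  rw [e1] at h1
  rw [e2] at h2
  rw [e3]
  have e4 : (1 + 1 / lam) * D = D + D / lam := by ring
  have e5 : D / lam * lam = D := by field_simp
  rw [e4]
  have h4 : 0 ≤ lam * B + 2 * M + D / lam := by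
    have : 0 ≤ (lam * B + 2 * M + D / lam) * lam := by nlinarith
    exact nonneg_of_mul_nonneg_left this hl
  have h5 : 0 ≤ lam * B - 2 * M + D / lam := by
    have : 0 ≤ (lam * B - 2 * M + D / lam) * lam := by nlinarith
    exact nonneg_of_mul_nonneg_left this hl
  rw [abs_le]; constructor <;> linarith

lemma grad_sub_eq {Ω : Set (ℝ × ℝ)} (hΩ : IsOpen Ω) {u w : ℝ × ℝ → ℝ} (hu : ContDiffOn ℝ 1 u Ω)
    (hw : ContDiffOn ℝ 1 w Ω) {x : ℝ × ℝ} (hx : x ∈ Ω) :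
    grad (fun y => u y - w y) x = grad u x - grad w x := by
  have n := hΩ.mem_nhds hx
  have h1 := hasF_of_differentiableAt ((hu.contDiffAt n).differentiableAt (by norm_num))
  have h2 := hasF_of_differentiableAt ((hw.contDiffAt n).differentiableAt (by norm_num))
  rw [grad_of (hasF_sub h1 h2)]; rfl

def NN (k : ℝ) (Ω : Set (ℝ × ℝ)) (u : ℝ × ℝ → ℝ) : ℝ := ∫ x in Ω, KHform k x (grad u x) (grad u x)

lemma NN_diff {k : ℝ} {Ω : Set (ℝ × ℝ)} {q : ℝ × ℝ → ℝ} (S : Setup k Ω q) {u w : ℝ × ℝ → ℝ}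
    (hu : MemH k Ω u) (hw : MemH k Ω w) {lam : ℝ} (hl : 0 < lam) :
    |NN k Ω u - NN k Ω w| ≤ lam * NN k Ω w + (1 + 1 / lam) * NN k Ω (fun y => u y - w y) := by
  obtain ⟨-, u2, -, u4⟩ := hu
  obtain ⟨-, w2, -, w4⟩ := hw
  have hd : IntegrableOn (fun x => KHform k x (grad (fun y => u y - w y) x) (grad (fun y => u y - w y) x)) Ω := by
    apply Integrable.mono' ((u4.const_mul 2).add (w4.const_mul 2))
    · exact (continuousOn_KHform S.hk (continuousOn_grad S.hΩ (u2.sub w2))).aestronglyMeasurable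
        S.hΩ.measurableSet
    · filter_upwards [ae_restrict_mem S.hΩ.measurableSet] with x hx
      rw [Real.norm_eq_abs, abs_of_nonneg (KHform_nonneg _ _ _), grad_sub_eq S.hΩ u2 w2 hx]
      have := KHform_nonneg k x (grad u x + grad w x)
      have e : KHform k x (grad u x - grad w x) (grad u x - grad w x)
        = 2 * KHform k x (grad u x) (grad u x) + 2 * KHform k x (grad w x) (grad w x)
          - KHform k x (grad u x + grad w x) (grad u x + grad w x) := by
        simp only [KHform, Prod.fst_sub, Prod.snd_sub, Prod.fst_add, Prod.snd_add]; ring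
      simp only [Pi.add_apply]
      linarith
  unfold NN
  have e1 := integral_sub u4 w4
  rw [← e1]
  refine (abs_integral_le_integral_abs).trans ?_
  rw [← integral_const_mul, ← integral_const_mul, ← integral_add (w4.const_mul lam) (hd.const_mul _)]
  apply setIntegral_mono_on (u4.sub w4).abs ((w4.const_mul lam).add (hd.const_mul _)) S.hΩ.measurableSet
  intro x hx
  have := KH_diff (k := k) hl x (grad u x) (grad w x)
  rw [← grad_sub_eq S.hΩ u2 w2 hx] at this
  exact this

lemma NN_nonneg (k : ℝ) (Ω : Set (ℝ × ℝ)) (u : ℝ × ℝ → ℝ) : 0 ≤ NN k Ω u :=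
  integral_nonneg fun x => KHform_nonneg k x _

lemma path_cont {k : ℝ} {Ω : Set (ℝ × ℝ)} {q : ℝ × ℝ → ℝ} (S : Setup k Ω q) {γ : ℝ → ℝ × ℝ → ℝ}
    (h1 : ∀ t ∈ Icc (0:ℝ) 1, MemH k Ω (γ t))
    (h2 : ∀ t ∈ Icc (0:ℝ) 1, ∀ δ > 0, ∃ η > 0, ∀ s ∈ Icc (0:ℝ) 1, |s - t| < η →
      (∫ x in Ω, KHform k x (grad (fun y => γ s y - γ t y) x)
        (grad (fun y => γ s y - γ t y) x)) < δ) :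
    ContinuousOn (fun t => NN k Ω (γ t)) (Icc 0 1) := by
  rw [Metric.continuousOn_iff]
  intro t ht e he
  have hN := NN_nonneg k Ω (γ t)
  set lam := e / (2 * (NN k Ω (γ t) + 1)) with hlam
  have hl : 0 < lam := by positivity
  obtain ⟨η, hη, h⟩ := h2 t ht (e / (2 * (1 + 1 / lam))) (by positivity)
  refine ⟨η, hη, fun s hs hst => ?_⟩
  rw [Real.dist_eq] at hst ⊢
  have h3 := h s hs hst
  have h4 := NN_diff S (h1 s hs) (h1 t ht) hl
  have h5 : (1 + 1 / lam) * NN k Ω (fun y => γ s y - γ t y) < (1 + 1 / lam) * (e / (2 * (1 + 1 / lam))) :=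
    mul_lt_mul_of_pos_left h3 (by positivity)
  have h6 : (1 + 1 / lam) * (e / (2 * (1 + 1 / lam))) = e / 2 := by field_simp
  have h7 : lam * NN k Ω (γ t) ≤ e / 2 := by
    have : lam * (NN k Ω (γ t) + 1) = e / 2 := by rw [hlam]; field_simp
    nlinarith
  linarith

lemma I_le {k p ε : ℝ} {Ω : Set (ℝ × ℝ)} {q : ℝ × ℝ → ℝ} (hp : 1 < p) (u : ℝ × ℝ → ℝ) :
    Ieps k p ε q Ω u ≤ 1 / 2 * NN k Ω u := by
  unfold Ieps NN
  have : 0 ≤ (1 / ((p + 1) * ε ^ 2)) * ∫ x in Ω, pPart (u x - q x * Real.log (1 / ε)) ^ (p + 1) := by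
    have : 0 ≤ ∫ x in Ω, pPart (u x - q x * Real.log (1 / ε)) ^ (p + 1) :=
      integral_nonneg fun x => Real.rpow_nonneg (pPart_nonneg _) _
    have : 0 < p + 1 := by linarith
    positivity
  linarith

lemma path_bdd {k p ε : ℝ} {Ω : Set (ℝ × ℝ)} {q : ℝ × ℝ → ℝ} (hp : 1 < p)
    {γ : ℝ → ℝ × ℝ → ℝ} (hc : ContinuousOn (fun t => NN k Ω (γ t)) (Icc 0 1)) :
    BddAbove ((fun t => Ieps k p ε q Ω (γ t)) '' Icc (0:ℝ) 1) := by
  obtain ⟨M, hM⟩ := (isCompact_Icc (a := (0:ℝ)) (b := 1)).bddAbove_image hc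
  refine ⟨1 / 2 * M, ?_⟩
  rintro _ ⟨t, ht, rfl⟩
  have := hM (mem_image_of_mem _ ht)
  have h2 := I_le (k := k) (ε := ε) (q := q) (Ω := Ω) hp (γ t)
  simp only at this ⊢
  linarith

lemma path_sup {k p ε : ℝ} {Ω : Set (ℝ × ℝ)} {q : ℝ × ℝ → ℝ} (S : Setup k Ω q) (hp : 1 < p)
    (hε : 0 < ε) (hl : 0 < Real.log (1 / ε)) :
    ∃ ρ > 0, ∀ γ : ℝ → ℝ × ℝ → ℝ, (∀ t ∈ Icc (0:ℝ) 1, MemH k Ω (γ t)) →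
    (∀ t ∈ Icc (0:ℝ) 1, ∀ δ > 0, ∃ η > 0, ∀ s ∈ Icc (0:ℝ) 1, |s - t| < η →
      (∫ x in Ω, KHform k x (grad (fun y => γ s y - γ t y) x)
        (grad (fun y => γ s y - γ t y) x)) < δ) →
    γ 0 = (fun _ => 0) → Ieps k p ε q Ω (γ 1) < 0 →
    ρ ≤ sSup ((fun t => Ieps k p ε q Ω (γ t)) '' Icc (0:ℝ) 1) := by
  obtain ⟨C, hC, hsob⟩ := sob S hp hl
  have hp1 : 0 < p + 1 := by linarith
  set D := (1 / ((p + 1) * ε ^ 2)) * C ^ (p + 1) with hD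
  have hD0 : 0 < D := by positivity
  set s0 := (1 / (4 * D)) ^ (1 / (p - 1)) with hs0
  have hs : 0 < s0 := by positivity
  have hlow : ∀ w, MemH k Ω w → NN k Ω w ≤ s0 ^ 2 → 1 / 4 * NN k Ω w ≤ Ieps k p ε q Ω w := by
    intro w hw hN
    have h1 := hsob w hw
    have hN0 := NN_nonneg k Ω w
    change _ ≤ (C * √(NN k Ω w)) ^ (p + 1) at h1
    set s := √(NN k Ω w) with hsd
    have hss : s ^ 2 = NN k Ω w := Real.sq_sqrt hN0
    have hsn : 0 ≤ s := Real.sqrt_nonneg _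
    have hle : s ≤ s0 := by
      rw [← hss] at hN; exact le_of_sq_le_sq hN hs.le
    rw [Real.mul_rpow hC.le hsn] at h1
    have h2 : s ^ (p + 1) = s ^ (p - 1) * s ^ 2 := by
      rw [← Real.rpow_natCast, ← Real.rpow_add' hsn]
      · congr 1; push_cast; ring
      · push_cast; linarith
    have h3 : s ^ (p - 1) ≤ 1 / (4 * D) := by
      calc s ^ (p - 1) ≤ s0 ^ (p - 1) := Real.rpow_le_rpow hsn hle (by linarith)
        _ = 1 / (4 * D) := by
          rw [hs0, ← Real.rpow_mul (by positivity), one_div_mul_cancel (by linarith), Real.rpow_one]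
    have h4 : (1 / ((p + 1) * ε ^ 2)) * ∫ x in Ω, pPart (w x - q x * Real.log (1 / ε)) ^ (p + 1)
       ≤ 1 / 4 * NN k Ω w := by
      calc _ ≤ (1 / ((p + 1) * ε ^ 2)) * (C ^ (p + 1) * s ^ (p + 1)) := by gcongr
        _ = D * s ^ (p - 1) * s ^ 2 := by rw [h2, hD]; ring
        _ ≤ D * (1 / (4 * D)) * s ^ 2 := by gcongr
        _ = 1 / 4 * NN k Ω w := by rw [hss]; field_simp
    unfold Ieps
    change _ ≤ 1 / 2 * NN k Ω w - _
    linarith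
  refine ⟨1 / 4 * s0 ^ 2, by positivity, fun γ h1 h2 h3 h4 => ?_⟩
  have hc := path_cont S h1 h2
  have hb := path_bdd (ε := ε) (q := q) hp hc
  have hN1 : s0 ^ 2 < NN k Ω (γ 1) := by
    by_contra h
    rw [not_lt] at h
    have := hlow (γ 1) (h1 1 (by simp)) h
    have := NN_nonneg k Ω (γ 1)
    linarith
  have hN0 : NN k Ω (γ 0) = 0 := by
    rw [h3]; simp [NN, grad, KHform]
  obtain ⟨t, ht, hte⟩ := intermediate_value_Icc (zero_le_one (α := ℝ)) hc
    (show s0 ^ 2 ∈ Icc (NN k Ω (γ 0)) (NN k Ω (γ 1)) by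
      rw [hN0]; exact ⟨by positivity, hN1.le⟩)
  simp only at hte
  have h5 := hlow (γ t) (h1 t ht) hte.le
  rw [hte] at h5
  exact h5.trans (le_csSup hb (mem_image_of_mem _ ht))

/-- positivity of the mountain pass level, and comparison with a given path -/
lemma ceps_pos {k p ε : ℝ} {Ω : Set (ℝ × ℝ)} {q : ℝ × ℝ → ℝ} (S : Setup k Ω q) (hp : 1 < p)
    (hε : 0 < ε) (hl : 0 < Real.log (1 / ε)) {γ : ℝ → ℝ × ℝ → ℝ}
    (h1 : ∀ t ∈ Icc (0:ℝ) 1, MemH k Ω (γ t))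
    (h2 : ∀ t ∈ Icc (0:ℝ) 1, ∀ δ > 0, ∃ η > 0, ∀ s ∈ Icc (0:ℝ) 1, |s - t| < η →
      (∫ x in Ω, KHform k x (grad (fun y => γ s y - γ t y) x)
        (grad (fun y => γ s y - γ t y) x)) < δ)
    (h3 : γ 0 = (fun _ => 0)) (h4 : Ieps k p ε q Ω (γ 1) < 0) :
    0 < ceps k p q Ω ε ∧ ceps k p q Ω ε ≤ sSup ((fun t => Ieps k p ε q Ω (γ t)) '' Icc (0:ℝ) 1) := by
  obtain ⟨ρ, hρ, h⟩ := path_sup S hp hε hl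
  constructor
  · refine hρ.trans_le ?_
    unfold ceps
    refine le_csInf ?_ ?_
    · exact ⟨_, γ, h1, h2, h3, h4, rfl⟩
    rintro c ⟨g, g1, g2, g3, g4, rfl⟩
    exact h g g1 g2 g3 g4
  · unfold ceps
    apply csInf_le
    · refine ⟨ρ, ?_⟩
      rintro c ⟨g, g1, g2, g3, g4, rfl⟩
      exact h g g1 g2 g3 g4
    · exact ⟨γ, h1, h2, h3, h4, rfl⟩

/-- a super-quadratic power dominates any quadratic -/
lemma pow_dom {c B p : ℝ} (hc : 0 < c) (hB : 0 < B) (hp : 1 < p) :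
    ∃ C : ℝ, 0 ≤ C ∧ ∀ z, 0 ≤ z → B * z ^ 2 - C ≤ c * z ^ (p + 1) := by
  set z0 := (B / c) ^ (1 / (p - 1)) with hz0
  have h0 : 0 ≤ z0 := by positivity
  refine ⟨B * z0 ^ 2, by positivity, fun z hz => ?_⟩
  rcases le_total z z0 with h | h
  · have h1 : B * z ^ 2 ≤ B * z0 ^ 2 := by gcongr
    have : 0 ≤ c * z ^ (p + 1) := by positivity
    linarith
  · have h2 : z ^ (p + 1) = z ^ (p - 1) * z ^ 2 := by
      rw [← Real.rpow_natCast z 2, ← Real.rpow_add' hz]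
      · congr 1; push_cast; ring
      · push_cast; linarith
    have h3 : B / c ≤ z ^ (p - 1) := by
      calc B / c = z0 ^ (p - 1) := by
            rw [hz0, ← Real.rpow_mul (by positivity), one_div_mul_cancel (by linarith), Real.rpow_one]
        _ ≤ z ^ (p - 1) := Real.rpow_le_rpow h0 h (by linarith)
    have h4 : B * z ^ 2 ≤ c * z ^ (p + 1) := by
      rw [h2]
      calc B * z ^ 2 = c * (B / c * z ^ 2) := by field_simp
        _ ≤ _ := by gcongr
    have : 0 ≤ B * z0 ^ 2 := by positivity
    linarith

lemma scalar1 {A C2 C0 c p : ℝ} (hA : 0 < A) (hC2 : 0 ≤ C2) (hC0 : 0 ≤ C0) (hc : 0 < c) (hp : 1 < p) :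
    ∃ C, ∀ l, 1 ≤ l → 2 * C0 ≤ l → ∀ s, 0 ≤ s →
      1 / 2 * (s ^ 2 * (2 * A * l + C2)) - c * pPart (s * (l - C0) - l) ^ (p + 1) ≤ A * l + C := by
  obtain ⟨C, hC, h⟩ := pow_dom (B := 8 * (2 * A + C2)) hc (by linarith) hp
  refine ⟨C + (A + C2) + (2 * A + C2) * (8 * C0 ^ 2), fun l hl hl2 s hs => ?_⟩
  set z := pPart (s * (l - C0) - l) with hz
  have hz0 : 0 ≤ z := pPart_nonneg _
  have hz1 : s * (l - C0) - l ≤ z := le_max_left _ _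
  have h1 := h z hz0
  set y := 2 * (z + C0) with hy
  have hy0 : 0 ≤ y := by positivity
  have hs1 : s ≤ 1 + y / l := by
    have h5 : s * (l - C0) ≤ (1 + y / l) * (l - C0) := by
      have e : (1 + y / l) * (l - C0) = l - C0 + y - y * C0 / l := by field_simp; ring
      have : y * C0 / l ≤ y * (1 / 2) := by
        rw [mul_div_assoc]
        refine mul_le_mul_of_nonneg_left ?_ hy0
        rw [div_le_iff₀ (by linarith)]; linarith
      rw [e]; rw [hy] at *; linarith
    exact le_of_mul_le_mul_right h5 (by linarith)
  have hs2 : s ^ 2 ≤ (1 + y / l) ^ 2 := by gcongr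
  have hyl : y / l ≤ y := div_le_self hy0 hl
  have hyl0 : 0 ≤ y / l := by positivity
  have h3 : (1 + y / l) ^ 2 * (2 * A * l + C2) = 2 * A * l + 4 * A * y + 2 * A * y * (y / l)
      + C2 * (1 + y / l) ^ 2 := by field_simp; ring
  have h4 : s ^ 2 * (2 * A * l + C2) ≤ (1 + y / l) ^ 2 * (2 * A * l + C2) := by gcongr
  have h6 : 2 * A * y * (y / l) ≤ 2 * A * y * y := by gcongr
  have h7 : C2 * (1 + y / l) ^ 2 ≤ C2 * (1 + y) ^ 2 := by gcongr
  have h8 : C2 * (1 + y) ^ 2 ≤ C2 * (2 + 2 * y ^ 2) := by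
    gcongr; nlinarith [sq_nonneg (1 - y)]
  have h9 : A * (2 * y) ≤ A * (1 + y ^ 2) := by gcongr; nlinarith [sq_nonneg (1 - y)]
  have h10 : (2 * A + C2) * y ^ 2 ≤ (2 * A + C2) * (8 * z ^ 2 + 8 * C0 ^ 2) := by
    gcongr; rw [hy]; nlinarith [sq_nonneg (z - C0)]
  nlinarith

lemma scalar2 {N C0 c p l : ℝ} (hN : 0 < N) (hc : 0 < c) (hp : 1 < p) (hl : 1 ≤ l)
    (hl2 : 2 * C0 ≤ l) :
    ∃ T, 0 ≤ T ∧ 1 / 2 * (T ^ 2 * N) - c * pPart (T * (l - C0) - l) ^ (p + 1) < 0 := by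
  obtain ⟨C, hC, h⟩ := pow_dom (B := 16 * N / l ^ 2) hc (by positivity) hp
  set T := 5 + 2 * C / N with hT
  have hT0 : 5 ≤ T := by rw [hT]; have : 0 ≤ 2 * C / N := by positivity
                         linarith
  refine ⟨T, by linarith, ?_⟩
  set z := pPart (T * (l - C0) - l) with hz
  have hz1 : T * (l - C0) - l ≤ z := le_max_left _ _
  have hz2 : T * l / 4 ≤ z := by nlinarith
  have h1 := h z (pPart_nonneg _)
  have h2 : 16 * N / l ^ 2 * (T * l / 4) ^ 2 ≤ 16 * N / l ^ 2 * z ^ 2 := by gcongr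
  have h3 : 16 * N / l ^ 2 * (T * l / 4) ^ 2 = N * T ^ 2 := by field_simp; ring
  have h4 : N * T = 5 * N + 2 * C := by rw [hT]; field_simp
  have h5 : N * T ≤ N * T ^ 2 := by gcongr; nlinarith
  linarith

lemma grad_smul (s : ℝ) {w : ℝ × ℝ → ℝ} {x : ℝ × ℝ} (h : DifferentiableAt ℝ w x) :
    grad (fun y => s * w y) x = (s * (grad w x).1, s * (grad w x).2) := by
  apply grad_of
  exact hasF_congr (hasF_mul (hasF_const s x) (hasF_of_differentiableAt h)) (by ring) (by ring)

lemma KHform_smul (k s : ℝ) (x a : ℝ × ℝ) :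
    KHform k x (s * a.1, s * a.2) (s * a.1, s * a.2) = s ^ 2 * KHform k x a a := by
  simp only [KHform]; ring

lemma NN_smul {k : ℝ} {Ω : Set (ℝ × ℝ)} (hΩ : IsOpen Ω) (s : ℝ) {w : ℝ × ℝ → ℝ}
    (hw : ContDiffOn ℝ 1 w Ω) : NN k Ω (fun y => s * w y) = s ^ 2 * NN k Ω w := by
  unfold NN
  rw [← integral_const_mul]
  apply setIntegral_congr_fun hΩ.measurableSet
  intro x hx
  simp only
  rw [grad_smul s ((hw.differentiableOn (by norm_num)).differentiableAt (hΩ.mem_nhds hx)), KHform_smul]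

lemma MemH_smul {k : ℝ} {Ω : Set (ℝ × ℝ)} (hΩ : IsOpen Ω) (s : ℝ) {w : ℝ × ℝ → ℝ}
    (hw : MemH k Ω w) : MemH k Ω (fun y => s * w y) := by
  obtain ⟨h1, h2, h3, h4⟩ := hw
  refine ⟨continuousOn_const.mul h1, contDiffOn_const.mul h2, fun x hx => by simp [h3 x hx], ?_⟩
  refine IntegrableOn.congr_fun (f := fun x => s ^ 2 * KHform k x (grad w x) (grad w x))
    (Integrable.const_mul h4 (s ^ 2)) ?_ hΩ.measurableSet
  intro x hx
  simp only
  rw [grad_smul s ((h2.differentiableOn (by norm_num)).differentiableAt (hΩ.mem_nhds hx)), KHform_smul]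

/-- mountain pass bound from a test function -/
lemma ceps_test {k p ε : ℝ} {Ω : Set (ℝ × ℝ)} {q : ℝ × ℝ → ℝ} (S : Setup k Ω q) (hp : 1 < p)
    (hε : 0 < ε) (hl : 0 < Real.log (1 / ε)) {w : ℝ × ℝ → ℝ} (hw : MemH k Ω w) {N C0 c M : ℝ}
    (hN : NN k Ω w ≤ N)
    (hc : ∀ s, 0 ≤ s → c * pPart (s * (Real.log (1 / ε) - C0) - Real.log (1 / ε)) ^ (p + 1) ≤
      (1 / ((p + 1) * ε ^ 2)) * ∫ x in Ω, pPart (s * w x - q x * Real.log (1 / ε)) ^ (p + 1))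
    (h1 : ∀ s, 0 ≤ s → 1 / 2 * (s ^ 2 * N) -
      c * pPart (s * (Real.log (1 / ε) - C0) - Real.log (1 / ε)) ^ (p + 1) ≤ M)
    (h2 : ∃ T, 0 ≤ T ∧ 1 / 2 * (T ^ 2 * N) -
      c * pPart (T * (Real.log (1 / ε) - C0) - Real.log (1 / ε)) ^ (p + 1) < 0) :
    0 < ceps k p q Ω ε ∧ ceps k p q Ω ε ≤ M := by
  obtain ⟨T, hT, hTn⟩ := h2
  have hI : ∀ s, 0 ≤ s → Ieps k p ε q Ω (fun y => s * w y) ≤ 1 / 2 * (s ^ 2 * N) -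
      c * pPart (s * (Real.log (1 / ε) - C0) - Real.log (1 / ε)) ^ (p + 1) := by
    intro s hs
    unfold Ieps
    have e := NN_smul (k := k) S.hΩ s hw.2.1
    change 1 / 2 * NN k Ω (fun y => s * w y) - _ ≤ _
    rw [e]
    have := hc s hs
    have : s ^ 2 * NN k Ω w ≤ s ^ 2 * N := by gcongr
    linarith
  have hd : ∀ s t : ℝ, (∫ x in Ω, KHform k x (grad (fun y => (s * T) * w y - (t * T) * w y) x)
        (grad (fun y => (s * T) * w y - (t * T) * w y) x)) = (s - t) ^ 2 * (T ^ 2 * NN k Ω w) := by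
    intro s t
    have e : (fun y => (s * T) * w y - (t * T) * w y) = (fun y => ((s - t) * T) * w y) := by
      ext y; ring
    rw [e]
    have := NN_smul (k := k) S.hΩ ((s - t) * T) hw.2.1
    unfold NN at this ⊢
    rw [this]; ring
  have key := ceps_pos (γ := fun t y => (t * T) * w y) (ε := ε) S hp hε hl
    (fun t _ => MemH_smul S.hΩ _ hw) ?_ (by ext y; simp) ?_
  · refine ⟨key.1, key.2.trans ?_⟩
    apply csSup_le
    · exact (nonempty_Icc.2 zero_le_one).image _
    · rintro _ ⟨t, ht, rfl⟩
      have h0 : 0 ≤ t * T := mul_nonneg ht.1 hT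
      exact (hI (t * T) h0).trans (h1 _ h0)
  · intro t _ δ hδ
    set X := T ^ 2 * NN k Ω w with hX
    have hX0 : 0 ≤ X := mul_nonneg (sq_nonneg _) (NN_nonneg _ _ _)
    refine ⟨√(δ / (X + 1)), by positivity, fun s _ hs => ?_⟩
    rw [hd]
    have h5 : (s - t) ^ 2 < δ / (X + 1) := by
      rw [← sq_abs]
      calc |s - t| ^ 2 < √(δ / (X + 1)) ^ 2 := by gcongr
        _ = _ := Real.sq_sqrt (by positivity)
    rw [lt_div_iff₀ (by positivity)] at h5
    nlinarith [sq_nonneg (s - t)]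
  · simp only [one_mul]
    exact (hI T hT).trans_lt hTn

lemma ground {k : ℝ} {Ω : Set (ℝ × ℝ)} {q : ℝ × ℝ → ℝ} (S : Setup k Ω q) {H : ℝ × ℝ → ℝ}
    (hH : ContDiff ℝ 2 H) {C : Set (ℝ × ℝ)} (hC : IsCompact C) (hCΩ : C ⊆ Ω)
    (h0 : ∀ x, x ∉ C → H x = 0) :
    MemH k Ω (fun x => q x * H x) ∧
    IntegrableOn (fun x => q x ^ 2 * KHform k x (grad H x) (grad H x)) Ω ∧
    NN k Ω (fun x => q x * H x) = ∫ x in Ω, q x ^ 2 * KHform k x (grad H x) (grad H x) := by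
  have hk := S.hk
  have hqd : ∀ x ∈ Ω, DifferentiableAt ℝ q x := fun x hx =>
    (S.hq1.differentiableOn (by norm_num)).differentiableAt (S.hΩ.mem_nhds hx)
  have hHd : Differentiable ℝ H := hH.differentiable (by norm_num)
  have hg0 : ∀ x, x ∉ C → grad H x = 0 := by
    intro x hx
    have : H =ᶠ[𝓝 x] fun _ => 0 := by
      filter_upwards [hC.isClosed.isOpen_compl.mem_nhds hx] with y hy
      exact h0 y hy
    simp [grad, this.fderiv_eq]
  have hf1 : IntegrableOn (fun x => q x ^ 2 * KHform k x (grad H x) (grad H x)) Ω := by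
    have hcont : ContinuousOn (fun x => q x ^ 2 * KHform k x (grad H x) (grad H x)) Ω :=
      (S.hq1.continuousOn.pow 2).mul
        (continuousOn_KHform hk (continuousOn_grad S.hΩ (hH.contDiffOn.of_le (by norm_num))))
    refine ((hcont.mono hCΩ).integrableOn_compact hC).of_forall_sdiff_eq_zero S.hΩ.measurableSet ?_
    rintro x ⟨_, hx⟩
    rw [hg0 x hx]; simp [KHform]
  set F : ℝ × ℝ → ℝ × ℝ := fun y => (q y * (H y * H y)) • KHvec k y (grad q y) with hF
  have hVc := contDiffOn_KHgrad hk S.hΩ S.hq1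
  have hFc : ContDiffOn ℝ 1 F Ω :=
    (((S.hq1.of_le (by norm_num)).mul ((hH.contDiffOn.of_le (by norm_num)).mul (hH.contDiffOn.of_le (by norm_num))))).smul hVc
  obtain ⟨i1, i2⟩ := ibp S.hΩ hFc hC hCΩ (by intro x _ hx; simp [hF, h0 x hx])
  have hpt : ∀ x ∈ Ω, KHform k x (grad (fun x => q x * H x) x) (grad (fun x => q x * H x) x)
      = q x ^ 2 * KHform k x (grad H x) (grad H x) + div2 F x := by
    intro x hx
    have e1 := hasF_of_differentiableAt (hqd x hx)
    have e2 := hasF_of_differentiableAt (hHd x)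
    have e3 := hasF_mul e1 (hasF_mul e2 e2)
    rw [hF, div2_smul e3.differentiableAt
      ((hVc.differentiableOn (by norm_num)).differentiableAt (S.hΩ.mem_nhds hx)), grad_of e3,
      grad_of (hasF_mul e1 e2)]
    have h4 : div2 (fun y => KHvec k y (grad q y)) x = 0 := by
      have := S.hq4 x hx
      unfold LH at this; linarith
    rw [h4]
    simp only [KHform, KHvec]
    ring
  refine ⟨⟨S.hq2.continuousOn.mul hH.continuous.continuousOn,
    (S.hq1.of_le (by norm_num)).mul (hH.contDiffOn.of_le (by norm_num)), ?_, ?_⟩, hf1, ?_⟩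
  · intro x hx
    have : x ∉ C := fun h => by
      rw [S.hΩ.frontier_eq] at hx
      exact hx.2 (hCΩ h)
    simp [h0 x this]
  · exact IntegrableOn.congr_fun (Integrable.add hf1 i1) (fun x hx => (hpt x hx).symm) S.hΩ.measurableSet
  · unfold NN
    rw [setIntegral_congr_fun S.hΩ.measurableSet hpt, integral_add hf1 i1, i2, add_zero]

def tH (k δ ε : ℝ) (o y : ℝ × ℝ) : ℝ := Th δ (-(1 / 2) * Real.log (zf k o y + ε ^ 2))

lemma hasF_tH {k δ ε : ℝ} (hk : 0 < k) (hδ : 0 < δ) (hε : 0 < ε) (o y : ℝ × ℝ) :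
    HasFDerivAt (tH k δ ε o) (lin
      (Th1 δ (-(1 / 2) * Real.log (zf k o y + ε ^ 2)) * (-(1 / (2 * (zf k o y + ε ^ 2)))) * (gz k o y).1)
      (Th1 δ (-(1 / 2) * Real.log (zf k o y + ε ^ 2)) * (-(1 / (2 * (zf k o y + ε ^ 2)))) * (gz k o y).2)) y := by
  have hz := zf_nonneg k o y
  have hp : 0 < zf k o y + ε ^ 2 := by positivity
  have h1 : HasDerivAt (fun z => -(1 / 2) * Real.log (z + ε ^ 2)) (-(1 / (2 * (zf k o y + ε ^ 2)))) (zf k o y) := by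
    have := (((hasDerivAt_id (zf k o y)).add_const (ε ^ 2)).log hp.ne').const_mul (-(1/2))
    convert! this using 1
    simp only [id]; field_simp
  exact hasF_comp (φ := fun z => Th δ (-(1 / 2) * Real.log (z + ε ^ 2)))
    (HasDerivAt.comp (h₂ := Th δ) _ (hasDeriv_Th hδ _) h1) (hasF_zf hk o y)

lemma contDiff_tH {k δ ε : ℝ} (hk : 0 < k) (hδ : 0 < δ) (hε : 0 < ε) (o : ℝ × ℝ) :
    ContDiff ℝ 2 (tH k δ ε o) := by
  apply (contDiff_Th hδ).comp
  apply contDiff_const.mul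
  apply ContDiff.log ((contDiff_zf hk o).add contDiff_const)
  intro y
  have := zf_nonneg k o y
  positivity

lemma tH_energy {k δ ε : ℝ} (hk : 0 < k) (hδ : 0 < δ) (hε : 0 < ε) (q : ℝ × ℝ → ℝ) (o y : ℝ × ℝ) :
    q y ^ 2 * KHform k y (grad (tH k δ ε o) y) (grad (tH k δ ε o) y) =
      Th1 δ (-(1 / 2) * Real.log (zf k o y + ε ^ 2)) ^ 2 *
        (Qfun k q y * Jac k y * (zf k o y / (zf k o y + ε ^ 2) ^ 2)) := by
  rw [grad_of (hasF_tH hk hδ hε o y), KHform_smul, KHform_eq, KHvec_gz hk, Qfun_eq hk]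
  have h := Pf_dot_gz hk o y
  have hz := zf_nonneg k o y
  have hp : 0 < zf k o y + ε ^ 2 := by positivity
  simp only [Prod.smul_fst, Prod.smul_snd, smul_eq_mul]
  have e : (gz k o y).1 * (2 * (k / sK k y) * (Pf k o y).1) + (gz k o y).2 * (2 * (k / sK k y) * (Pf k o y).2)
     = 2 * (k / sK k y) * (2 * Jac k y * zf k o y) := by rw [← h]; ring
  rw [e]
  have hs := sK_pos hk y
  field_simp

lemma tH_out {k δ ε : ℝ} (hδ : 0 < δ) (hε : 0 < ε) (o y : ℝ × ℝ)
    (h : Real.exp (-δ) ≤ √(zf k o y)) : -(1 / 2) * Real.log (zf k o y + ε ^ 2) ≤ δ := by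
  have hz := zf_nonneg k o y
  have h1 : Real.exp (-δ) ^ 2 ≤ zf k o y := by
    calc _ ≤ √(zf k o y) ^ 2 := by gcongr
      _ = _ := Real.sq_sqrt hz
  have h2 : Real.log (Real.exp (-δ) ^ 2) ≤ Real.log (zf k o y + ε ^ 2) :=
    Real.log_le_log (by positivity) (by nlinarith)
  rw [Real.log_pow, Real.log_exp] at h2
  push_cast at h2
  linarith

def tf (R ε Q0 C r : ℝ) : ℝ := if r < R then Q0 / (r ^ 2 + ε ^ 2) + C * |r| / (r ^ 2 + ε ^ 2) else 0

lemma tf_int {R ε Q0 C : ℝ} (hR : 0 < R) (hR1 : R ≤ 1) (hε : 0 < ε) (hε1 : ε ≤ 1) (hQ : 0 ≤ Q0) (hC : 0 ≤ C) :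
    Measurable (tf R ε Q0 C) ∧ (∀ r, 0 ≤ tf R ε Q0 C r) ∧
    IntegrableOn (fun r => r * tf R ε Q0 C r) (Ioi 0) ∧
    ∫ r in Ioi (0:ℝ), r * tf R ε Q0 C r ≤ Q0 * Real.log (1 / ε) + (Q0 + C) := by
  have hcont : Continuous (fun r : ℝ => r * (Q0 / (r ^ 2 + ε ^ 2) + C * |r| / (r ^ 2 + ε ^ 2))) := by
    apply continuous_id.mul
    apply Continuous.add
    · apply Continuous.div (by fun_prop) (by fun_prop)
      intro x; positivity
    · apply Continuous.div (by fun_prop) (by fun_prop)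
      intro x; positivity
  obtain ⟨h1, h2⟩ := int_rad (f := tf R ε Q0 C) hR (fun r => Q0 / (r ^ 2 + ε ^ 2) + C * |r| / (r ^ 2 + ε ^ 2))
    (fun r => rfl) (hcont.intervalIntegrable _ _)
  refine ⟨?_, ?_, h1, ?_⟩
  · unfold tf
    exact Measurable.ite measurableSet_Iio (by fun_prop) (by fun_prop)
  · intro r; unfold tf; split_ifs <;> positivity
  · rw [h2]
    have hcont2 : Continuous (fun r : ℝ => Q0 * (r / (r ^ 2 + ε ^ 2)) + C) := by
      refine (Continuous.mul (by fun_prop) (Continuous.div (by fun_prop) (by fun_prop) ?_)).add (by fun_prop)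
      intro x; positivity
    have h3 : ∫ r in (0:ℝ)..R, r * (Q0 / (r ^ 2 + ε ^ 2) + C * |r| / (r ^ 2 + ε ^ 2))
        ≤ ∫ r in (0:ℝ)..R, (Q0 * (r / (r ^ 2 + ε ^ 2)) + C) := by
      apply intervalIntegral.integral_mono_on hR.le (hcont.intervalIntegrable _ _)
        (hcont2.intervalIntegrable _ _)
      intro r hr
      have hp : 0 < r ^ 2 + ε ^ 2 := by positivity
      rw [abs_of_nonneg hr.1]
      have e : r * (Q0 / (r ^ 2 + ε ^ 2) + C * r / (r ^ 2 + ε ^ 2)) =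
        Q0 * (r / (r ^ 2 + ε ^ 2)) + C * (r ^ 2 / (r ^ 2 + ε ^ 2)) := by ring
      rw [e]
      have : r ^ 2 / (r ^ 2 + ε ^ 2) ≤ 1 := by rw [div_le_one hp]; nlinarith
      nlinarith
    refine h3.trans ?_
    rw [intervalIntegral.integral_eq_sub_of_hasDerivAt
      (f := fun r => Q0 * (1 / 2 * Real.log (r ^ 2 + ε ^ 2)) + C * r) _ (hcont2.intervalIntegrable _ _)]
    · have h4 : Real.log (R ^ 2 + ε ^ 2) ≤ 2 := by
        have : Real.log (R ^ 2 + ε ^ 2) ≤ R ^ 2 + ε ^ 2 - 1 := Real.log_le_sub_one_of_pos (by positivity)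
        nlinarith
      have h5 : Real.log (0 ^ 2 + ε ^ 2) = - (2 * Real.log (1 / ε)) := by
        rw [one_div, Real.log_inv]; simp
      rw [h5]
      nlinarith
    · intro r _
      have hp : 0 < r ^ 2 + ε ^ 2 := by positivity
      have := ((((hasDerivAt_pow 2 r).add_const (ε ^ 2)).log hp.ne').const_mul (1/2)).const_mul Q0
      have := this.add ((hasDerivAt_id r).const_mul C)
      convert! this using 1
      push_cast; field_simp

lemma disc_int {k : ℝ} (hk : 0 < k) (o : ℝ × ℝ) {ε : ℝ} (hε : 0 < ε) :
    Integrable (fun y => Jac k y * (if √(zf k o y) < ε then (1:ℝ) else 0)) ∧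
    ∫ y, Jac k y * (if √(zf k o y) < ε then (1:ℝ) else 0) = π * ε ^ 2 := by
  have hm : Measurable (fun r : ℝ => if r < ε then (1:ℝ) else 0) :=
    Measurable.ite measurableSet_Iio (by fun_prop) (by fun_prop)
  have h0 : ∀ r : ℝ, (0:ℝ) ≤ if r < ε then (1:ℝ) else 0 := fun r => by split_ifs <;> norm_num
  obtain ⟨h1, h2⟩ := int_rad (f := fun r : ℝ => if r < ε then (1:ℝ) else 0) hε (fun _ => 1) (fun r => rfl)
    (by simp)
  refine ⟨radial_integrable hk o hm h0 h1, ?_⟩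
  rw [radial_integral hk o hm h0, h2]
  simp; ring

lemma test_fun {k p : ℝ} {Ω : Set (ℝ × ℝ)} {q : ℝ × ℝ → ℝ} (S : Setup k Ω q) (hp : 1 < p)
    {a : ℝ × ℝ} (ha : a ∈ Ω) :
    ∃ C2, 0 ≤ C2 ∧ ∃ C0, 0 ≤ C0 ∧ ∃ c > 0, ∃ e0 > 0, ∀ ε, 0 < ε → ε < e0 → ∃ w, MemH k Ω w ∧
      NN k Ω w ≤ 2 * (π * Qfun k q a) * Real.log (1 / ε) + C2 ∧
      ∀ s, 0 ≤ s → c * pPart (s * (Real.log (1 / ε) - C0) - Real.log (1 / ε)) ^ (p + 1) ≤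
      (1 / ((p + 1) * ε ^ 2)) * ∫ x in Ω, pPart (s * w x - q x * Real.log (1 / ε)) ^ (p + 1) := by
  have hk := S.hk
  have hQ := Qfun_pos S (subset_closure ha)
  have he0 := eta0_pos hk
  set o := Ym k a with ho
  obtain ⟨K, t, ht, hLip⟩ := (((Qfun_contDiffOn S).contDiffAt (S.hΩ.mem_nhds ha)).of_le
    (by norm_num : (1:WithTop ℕ∞) ≤ 2)).exists_lipschitzOnWith
  obtain ⟨r, hr, hrs⟩ := zf_small hk (Filter.inter_mem ht (S.hΩ.mem_nhds ha))
  set R := min (r / 2) (1 / 2) with hR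
  have hR0 : 0 < R := by positivity
  have hRr : R < r := (min_le_left _ _).trans_lt (by linarith)
  have hR1 : R < 1 := (min_le_right _ _).trans_lt (by norm_num)
  set δ := - Real.log R with hδd
  have hδ : 0 < δ := by have := Real.log_neg hR0 hR1; rw [hδd]; linarith
  have hexp : Real.exp (-δ) = R := by rw [hδd, neg_neg, Real.exp_log hR0]
  have hzc : Continuous (zf k o) := (contDiff_zf hk o).continuous
  set C := {y | √(zf k o y) ≤ R} with hC
  have hCΩ : C ⊆ Ω := fun y hy => (hrs y (lt_of_le_of_lt hy hRr)).2
  have hCc : IsCompact C := S.cpt.of_isClosed_subset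
    (isClosed_le (by fun_prop) continuous_const) (hCΩ.trans subset_closure)
  set L := (K:ℝ) / eta0 k with hL
  have hL0 : 0 ≤ L := by positivity
  have hat : a ∈ t := mem_of_mem_nhds ht
  have hQy : ∀ y, √(zf k o y) < R → Qfun k q y ≤ Qfun k q a + L * √(zf k o y) := by
    intro y hy
    have h1 := hLip.dist_le_mul y (hrs y (hy.trans hRr)).1 a hat
    rw [Real.dist_eq] at h1
    have h2 : dist y a ≤ √(zf k o y) / eta0 k := by
      rw [le_div_iff₀ he0]
      apply Real.le_sqrt_of_sq_le
      have h3 := zf_expand hk a y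
      refine le_trans ?_ h3
      have h4 : dist y a ^ 2 ≤ (a.1 - y.1) ^ 2 + (a.2 - y.2) ^ 2 := by
        rw [Prod.dist_eq, Real.dist_eq, Real.dist_eq]
        rcases max_choice |y.1 - a.1| |y.2 - a.2| with h | h <;> rw [h, sq_abs] <;> nlinarith [sq_nonneg (y.1 - a.1), sq_nonneg (y.2 - a.2)]
      nlinarith [sq_nonneg (eta0 k)]
    have h5 : (K:ℝ) * dist y a ≤ L * √(zf k o y) := by
      calc (K:ℝ) * dist y a ≤ K * (√(zf k o y) / eta0 k) := by gcongr
        _ = _ := by rw [hL]; ring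
    have := le_abs_self (Qfun k q y - Qfun k q a)
    linarith
  obtain ⟨J0, hJ0, J1, hJ1, hJ⟩ := Jac_bdd S
  obtain ⟨q0, hq0, q1, hq1, hqb⟩ := q_bdd S
  refine ⟨2 * π * (Qfun k q a + L), by positivity, 1 / 2 * Real.log 2 + 2 * δ,
    by have := Real.log_nonneg (by norm_num : (1:ℝ) ≤ 2); positivity,
    q0 ^ (p + 1) * π / (J1 * (p + 1)), by positivity, R, hR0, fun ε hε hεR => ?_⟩
  have hlog : Real.log (1 / ε) = - Real.log ε := by rw [one_div, Real.log_inv]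
  have hlpos : 0 < Real.log (1 / ε) := by
    rw [hlog]; have := Real.log_neg hε (hεR.trans hR1); linarith
  have hH := contDiff_tH (δ := δ) hk hδ hε o
  have hout : ∀ y, R ≤ √(zf k o y) → -(1 / 2) * Real.log (zf k o y + ε ^ 2) ≤ δ := fun y hy =>
    tH_out hδ hε o y (by rw [hexp]; exact hy)
  obtain ⟨g1, g2, g3⟩ := ground S hH hCc hCΩ (fun y hy => by
    have : R ≤ √(zf k o y) := (not_le.1 hy).le
    exact Th_zero hδ (hout y this))
  refine ⟨fun x => q x * tH k δ ε o x, g1, ?_, ?_⟩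
  · rw [g3]
    obtain ⟨f1, f2, f3, f4⟩ := tf_int hR0 hR1.le hε (hεR.trans hR1).le hQ.le hL0
    have hi := radial_integrable hk o f1 f2 f3
    calc ∫ x in Ω, q x ^ 2 * KHform k x (grad (tH k δ ε o) x) (grad (tH k δ ε o) x)
        ≤ ∫ x in Ω, Jac k x * tf R ε (Qfun k q a) L (√(zf k o x)) := by
          apply setIntegral_mono_on g2 hi.integrableOn S.hΩ.measurableSet
          intro y hy
          rw [tH_energy hk hδ hε]
          have hz := zf_nonneg k o y
          have hJy := Jac_pos hk y
          have hQ' := Qfun_pos S (subset_closure hy)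
          by_cases h : √(zf k o y) < R
          · have h1 : Th1 δ (-(1 / 2) * Real.log (zf k o y + ε ^ 2)) ^ 2 ≤ 1 :=
              pow_le_one₀ (Th1_nonneg _ _) (Th1_le _ _)
            have hp' : 0 < zf k o y + ε ^ 2 := by positivity
            have h2 : zf k o y / (zf k o y + ε ^ 2) ^ 2 ≤ 1 / (zf k o y + ε ^ 2) := by
              rw [div_le_div_iff₀ (by positivity) hp']; nlinarith [sq_nonneg ε]
            have hnn : 0 ≤ zf k o y / (zf k o y + ε ^ 2) ^ 2 := by positivity
            calc _ ≤ 1 * (Qfun k q y * Jac k y * (zf k o y / (zf k o y + ε ^ 2) ^ 2)) := by gcongr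
              _ ≤ 1 * ((Qfun k q a + L * √(zf k o y)) * Jac k y * (1 / (zf k o y + ε ^ 2))) := by
                gcongr
                exact hQy y h
              _ = _ := by
                unfold tf
                rw [if_pos h, Real.sq_sqrt hz, abs_of_nonneg (Real.sqrt_nonneg _)]
                ring
          · rw [Th1_zero hδ (hout y (not_lt.1 h))]
            simp [tf, h]
      _ ≤ ∫ x, Jac k x * tf R ε (Qfun k q a) L (√(zf k o x)) :=
          setIntegral_le_integral hi (Eventually.of_forall fun y => mul_nonneg (Jac_pos hk y).le (f2 _))
      _ = 2 * π * ∫ r in Ioi (0:ℝ), r * tf R ε (Qfun k q a) L r := radial_integral hk o f1 f2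
      _ ≤ 2 * π * (Qfun k q a * Real.log (1 / ε) + (Qfun k q a + L)) := by gcongr
      _ = _ := by ring
  · intro s hs
    set l := Real.log (1 / ε) with hl
    set C0 := 1 / 2 * Real.log 2 + 2 * δ with hC0
    set X := pPart (s * (l - C0) - l) with hX
    have hX0 : 0 ≤ X := pPart_nonneg _
    obtain ⟨d1, d2⟩ := disc_int hk o hε
    have hcont : ContinuousOn (fun x => s * (q x * tH k δ ε o x)) (closure Ω) := continuousOn_const.mul g1.1
    have hintg : IntegrableOn (fun x => pPart (s * (q x * tH k δ ε o x) - q x * l) ^ (p + 1)) Ω :=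
      S.intOn (v_cont S hcont l (by linarith))
    have key : (q0 * X) ^ (p + 1) / J1 * (π * ε ^ 2) ≤
        ∫ x in Ω, pPart (s * (q x * tH k δ ε o x) - q x * l) ^ (p + 1) := by
      rw [← d2, ← integral_const_mul]
      rw [← setIntegral_eq_integral_of_forall_compl_eq_zero (s := Ω)]
      · apply setIntegral_mono_on (Integrable.integrableOn (d1.const_mul _)) hintg S.hΩ.measurableSet
        intro y hy
        have hnn : 0 ≤ pPart (s * (q y * tH k δ ε o y) - q y * l) ^ (p + 1) :=
          Real.rpow_nonneg (pPart_nonneg _) _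
        by_cases h : √(zf k o y) < ε
        · rw [if_pos h, mul_one]
          have hz := zf_nonneg k o y
          have h1 : zf k o y ≤ ε ^ 2 := by
            rw [← Real.sq_sqrt hz]; gcongr
          have h2 : Real.log (zf k o y + ε ^ 2) ≤ Real.log 2 - 2 * l := by
            calc _ ≤ Real.log (2 * ε ^ 2) := Real.log_le_log (by positivity) (by linarith)
              _ = _ := by
                rw [Real.log_mul (by norm_num) (by positivity), Real.log_pow, hlog]
                push_cast; ring
          have h3 : l - C0 ≤ tH k δ ε o y := by
            have := Th_ge hδ (-(1 / 2) * Real.log (zf k o y + ε ^ 2))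
            unfold tH
            linarith
          have hqy := hqb y (subset_closure hy)
          have h4 : q0 * X ≤ pPart (s * (q y * tH k δ ε o y) - q y * l) := by
            have e : s * (q y * tH k δ ε o y) - q y * l = q y * (s * tH k δ ε o y - l) := by ring
            rw [e]
            rcases le_total (s * (l - C0) - l) 0 with h5 | h5
            · rw [hX, pPart_of_nonpos h5, mul_zero]; exact pPart_nonneg _
            · rw [hX, pPart_of_nonneg h5]
              have h6 : s * (l - C0) ≤ s * tH k δ ε o y := by gcongr
              refine le_trans ?_ (le_max_left _ _)
              have : 0 ≤ q y := by linarith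
              apply mul_le_mul hqy.1 (by linarith) h5 this
          have h7 : (q0 * X) ^ (p + 1) ≤ pPart (s * (q y * tH k δ ε o y) - q y * l) ^ (p + 1) :=
            Real.rpow_le_rpow (by positivity) h4 (by linarith)
          refine le_trans ?_ h7
          have h8 := (hJ y (subset_closure hy)).2
          have h9 : 0 ≤ (q0 * X) ^ (p + 1) := by positivity
          calc (q0 * X) ^ (p + 1) / J1 * Jac k y ≤ (q0 * X) ^ (p + 1) / J1 * J1 := by gcongr
            _ = _ := by field_simp
        · rw [if_neg h]; simpa using hnn
      · intro y hy
        have : ¬ √(zf k o y) < ε := fun h => hy (hCΩ (h.trans hεR).le)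
        simp [this]
    calc q0 ^ (p + 1) * π / (J1 * (p + 1)) * X ^ (p + 1)
        = (1 / ((p + 1) * ε ^ 2)) * ((q0 * X) ^ (p + 1) / J1 * (π * ε ^ 2)) := by
          rw [Real.mul_rpow hq0.le hX0]; field_simp
      _ ≤ _ := by gcongr

/-- upper bound for the mountain pass level -/
theorem upper {k p : ℝ} {Ω : Set (ℝ × ℝ)} {q : ℝ × ℝ → ℝ} (S : Setup k Ω q) (hp : 1 < p)
    {a : ℝ × ℝ} (ha : a ∈ Ω) :
    ∃ C, ∀ᶠ ε in 𝓝[>] (0:ℝ), 0 < ceps k p q Ω ε ∧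
      ceps k p q Ω ε ≤ π * Qfun k q a * Real.log (1 / ε) + C := by
  have hQ := Qfun_pos S (subset_closure ha)
  obtain ⟨C2, hC2, C0, hC0, c, hc, e0, he0, h⟩ := test_fun S hp ha
  obtain ⟨C, hC⟩ := scalar1 (A := π * Qfun k q a) (by positivity) hC2 hC0 hc hp
  refine ⟨C, ?_⟩
  have ev : ∀ᶠ ε in 𝓝[>] (0:ℝ), ε ∈ Ioo (0:ℝ) (min e0 (Real.exp (-(1 + 2 * C0)))) :=
    Ioo_mem_nhdsGT (by positivity)
  filter_upwards [ev] with ε hε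
  have h1 : 1 + 2 * C0 ≤ Real.log (1 / ε) := by
    rw [one_div, Real.log_inv, le_neg, Real.log_le_iff_le_exp] <;>
      first | exact hε.1 | exact (hε.2.trans_le (min_le_right _ _)).le
  obtain ⟨w, w1, w2, w3⟩ := h ε hε.1 (hε.2.trans_le (min_le_left _ _))
  refine ceps_test S hp hε.1 (by linarith) w1 w2 w3 (hC _ (by linarith) (by linarith)) ?_
  apply scalar2 _ hc hp (by linarith) (by linarith)
  have : 0 < Real.log (1 / ε) := by linarith
  positivity

def mm (p ε : ℝ) (q : ℝ × ℝ → ℝ) (Ω : Set (ℝ × ℝ)) (u : ℝ × ℝ → ℝ) : ℝ :=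
  ∫ x in Ω, q x * (1 / ε ^ 2 * pPart (u x - q x * Real.log (1 / ε)) ^ p)
def EE (p ε : ℝ) (q : ℝ × ℝ → ℝ) (Ω : Set (ℝ × ℝ)) (u : ℝ × ℝ → ℝ) : ℝ :=
  ∫ x in Ω, 1 / ε ^ 2 * pPart (u x - q x * Real.log (1 / ε)) ^ (p + 1)
def LL (k ε : ℝ) (x y : ℝ × ℝ) : ℝ := Real.log (max 1 (√(zf k (Ym k x) y) / ε))

lemma LL_nonneg (k ε : ℝ) (x y : ℝ × ℝ) : 0 ≤ LL k ε x y := Real.log_nonneg (le_max_left _ _)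
lemma LL_cont {k : ℝ} (hk : 0 < k) (ε : ℝ) (x : ℝ × ℝ) : Continuous (LL k ε x) := by
  have : Continuous (zf k (Ym k x)) := (contDiff_zf hk _).continuous
  unfold LL
  apply Continuous.log (by fun_prop)
  intro y
  have : (1:ℝ) ≤ max 1 (√(zf k (Ym k x) y) / ε) := le_max_left _ _
  positivity

lemma om_nonneg {k p ε : ℝ} {Ω : Set (ℝ × ℝ)} {q : ℝ × ℝ → ℝ} (S : Setup k Ω q) (u : ℝ × ℝ → ℝ)
    {x : ℝ × ℝ} (hx : x ∈ Ω) : 0 ≤ q x * (1 / ε ^ 2 * pPart (u x - q x * Real.log (1 / ε)) ^ p) := by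
  have := S.qpos hx
  have := Real.rpow_nonneg (pPart_nonneg (u x - q x * Real.log (1 / ε))) p
  positivity

lemma mm_nonneg {k p ε : ℝ} {Ω : Set (ℝ × ℝ)} {q : ℝ × ℝ → ℝ} (S : Setup k Ω q) (u : ℝ × ℝ → ℝ) :
    0 ≤ mm p ε q Ω u := setIntegral_nonneg S.hΩ.measurableSet fun _ hx => om_nonneg S u hx

lemma EE_nonneg (p ε : ℝ) (q : ℝ × ℝ → ℝ) (Ω : Set (ℝ × ℝ)) (u : ℝ × ℝ → ℝ) : 0 ≤ EE p ε q Ω u := by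
  apply integral_nonneg
  intro x
  have := Real.rpow_nonneg (pPart_nonneg (u x - q x * Real.log (1 / ε))) (p + 1)
  change (0:ℝ) ≤ _
  positivity

lemma sing_int {k : ℝ} (hk : 0 < k) (o : ℝ × ℝ) {ε : ℝ} (hε : 0 < ε) :
    Integrable (fun y => Jac k y * (if √(zf k o y) < ε then ε / |√(zf k o y)| else 0)) ∧
    ∫ y, Jac k y * (if √(zf k o y) < ε then ε / |√(zf k o y)| else 0) = 2 * π * ε ^ 2 := by
  have hm : Measurable (fun r : ℝ => if r < ε then ε / |r| else 0) :=
    Measurable.ite measurableSet_Iio (by fun_prop) (by fun_prop)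
  have h0 : ∀ r : ℝ, (0:ℝ) ≤ if r < ε then ε / |r| else 0 := fun r => by split_ifs <;> positivity
  have e : Set.EqOn (fun _ : ℝ => ε) (fun r => r * (ε / |r|)) (Set.uIoc 0 ε) := by
    intro r hr
    rw [uIoc_of_le hε.le] at hr
    have := hr.1
    simp only
    rw [abs_of_pos this]; field_simp
  obtain ⟨h1, h2⟩ := int_rad (f := fun r : ℝ => if r < ε then ε / |r| else 0) hε (fun r => ε / |r|) (fun r => rfl)
    ((intervalIntegrable_const (c := ε)).congr e)
  refine ⟨radial_integrable hk o hm h0 h1, ?_⟩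
  rw [radial_integral hk o hm h0, h2]
  have := intervalIntegral.integral_congr_ae (μ := volume) (a := 0) (b := ε) (f := fun r => r * (ε / |r|)) (g := fun _ => ε)
    (Eventually.of_forall fun r hr => (e hr).symm)
  rw [this]; simp; ring

lemma pow_exp {p t : ℝ} (hp : 0 < p) (ht : 0 ≤ t) : t ^ p ≤ p ^ p * Real.exp t := by
  have h1 : t ≤ p * Real.exp (t / p) := by
    have := Real.add_one_le_exp (t / p)
    calc t = p * (t / p) := by field_simp
      _ ≤ _ := by gcongr; linarith
  calc t ^ p ≤ (p * Real.exp (t / p)) ^ p := Real.rpow_le_rpow ht h1 hp.le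
    _ = _ := by
      rw [Real.mul_rpow hp.le (Real.exp_pos _).le, ← Real.exp_mul]
      congr 2; field_simp

lemma young {a p q1 q v t : ℝ} (ha : 0 < a) (hp : 1 < p) (hq : 0 < q) (hq1 : q ≤ q1) (hv : 0 ≤ v) (ht : 0 ≤ t) :
    t * (q * v ^ p) ≤ a * v ^ (p + 1) + a * (q1 / a) ^ (p + 1) * (p + 1) ^ (p + 1) * Real.exp t := by
  have hq1' : 0 < q1 := by linarith
  have hvp : v ^ (p + 1) = v ^ p * v := by
    rw [Real.rpow_add' hv (by linarith), Real.rpow_one]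
  rcases le_total (q * t) (a * v) with h | h
  · have : 0 ≤ a * (q1 / a) ^ (p + 1) * (p + 1) ^ (p + 1) * Real.exp t := by positivity
    rw [hvp]
    have h2 : 0 ≤ v ^ p := by positivity
    nlinarith
  · have h1 : v ≤ q1 / a * t := by
      have : q * t ≤ q1 * t := by gcongr
      rw [div_mul_eq_mul_div, le_div_iff₀ ha]; linarith
    have h2 : t * (q * v ^ p) ≤ a * (q1 / a * t) ^ (p + 1) := by
      calc t * (q * v ^ p) ≤ t * (q1 * (q1 / a * t) ^ p) := by gcongr
        _ = a * (q1 / a * t) ^ (p + 1) := by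
          rw [Real.rpow_add' (by positivity) (by linarith), Real.rpow_one]; field_simp
    have h3 : a * (q1 / a * t) ^ (p + 1) ≤ a * (q1 / a) ^ (p + 1) * (p + 1) ^ (p + 1) * Real.exp t := by
      rw [Real.mul_rpow (by positivity) ht]
      have := pow_exp (p := p + 1) (by linarith) ht
      calc a * ((q1 / a) ^ (p + 1) * t ^ (p + 1)) ≤ a * ((q1 / a) ^ (p + 1) * ((p + 1) ^ (p + 1) * Real.exp t)) := by gcongr
        _ = _ := by ring
    have : 0 ≤ a * v ^ (p + 1) := by positivity
    linarith

/-- the key inequality at points of the vortex core -/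
lemma key_ineq {k p : ℝ} {Ω : Set (ℝ × ℝ)} {q : ℝ × ℝ → ℝ} (S : Setup k Ω q) (hp : 1 < p) :
    ∃ C, 0 ≤ C ∧ ∀ ε ∈ Ioo (0:ℝ) 1, ∀ u, IsSolution k p ε q Ω u → ∀ x ∈ vcore q Ω ε u,
      2 * π * Qfun k q x * Real.log (1 / ε)
       + ∫ y in Ω, LL k ε x y * (q y * (1 / ε ^ 2 * pPart (u y - q y * Real.log (1 / ε)) ^ p))
      ≤ Real.log (1 / ε) * mm p ε q Ω u + C * mm p ε q Ω u
        + (1 / 2 - 1 / (p + 1)) * EE p ε q Ω u + C := by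
  have hk := S.hk
  obtain ⟨C1, hC1⟩ := green S
  obtain ⟨J0, hJ0, J1, hJ1, hJ⟩ := Jac_bdd S
  obtain ⟨q0, hq0, q1, hq1, hqb⟩ := q_bdd S
  set a := 1 / 2 - 1 / (p + 1) with ha
  have ha0 : 0 < a := by
    rw [ha, sub_pos]; apply one_div_lt_one_div_of_lt <;> linarith
  set Cc := a * (q1 / a) ^ (p + 1) * (p + 1) ^ (p + 1) with hCc
  have hCc0 : 0 < Cc := by positivity
  refine ⟨|C1| + Cc / J0 * (2 * π), by positivity, fun ε hε u hu x hx => ?_⟩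
  obtain ⟨u1, u2, u3, u4⟩ := hu
  have hε0 := hε.1
  set l := Real.log (1 / ε) with hl
  set o := Ym k x with ho
  set W := fun y => q y * (1 / ε ^ 2 * pPart (u y - q y * l) ^ p) with hW
  set V := fun y => 1 / ε ^ 2 * pPart (u y - q y * l) ^ (p + 1) with hV
  set f := fun y => Jac k y * (if √(zf k o y) < ε then ε / |√(zf k o y)| else 0) with hf
  have hWc : ContinuousOn W (closure Ω) :=
    S.hq2.continuousOn.mul (continuousOn_const.mul (v_cont S u1 _ (by linarith)))
  have hVc : ContinuousOn V (closure Ω) := continuousOn_const.mul (v_cont S u1 _ (by linarith))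
  obtain ⟨f1, f2⟩ := sing_int hk o hε0
  have iW : IntegrableOn W Ω := S.intOn hWc
  have iV : IntegrableOn V Ω := S.intOn hVc
  have iL : IntegrableOn (fun y => LL k ε x y * W y) Ω := S.intOn ((LL_cont hk ε x).continuousOn.mul hWc)
  have if1 : IntegrableOn f Ω := f1.integrableOn
  have hxq := S.qpos hx.1
  have j1 : IntegrableOn (fun y => (C1 + l) * W y) Ω := Integrable.const_mul iW _
  have j2 : IntegrableOn (fun y => (C1 + l) * W y - LL k ε x y * W y) Ω := Integrable.sub j1 iL
  have j3 : IntegrableOn (fun y => a * V y) Ω := Integrable.const_mul iV _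
  have j4 : IntegrableOn (fun y => ((C1 + l) * W y - LL k ε x y * W y) + a * V y) Ω := Integrable.add j2 j3
  have j5 : IntegrableOn (fun y => Cc / (J0 * ε ^ 2) * f y) Ω := Integrable.const_mul if1 _
  have j6 : IntegrableOn (fun y => (((C1 + l) * W y - LL k ε x y * W y) + a * V y)
    + Cc / (J0 * ε ^ 2) * f y) Ω := Integrable.add j4 j5
  have hg := hC1 u (fun y => 1 / ε ^ 2 * pPart (u y - q y * l) ^ p) u1 u2 u3 u4
    (fun y _ => mul_nonneg (by positivity) (Real.rpow_nonneg (pPart_nonneg _) _)) x hx.1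
    (fun y => (((C1 + l) * W y - LL k ε x y * W y) + a * V y) + Cc / (J0 * ε ^ 2) * f y)
    j6 ?_
  · have e1 : ∫ y in Ω, ((((C1 + l) * W y - LL k ε x y * W y) + a * V y) + Cc / (J0 * ε ^ 2) * f y)
       = (C1 + l) * (∫ y in Ω, W y) - (∫ y in Ω, LL k ε x y * W y) + a * (∫ y in Ω, V y)
          + Cc / (J0 * ε ^ 2) * ∫ y in Ω, f y := by
      rw [integral_add j4 j5, integral_add j2 j3, integral_sub j1 iL,
        integral_const_mul (C1 + l) W, integral_const_mul a V, integral_const_mul (Cc / (J0 * ε ^ 2)) f]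
    rw [e1] at hg
    have h2 : ∫ y in Ω, f y ≤ 2 * π * ε ^ 2 := by
      rw [← f2]
      refine setIntegral_le_integral f1 (Eventually.of_forall fun y => ?_)
      have := Jac_pos hk y
      change (0:ℝ) ≤ Jac k y * _
      apply mul_nonneg this.le
      split_ifs <;> positivity
    have h3 : Cc / (J0 * ε ^ 2) * ∫ y in Ω, f y ≤ Cc / J0 * (2 * π) := by
      calc _ ≤ Cc / (J0 * ε ^ 2) * (2 * π * ε ^ 2) := by gcongr
        _ = _ := by field_simp
    have h4 : l ≤ u x / q x := by
      rw [le_div_iff₀ hxq, mul_comm]; exact hx.2.le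
    have hQ := Qfun_pos S (subset_closure hx.1)
    have h5 : 2 * π * Qfun k q x * l ≤ 2 * π * (Qfun k q x * (u x / q x)) := by
      calc 2 * π * Qfun k q x * l ≤ 2 * π * Qfun k q x * (u x / q x) := by gcongr
        _ = _ := by ring
    have hm0 : 0 ≤ ∫ y in Ω, W y := mm_nonneg S u
    have h6 : C1 * (∫ y in Ω, W y) ≤ (|C1| + Cc / J0 * (2 * π)) * (∫ y in Ω, W y) := by
      gcongr
      have := le_abs_self C1
      have : 0 ≤ Cc / J0 * (2 * π) := by positivity
      linarith
    have h7 := abs_nonneg C1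
    change _ + (∫ y in Ω, LL k ε x y * W y) ≤ l * (∫ y in Ω, W y) + _ * (∫ y in Ω, W y) + a * (∫ y in Ω, V y) + _
    linarith
  · intro y hy hne
    have hz := zf_pos hk hne
    set d := √(zf k o y) with hd
    have hd0 : 0 < d := Real.sqrt_pos.2 hz
    have hqy := hqb y (subset_closure hy)
    have hqy0 := S.qpos hy
    have hJy := hJ y (subset_closure hy)
    have hv := pPart_nonneg (u y - q y * l)
    set v := pPart (u y - q y * l) with hvd
    have hlogd : Real.log (d / ε) = Real.log d + l := by
      rw [Real.log_div hd0.ne' hε0.ne', hl, one_div, Real.log_inv]; ring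
    have hW0 : 0 ≤ W y := om_nonneg S u hy
    have hV0 : 0 ≤ a * V y := by
      have : 0 ≤ v ^ (p + 1) := by positivity
      simp only [hV]; positivity
    change (C1 - Real.log d) * W y ≤ _
    by_cases h : d < ε
    · have hLL : LL k ε x y = 0 := by
        unfold LL
        rw [max_eq_left]
        · simp
        · rw [div_le_one hε0]; exact h.le
      have ht : 0 ≤ - Real.log (d / ε) := by
        have := Real.log_nonpos (by positivity) ((div_le_one hε0).2 h.le)
        linarith
      have hexp : Real.exp (-Real.log (d / ε)) = ε / d := by
        rw [Real.exp_neg, Real.exp_log (by positivity), inv_div]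
      have hy2 := young ha0 hp hqy0 hqy.2 hv ht
      rw [hexp] at hy2
      have e2 : f y = Jac k y * (ε / d) := by
        simp only [hf, ← hd, if_pos h, abs_of_pos hd0]
      have e3 : -Real.log (d / ε) * W y ≤ a * V y + Cc / (J0 * ε ^ 2) * f y := by
        have h8 : Cc * (ε / d) ≤ Cc / J0 * (Jac k y * (ε / d)) := by
          calc Cc * (ε / d) = Cc / J0 * (J0 * (ε / d)) := by field_simp
            _ ≤ _ := by gcongr; exact hJy.1
        calc -Real.log (d / ε) * W y = 1 / ε ^ 2 * (-Real.log (d / ε) * (q y * v ^ p)) := by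
              simp only [hW]; ring
          _ ≤ 1 / ε ^ 2 * (a * v ^ (p + 1) + Cc * (ε / d)) := by gcongr
          _ ≤ 1 / ε ^ 2 * (a * v ^ (p + 1) + Cc / J0 * (Jac k y * (ε / d))) := by gcongr
          _ = _ := by rw [e2]; simp only [hV, ← hvd]; field_simp
      simp only [hLL]
      rw [hlogd] at e3
      linarith
    · have hLL : LL k ε x y = Real.log d + l := by
        unfold LL
        rw [max_eq_right]
        · exact hlogd
        · rw [le_div_iff₀ hε0]; linarith
      have e2 : f y = 0 := by simp only [hf, ← hd, if_neg h, mul_zero]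
      simp only [hLL, e2]
      linarith

lemma tendsto_ell : Tendsto (fun ε : ℝ => Real.log (1 / ε)) (𝓝[>] (0:ℝ)) atTop := by
  have : Tendsto (fun ε : ℝ => ε⁻¹) (𝓝[>] (0:ℝ)) atTop := tendsto_inv_nhdsGT_zero
  simp only [one_div]
  exact Real.tendsto_log_atTop.comp this

lemma LW_nonneg {k p ε : ℝ} {Ω : Set (ℝ × ℝ)} {q : ℝ × ℝ → ℝ} (S : Setup k Ω q) (u : ℝ × ℝ → ℝ) (x : ℝ × ℝ) :
    0 ≤ ∫ y in Ω, LL k ε x y * (q y * (1 / ε ^ 2 * pPart (u y - q y * Real.log (1 / ε)) ^ p)) :=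
  setIntegral_nonneg S.hΩ.measurableSet fun _ hy => mul_nonneg (LL_nonneg _ _ _ _) (om_nonneg S u hy)

lemma star {k p : ℝ} {Ω : Set (ℝ × ℝ)} {q : ℝ × ℝ → ℝ} (S : Setup k Ω q) (hp : 1 < p)
    {u : ℝ → ℝ × ℝ → ℝ} (hu : ∀ ε ∈ Set.Ioo (0:ℝ) 1, IsMPSolution k p ε q Ω (u ε))
    {a : ℝ × ℝ} (ha : a ∈ Ω) :
    ∃ C, 0 ≤ C ∧ ∀ᶠ ε in 𝓝[>] (0:ℝ), ε ∈ Ioo (0:ℝ) 1 ∧ 1 ≤ Real.log (1 / ε) ∧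
      (vcore q Ω ε (u ε)).Nonempty ∧
      ceps k p q Ω ε ≤ π * Qfun k q a * Real.log (1 / ε) + C ∧
      ∀ x ∈ vcore q Ω ε (u ε),
        2 * π * Qfun k q x * Real.log (1 / ε)
          + (∫ y in Ω, LL k ε x y * (q y * (1 / ε ^ 2 * pPart (u ε y - q y * Real.log (1 / ε)) ^ p)))
          + (1 / 2 - 1 / (p + 1)) * EE p ε q Ω (u ε) ≤ 2 * ceps k p q Ω ε + C ∧
        2 * π * Qfun k q x * Real.log (1 / ε) ≤ Real.log (1 / ε) * mm p ε q Ω (u ε)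
          + (1 / 2 - 1 / (p + 1)) * EE p ε q Ω (u ε) + C := by
  obtain ⟨C1, h1⟩ := upper S hp ha
  obtain ⟨C2, hC2, h2⟩ := key_ineq S hp
  have hQ := Qfun_pos S (subset_closure ha)
  have ha0 : 0 < 1 / 2 - 1 / (p + 1) := by
    rw [sub_pos]; apply one_div_lt_one_div_of_lt <;> linarith
  set M := 2 * (π * Qfun k q a + |C1|) with hM
  have hM0 : 0 ≤ M := by positivity
  refine ⟨|C1| + C2 * M + C2, by positivity, ?_⟩
  filter_upwards [h1, Ioo_mem_nhdsGT (zero_lt_one (α := ℝ)), tendsto_ell.eventually_ge_atTop 1] with ε e1 e2 e3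
  obtain ⟨s1, s2, s3⟩ := hu ε e2
  have i := I_lower S hp e2.1 s1 s2
  rw [s3] at i
  change (1 / 2 - 1 / (p + 1)) * EE p ε q Ω (u ε) + 1 / 2 * Real.log (1 / ε) * mm p ε q Ω (u ε) ≤ _ at i
  have hE := EE_nonneg p ε q Ω (u ε)
  have hm := mm_nonneg (p := p) (ε := ε) S (u ε)
  set l := Real.log (1 / ε) with hl
  set m := mm p ε q Ω (u ε) with hmd
  set E := EE p ε q Ω (u ε) with hEd
  have hE' : 0 ≤ (1 / 2 - 1 / (p + 1)) * E := mul_nonneg ha0.le hE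
  have hC1 := le_abs_self C1
  have hmM : m ≤ M := by
    have h3 : l * m ≤ l * M := by
      have : |C1| ≤ l * |C1| := le_mul_of_one_le_left (abs_nonneg _) e3
      rw [hM]; linarith
    exact le_of_mul_le_mul_left h3 (by linarith)
  have hCM : C2 * m ≤ C2 * M := by gcongr
  have hCM0 : 0 ≤ C2 * M := by positivity
  refine ⟨e2, e3, core_nonempty S hp (by linarith) s1 (by rw [s3]; exact e1.1), by linarith [e1.2], ?_⟩
  intro x hx
  have h4 := h2 ε e2 (u ε) s1 x hx
  have h5 := LW_nonneg (p := p) (ε := ε) S (u ε) x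
  have h6 := abs_nonneg C1
  constructor <;> linarith

lemma Q_min {k p : ℝ} {Ω : Set (ℝ × ℝ)} {q : ℝ × ℝ → ℝ} (S : Setup k Ω q) (hp : 1 < p)
    {u : ℝ → ℝ × ℝ → ℝ} (hu : ∀ ε ∈ Set.Ioo (0:ℝ) 1, IsMPSolution k p ε q Ω (u ε))
    {xs : ℝ × ℝ} (hx : xs ∈ Ω)
    (hconc : ∀ xsel : ℝ → ℝ × ℝ,
      (∀ᶠ ε in 𝓝[>] (0:ℝ), xsel ε ∈ vcore q Ω ε (u ε)) → Tendsto xsel (𝓝[>] (0:ℝ)) (𝓝 xs)) :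
    ∀ y ∈ closure Ω, Qfun k q xs ≤ Qfun k q y := by
  classical
  have hmain : ∀ a ∈ Ω, Qfun k q xs ≤ Qfun k q a := by
    intro a ha
    obtain ⟨C, hC, h⟩ := star S hp hu ha
    set sel : ℝ → ℝ × ℝ := fun ε => if h : (vcore q Ω ε (u ε)).Nonempty then h.some else xs with hsel
    have hs : ∀ᶠ ε in 𝓝[>] (0:ℝ), sel ε ∈ vcore q Ω ε (u ε) := by
      filter_upwards [h] with ε hε
      simp only [hsel, dif_pos hε.2.2.1]
      exact hε.2.2.1.some_mem
    have ht := hconc sel hs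
    have hQc : ContinuousAt (Qfun k q) xs := (Qfun_contDiffOn S).continuousOn.continuousAt (S.hΩ.mem_nhds hx)
    have h1 : Tendsto (fun ε => Qfun k q (sel ε)) (𝓝[>] (0:ℝ)) (𝓝 (Qfun k q xs)) := hQc.tendsto.comp ht
    have h2 : Tendsto (fun ε : ℝ => Qfun k q a + 3 * C / (2 * π) / Real.log (1 / ε)) (𝓝[>] (0:ℝ)) (𝓝 (Qfun k q a + 0)) :=
      tendsto_const_nhds.add (tendsto_ell.const_div_atTop _)
    rw [add_zero] at h2
    refine le_of_tendsto_of_tendsto h1 h2 ?_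
    filter_upwards [h, hs] with ε hε hsε
    obtain ⟨e1, e2, e3, e4, e5⟩ := hε
    have h5 := (e5 _ hsε).1
    have h6 := LW_nonneg (p := p) (ε := ε) S (u ε) (sel ε)
    have hE := EE_nonneg p ε q Ω (u ε)
    have ha0 : 0 < 1 / 2 - 1 / (p + 1) := by
      rw [sub_pos]; apply one_div_lt_one_div_of_lt <;> linarith
    have hE' : 0 ≤ (1 / 2 - 1 / (p + 1)) * EE p ε q Ω (u ε) := mul_nonneg ha0.le hE
    set l := Real.log (1 / ε) with hl
    have hl0 : 0 < l := by linarith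
    have h7 : 2 * π * l * Qfun k q (sel ε) ≤ 2 * π * l * (Qfun k q a + 3 * C / (2 * π) / l) := by
      have : 2 * π * l * (Qfun k q a + 3 * C / (2 * π) / l) = 2 * (π * Qfun k q a * l) + 3 * C := by
        field_simp
      rw [this]; linarith
    exact le_of_mul_le_mul_left h7 (by positivity)
  intro y hy
  have h1 := (Qfun_continuousOn S).image_closure (mem_image_of_mem _ hy)
  have h2 : closure (Qfun k q '' Ω) ⊆ Ici (Qfun k q xs) := by
    apply closure_minimal _ isClosed_Ici
    rintro _ ⟨a, ha, rfl⟩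
    exact hmain a ha
  exact h2 h1

/-- all the quantitative information -/
lemma info {k p : ℝ} {Ω : Set (ℝ × ℝ)} {q : ℝ × ℝ → ℝ} (S : Setup k Ω q) (hp : 1 < p)
    {u : ℝ → ℝ × ℝ → ℝ} (hu : ∀ ε ∈ Set.Ioo (0:ℝ) 1, IsMPSolution k p ε q Ω (u ε))
    {xs : ℝ × ℝ} (hx : xs ∈ Ω) (hmin : ∀ y ∈ closure Ω, Qfun k q xs ≤ Qfun k q y) :
    ∃ C, 0 ≤ C ∧ ∀ᶠ ε in 𝓝[>] (0:ℝ), ε ∈ Ioo (0:ℝ) 1 ∧ (vcore q Ω ε (u ε)).Nonempty ∧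
      |ceps k p q Ω ε - π * Qfun k q xs * Real.log (1 / ε)| ≤ C ∧
      EE p ε q Ω (u ε) ≤ C ∧ π * Qfun k q xs ≤ mm p ε q Ω (u ε) ∧
      ∀ x ∈ vcore q Ω ε (u ε),
        (∫ y in Ω, LL k ε x y * (q y * (1 / ε ^ 2 * pPart (u ε y - q y * Real.log (1 / ε)) ^ p))) ≤ C := by
  obtain ⟨C, hC, h⟩ := star S hp hu hx
  have hQ := Qfun_pos S (subset_closure hx)
  have ha0 : 0 < 1 / 2 - 1 / (p + 1) := by
    rw [sub_pos]; apply one_div_lt_one_div_of_lt <;> linarith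
  set a := 1 / 2 - 1 / (p + 1) with had
  refine ⟨3 * C + 3 * C / a, by positivity, ?_⟩
  filter_upwards [h, tendsto_ell.eventually_ge_atTop (4 * C / (π * Qfun k q xs))] with ε hε hl2
  obtain ⟨e1, e2, e3, e4, e5⟩ := hε
  have hE := EE_nonneg p ε q Ω (u ε)
  set l := Real.log (1 / ε) with hl
  have hl0 : 0 < l := by linarith
  have hE' : 0 ≤ a * EE p ε q Ω (u ε) := mul_nonneg ha0.le hE
  have hCa : 0 ≤ 3 * C / a := by positivity
  have hall : ∀ x ∈ vcore q Ω ε (u ε),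
      2 * (π * Qfun k q xs * l) ≤ 2 * π * Qfun k q x * l := by
    intro x hx
    have := hmin x (subset_closure hx.1)
    calc 2 * (π * Qfun k q xs * l) = 2 * π * Qfun k q xs * l := by ring
      _ ≤ _ := by gcongr
  obtain ⟨x, hxA⟩ := e3
  have b1 := hall x hxA
  obtain ⟨b2, b3⟩ := e5 x hxA
  have b4 := LW_nonneg (p := p) (ε := ε) S (u ε) x
  have b5 : a * EE p ε q Ω (u ε) ≤ 3 * C := by linarith
  refine ⟨e1, ⟨x, hxA⟩, ?_, ?_, ?_, ?_⟩
  · rw [abs_le]; constructor <;> linarith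
  · have : EE p ε q Ω (u ε) ≤ 3 * C / a := by rw [le_div_iff₀ ha0]; linarith
    linarith
  · rw [div_le_iff₀ (by positivity)] at hl2
    have : l * (π * Qfun k q xs) ≤ l * mm p ε q Ω (u ε) := by linarith
    exact le_of_mul_le_mul_left this hl0
  · intro y hy
    have c1 := hall y hy
    have c2 := (e5 y hy).1
    linarith

lemma diam_upper {k p : ℝ} {Ω : Set (ℝ × ℝ)} {q : ℝ × ℝ → ℝ} (S : Setup k Ω q) (hp : 1 < p)
    {u : ℝ × ℝ → ℝ} {ε C b : ℝ} (hε : 0 < ε) (hu : ContinuousOn u (closure Ω)) (hb : 0 < b)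
    (hm : b ≤ mm p ε q Ω u)
    (hL : ∀ x ∈ vcore q Ω ε u,
        (∫ y in Ω, LL k ε x y * (q y * (1 / ε ^ 2 * pPart (u y - q y * Real.log (1 / ε)) ^ p))) ≤ C)
    {x x' : ℝ × ℝ} (hx : x ∈ vcore q Ω ε u) (hx' : x' ∈ vcore q Ω ε u) :
    dE x x' ≤ 2 * Real.exp (2 * C / b) / eta0 k * ε := by
  have hk := S.hk
  have he0 := eta0_pos hk
  set W := fun y => q y * (1 / ε ^ 2 * pPart (u y - q y * Real.log (1 / ε)) ^ p) with hW
  have hWc : ContinuousOn W (closure Ω) :=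
    S.hq2.continuousOn.mul (continuousOn_const.mul (v_cont S hu _ (by linarith)))
  have iW : IntegrableOn W Ω := S.intOn hWc
  have iL : ∀ x, IntegrableOn (fun y => LL k ε x y * W y) Ω := fun x =>
    S.intOn ((LL_cont hk ε x).continuousOn.mul hWc)
  set d := √(zf k (Ym k x) x') with hd
  set Λ := Real.log (max 1 (d / (2 * ε))) with hΛ
  have hΛ0 : 0 ≤ Λ := Real.log_nonneg (le_max_left _ _)
  have hpt : ∀ y, Λ ≤ LL k ε x y + LL k ε x' y := by
    intro y
    set d1 := √(zf k (Ym k x) y) with hd1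
    set d2 := √(zf k (Ym k x') y) with hd2
    have q1 : d1 ^ 2 = zf k (Ym k x) y := Real.sq_sqrt (zf_nonneg _ _ _)
    have q2 : d2 ^ 2 = zf k (Ym k x') y := Real.sq_sqrt (zf_nonneg _ _ _)
    have q3 : d ^ 2 = zf k (Ym k x) x' := Real.sq_sqrt (zf_nonneg _ _ _)
    have h1 : d ^ 2 ≤ 2 * d1 ^ 2 + 2 * d2 ^ 2 := by
      rw [q1, q2, q3]
      simp only [zf]
      nlinarith [sq_nonneg ((Ym k y).1 - (Ym k x).1 + ((Ym k y).1 - (Ym k x').1)),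
        sq_nonneg ((Ym k y).2 - (Ym k x).2 + ((Ym k y).2 - (Ym k x').2))]
    have hd1n : 0 ≤ d1 := Real.sqrt_nonneg _
    have hd2n : 0 ≤ d2 := Real.sqrt_nonneg _
    have h2 : d ≤ 2 * d1 ∨ d ≤ 2 * d2 := by
      rcases le_total d1 d2 with h | h
      · right; apply abs_le_of_sq_le_sq' _ (by positivity) |>.2; nlinarith
      · left; apply abs_le_of_sq_le_sq' _ (by positivity) |>.2; nlinarith
    have hstep : ∀ e : ℝ, d ≤ 2 * e → Λ ≤ Real.log (max 1 (e / ε)) := by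
      intro e he
      apply Real.log_le_log (by positivity)
      apply max_le_max le_rfl
      rw [div_le_div_iff₀ (by positivity) hε]
      nlinarith
    have n1 := LL_nonneg k ε x y
    have n2 := LL_nonneg k ε x' y
    rcases h2 with h | h
    · have : Λ ≤ LL k ε x y := hstep _ h
      linarith
    · have : Λ ≤ LL k ε x' y := hstep _ h
      linarith
  have h1 : Λ * mm p ε q Ω u ≤ 2 * C := by
    have i3 : IntegrableOn (fun y => LL k ε x y * W y + LL k ε x' y * W y) Ω := Integrable.add (iL x) (iL x')
    calc Λ * mm p ε q Ω u = ∫ y in Ω, Λ * W y := (integral_const_mul Λ W).symm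
      _ ≤ ∫ y in Ω, (LL k ε x y * W y + LL k ε x' y * W y) := by
        apply setIntegral_mono_on (Integrable.const_mul iW _) i3 S.hΩ.measurableSet
        intro y hy
        have h0 : 0 ≤ W y := om_nonneg S u hy
        have := hpt y
        nlinarith
      _ = (∫ y in Ω, LL k ε x y * W y) + ∫ y in Ω, LL k ε x' y * W y := integral_add (iL x) (iL x')
      _ ≤ 2 * C := by have := hL x hx; have := hL x' hx'; linarith
  have h2 : Λ ≤ 2 * C / b := by
    rw [le_div_iff₀ hb]; nlinarith
  have h3 : d / (2 * ε) ≤ Real.exp (2 * C / b) := by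
    refine (le_max_right 1 _).trans ?_
    rw [← Real.log_le_iff_le_exp (by positivity)]
    exact h2
  rw [div_le_iff₀ (by positivity)] at h3
  have h4 : eta0 k * dE x x' ≤ d := by
    apply Real.le_sqrt_of_sq_le
    refine le_trans (le_of_eq ?_) (zf_expand hk x x')
    rw [mul_pow, dE, Real.sq_sqrt (by positivity)]
  rw [div_mul_eq_mul_div, le_div_iff₀ he0]
  linarith

lemma core_open {k ε : ℝ} {Ω : Set (ℝ × ℝ)} {q : ℝ × ℝ → ℝ} (S : Setup k Ω q) {u : ℝ × ℝ → ℝ}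
    (hu : ContinuousOn u (closure Ω)) : IsOpen (vcore q Ω ε u) := by
  have hc : ContinuousOn (fun x => u x - q x * Real.log (1 / ε)) Ω :=
    (hu.sub (S.hq2.continuousOn.mul continuousOn_const)).mono subset_closure
  have := hc.isOpen_inter_preimage S.hΩ (isOpen_Ioi (a := (0:ℝ)))
  convert! this using 1
  ext x; simp only [vcore, mem_setOf_eq, mem_inter_iff, mem_preimage, mem_Ioi, sub_pos]

lemma mass_area {k p : ℝ} {Ω : Set (ℝ × ℝ)} {q : ℝ × ℝ → ℝ} (S : Setup k Ω q) (hp : 1 < p)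
    {u : ℝ × ℝ → ℝ} {ε q1 η : ℝ} (hε : 0 < ε) (hη : 0 < η) (hu : ContinuousOn u (closure Ω))
    (hq1 : 0 < q1) (hq : ∀ x ∈ Ω, q x ≤ q1) :
    mm p ε q Ω u ≤ η * EE p ε q Ω u +
      1 / ε ^ 2 * (q1 * (q1 / η) ^ p) * (volume (vcore q Ω ε u)).toReal := by
  set A := vcore q Ω ε u with hA
  set c := 1 / ε ^ 2 * (q1 * (q1 / η) ^ p) with hc
  have hc0 : 0 ≤ c := by positivity
  have hAm : MeasurableSet A := (core_open S hu).measurableSet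
  have hAΩ : A ⊆ Ω := fun x hx => hx.1
  set W := fun y => q y * (1 / ε ^ 2 * pPart (u y - q y * Real.log (1 / ε)) ^ p) with hW
  set V := fun y => 1 / ε ^ 2 * pPart (u y - q y * Real.log (1 / ε)) ^ (p + 1) with hV
  have iW : IntegrableOn W Ω := S.intOn
    (S.hq2.continuousOn.mul (continuousOn_const.mul (v_cont S hu _ (by linarith))))
  have iV : IntegrableOn V Ω := S.intOn (continuousOn_const.mul (v_cont S hu _ (by linarith)))
  have iA : IntegrableOn (A.indicator fun _ => c) Ω :=
    (integrableOn_const (S.vol.ne)).indicator hAm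
  have e1 : ∫ y in Ω, A.indicator (fun _ => c) y = c * (volume A).toReal := by
    rw [setIntegral_indicator hAm, inter_eq_right.2 hAΩ, setIntegral_const, smul_eq_mul, mul_comm]
    rfl
  have j1 : IntegrableOn (fun y => η * V y) Ω := Integrable.const_mul iV _
  have j2 : IntegrableOn (fun y => η * V y + A.indicator (fun _ => c) y) Ω := Integrable.add j1 iA
  calc mm p ε q Ω u = ∫ y in Ω, W y := rfl
    _ ≤ ∫ y in Ω, (η * V y + A.indicator (fun _ => c) y) := by
      apply setIntegral_mono_on iW j2 S.hΩ.measurableSet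
      intro y hy
      have hqy := S.qpos hy
      have hqy1 := hq y hy
      set v := pPart (u y - q y * Real.log (1 / ε)) with hv
      have hv0 : 0 ≤ v := pPart_nonneg _
      have hvp : v ^ (p + 1) = v ^ p * v := by
        rw [Real.rpow_add' hv0 (by linarith), Real.rpow_one]
      have hvp0 : 0 ≤ v ^ p := by positivity
      have hWe : W y = 1 / ε ^ 2 * (q y * v ^ p) := by simp only [hW, ← hv]; ring
      have hVe : V y = 1 / ε ^ 2 * (v ^ p * v) := by simp only [hV, ← hv, hvp]
      have hV0 : 0 ≤ η * V y := by rw [hVe]; positivity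
      by_cases hyA : y ∈ A
      · rw [indicator_of_mem hyA, hWe]
        rcases le_total (q1 / η) v with h | h
        · rw [div_le_iff₀ hη] at h
          have : 1 / ε ^ 2 * (q y * v ^ p) ≤ 1 / ε ^ 2 * ((v * η) * v ^ p) := by
            gcongr; linarith
          rw [hVe]; linarith
        · have : 1 / ε ^ 2 * (q y * v ^ p) ≤ c := by
            rw [hc]; gcongr
          linarith
      · rw [indicator_of_notMem hyA, hWe]
        have : v = 0 := by
          apply pPart_of_nonpos
          by_contra h
          exact hyA ⟨hy, by linarith⟩
        rw [this, Real.zero_rpow (by linarith)]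
        linarith
    _ = _ := by
      rw [integral_add j1 iA, e1, integral_const_mul η V]; rfl

lemma area_diam {A : Set (ℝ × ℝ)} {x : ℝ × ℝ} {D : ℝ} (hD : 0 ≤ D) (h : ∀ y ∈ A, dE x y ≤ D) :
    (volume A).toReal ≤ 4 * D ^ 2 := by
  have hs : A ⊆ Metric.closedBall x.1 D ×ˢ Metric.closedBall x.2 D := by
    intro y hy
    have h1 := h y hy
    have h2 : (x.1 - y.1) ^ 2 + (x.2 - y.2) ^ 2 ≤ D ^ 2 := by
      rw [dE, Real.sqrt_le_left hD] at h1; exact h1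
    constructor
    · rw [Metric.mem_closedBall, dist_comm, Real.dist_eq]
      exact abs_le_of_sq_le_sq (by nlinarith [sq_nonneg (x.2 - y.2)]) hD
    · rw [Metric.mem_closedBall, dist_comm, Real.dist_eq]
      exact abs_le_of_sq_le_sq (by nlinarith [sq_nonneg (x.1 - y.1)]) hD
  have h3 : volume A ≤ ENNReal.ofReal (4 * D ^ 2) := by
    refine (measure_mono hs).trans ?_
    rw [Measure.volume_eq_prod, Measure.prod_prod, Real.volume_closedBall, Real.volume_closedBall,
      ← ENNReal.ofReal_mul (by positivity)]
    apply ENNReal.ofReal_le_ofReal; nlinarith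
  exact ENNReal.toReal_le_of_le_ofReal (by positivity) h3

/-- Proposition 3.9: if the vortex core concentrates at an interior
point `x* ∈ Ω`, then `c_ε = I_ε(u_ε) = π (min_{Ω̄} q²√(det K_H)) ln(1/ε) + O(1)` and
there are `R₁, R₂ > 0` with `R₁ ε ≤ diam(A_ε) ≤ R₂ ε`. -/
theorem statement16 (k p : ℝ) (hk : 0 < k) (hp : 1 < p)
    (Ω : Set (ℝ × ℝ)) (hΩo : IsOpen Ω) (hΩc : IsConnected Ω)
    (hΩb : Bornology.IsBounded Ω) (hΩsc : SimplyConnectedSpace ↥Ω)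
    (q : ℝ × ℝ → ℝ) (hq1 : ContDiffOn ℝ 2 q Ω) (hq2 : ContDiffOn ℝ 1 q (closure Ω))
    (hq3 : ∀ x ∈ closure Ω, 0 < q x) (hq4 : ∀ x ∈ Ω, LH k q x = 0)
    (hmin : ∃ x0 ∈ closure Ω, x0.2 = 0 ∧ ∀ y ∈ closure Ω, Qfun k q x0 ≤ Qfun k q y)
    (u : ℝ → ℝ × ℝ → ℝ)
    (hu : ∀ ε ∈ Set.Ioo (0:ℝ) 1, IsMPSolution k p ε q Ω (u ε))
    (xstar : ℝ × ℝ) (hxΩ : xstar ∈ Ω)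
    (hconc : ∀ xsel : ℝ → ℝ × ℝ,
      (∀ᶠ ε in 𝓝[>] (0:ℝ), xsel ε ∈ vcore q Ω ε (u ε)) →
        Tendsto xsel (𝓝[>] (0:ℝ)) (𝓝 xstar)) :
    (∀ ε ∈ Set.Ioo (0:ℝ) 1, ceps k p q Ω ε = Ieps k p ε q Ω (u ε)) ∧
    (∃ C : ℝ, ∀ᶠ ε in 𝓝[>] (0:ℝ),
      |ceps k p q Ω ε - π * sInf (Qfun k q '' closure Ω) * Real.log (1 / ε)| ≤ C) ∧
    (∃ R₁ > (0:ℝ), ∃ R₂ > (0:ℝ), ∀ᶠ ε in 𝓝[>] (0:ℝ),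
      R₁ * ε ≤ diamE (vcore q Ω ε (u ε)) ∧ diamE (vcore q Ω ε (u ε)) ≤ R₂ * ε) := by
  have S : Setup k Ω q := ⟨hk, hΩo, hΩb, hq1, hq2, hq3, hq4⟩
  have hQ := Q_min S hp hu hxΩ hconc
  have hs : sInf (Qfun k q '' closure Ω) = Qfun k q xstar :=
    IsLeast.csInf_eq ⟨⟨xstar, subset_closure hxΩ, rfl⟩, by rintro _ ⟨y, hy, rfl⟩; exact hQ y hy⟩
  obtain ⟨C, hC, h⟩ := info S hp hu hxΩ hQ
  refine ⟨fun ε hε => (hu ε hε).2.2.symm, ⟨C, ?_⟩, ?_⟩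
  · rw [hs]
    filter_upwards [h] with ε hε using hε.2.2.1
  have hQp := Qfun_pos S (subset_closure hxΩ)
  have hb : 0 < π * Qfun k q xstar := by positivity
  set b := π * Qfun k q xstar with hbd
  obtain ⟨q0, hq0, qs, hqs, hqb⟩ := q_bdd S
  have he0 := eta0_pos hk
  have hη : 0 < b / (2 * (C + 1)) := by positivity
  have hηC : b / (2 * (C + 1)) * C ≤ b / 2 := by
    rw [div_mul_eq_mul_div, div_le_div_iff₀ (by positivity) (by norm_num)]
    nlinarith
  set η := b / (2 * (C + 1)) with hηd
  have hc1 : 0 < qs * (qs / η) ^ p := by positivity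
  set c1 := qs * (qs / η) ^ p with hc1d
  refine ⟨√(b / (8 * c1)), by positivity, 2 * Real.exp (2 * C / b) / eta0 k, by positivity, ?_⟩
  filter_upwards [h] with ε hε
  obtain ⟨hεI, hne, -, hE, hm, hL⟩ := hε
  have hε0 := hεI.1
  have huc : ContinuousOn (u ε) (closure Ω) := (hu ε hεI).1.1
  have hup : ∀ x ∈ vcore q Ω ε (u ε), ∀ y ∈ vcore q Ω ε (u ε),
      dE x y ≤ 2 * Real.exp (2 * C / b) / eta0 k * ε := fun x hx y hy =>
    diam_upper S hp hε0 huc hb hm hL hx hy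
  obtain ⟨x0, hx0⟩ := hne
  have hbdd : BddAbove {d | ∃ a ∈ vcore q Ω ε (u ε), ∃ b ∈ vcore q Ω ε (u ε), d = dE a b} := by
    refine ⟨2 * Real.exp (2 * C / b) / eta0 k * ε, ?_⟩
    rintro _ ⟨x, hx, y, hy, rfl⟩
    exact hup x hx y hy
  have hle : ∀ y ∈ vcore q Ω ε (u ε), dE x0 y ≤ diamE (vcore q Ω ε (u ε)) := fun y hy =>
    le_csSup hbdd ⟨x0, hx0, y, hy, rfl⟩
  constructor
  · have hD : 0 ≤ diamE (vcore q Ω ε (u ε)) := (Real.sqrt_nonneg _).trans (hle x0 hx0)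
    have ha := area_diam hD hle
    have hma := mass_area S hp hε0 hη huc hqs (fun x hx => (hqb x (subset_closure hx)).2)
    rw [← hc1d] at hma
    set D := diamE (vcore q Ω ε (u ε)) with hDd
    have h1 : b / 2 ≤ 1 / ε ^ 2 * c1 * (volume (vcore q Ω ε (u ε))).toReal := by
      have := mul_le_mul_of_nonneg_left hE hη.le
      linarith
    have h2 : b / 2 ≤ 1 / ε ^ 2 * c1 * (4 * D ^ 2) :=
      h1.trans (mul_le_mul_of_nonneg_left ha (by positivity))
    have h3 : b / (8 * c1) * ε ^ 2 ≤ D ^ 2 := by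
      rw [div_mul_eq_mul_div, div_le_iff₀ (by positivity)]
      have h4 : 1 / ε ^ 2 * c1 * (4 * D ^ 2) = (c1 * 4 * D ^ 2) / ε ^ 2 := by ring
      rw [h4, le_div_iff₀ (by positivity)] at h2
      linarith
    apply abs_le_of_sq_le_sq' _ hD |>.2
    rw [mul_pow, Real.sq_sqrt (by positivity)]
    exact h3
  · refine csSup_le ⟨_, x0, hx0, x0, hx0, rfl⟩ ?_
    rintro _ ⟨x, hx, y, hy, rfl⟩
    exact hup x hx y hy
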